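/- arXiv:2504.21253 — 3 statements merged into one kernel-verified Lean document; each statement's English description precedes it below -/
import Mathlib

section
/- Let n ≥ 2, q ∈ [0,n), λ > 0, and let Ω ⊆ ℝⁿ be an open convex set. Let v : Ω → ℝ be continuous, convex and nonnegative with |∂v(E ∩ {v>0})| ≥ λ ∫_{E∩{v>0}} v^q dx for every Borel set E ⊆ Ω. Let K := {x ∈ Ω : v(x) = 0}, and suppose 0 ∈ ∂K and K ⊆ {x : x_n ≥ 0}. Then there exists c > 0, depending only on n, q and λ, such that for every y = (y', y_n) ∈ Ω with y_n ≤ 0 one has v(y) ≥ c · |K ∩ {x : x_n ≤ |y_n|}|^{2/(n−q)}. -/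
open MeasureTheory Set Metric
open scoped RealInnerProductSpace

noncomputable section

/-- The subdifferential of a convex function `v` at `x`, relative to the domain `Ω`. -/
def subgrad {n : ℕ} (Ω : Set (EuclideanSpace ℝ (Fin n))) (v : EuclideanSpace ℝ (Fin n) → ℝ)
    (x : EuclideanSpace ℝ (Fin n)) : Set (EuclideanSpace ℝ (Fin n)) :=
  {p | ∀ y ∈ Ω, v x + ⟪p, y - x⟫ ≤ v y}

/-- The image `∂v(E) = ⋃_{x ∈ E} ∂v(x)` of a set under the subdifferential. -/
def subgradImg {n : ℕ} (Ω : Set (EuclideanSpace ℝ (Fin n))) (v : EuclideanSpace ℝ (Fin n) → ℝ)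
    (E : Set (EuclideanSpace ℝ (Fin n))) : Set (EuclideanSpace ℝ (Fin n)) :=
  ⋃ x ∈ E, subgrad Ω v x

/-- The last coordinate `x_n` of a point of `ℝⁿ`. -/
def lastCoord {n : ℕ} (x : EuclideanSpace ℝ (Fin n)) : ℝ :=
  if h : 0 < n then x ⟨n - 1, by omega⟩ else 0

/-- The first `n-1` coordinates `x'` of a point of `ℝⁿ`. -/
def fstCoords {n : ℕ} (x : EuclideanSpace ℝ (Fin n)) : EuclideanSpace ℝ (Fin (n - 1)) :=
  (EuclideanSpace.equiv (Fin (n - 1)) ℝ).symm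
    (fun i => x ⟨i, lt_of_lt_of_le i.isLt (Nat.sub_le n 1)⟩)

/-- The point `(x', t) ∈ ℝⁿ = ℝ^{n-1} × ℝ`. -/
def app (n : ℕ) (x' : EuclideanSpace ℝ (Fin (n - 1))) (t : ℝ) : EuclideanSpace ℝ (Fin n) :=
  (EuclideanSpace.equiv (Fin n) ℝ).symm
    (fun i => if h : (i : ℕ) < n - 1 then x' ⟨i, h⟩ else t)

open Module (Basis finrank)

/-- The closed coordinate cube of side `2 * r` centred at the origin. -/
def coordCube (n : ℕ) (r : ℝ) : Set (EuclideanSpace ℝ (Fin n)) :=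
  {x | ∀ i, |x i| ≤ r}

theorem volume_coordCube (n : ℕ) {r : ℝ} (hr : 0 ≤ r) :
    volume (coordCube n r) = ENNReal.ofReal ((2 * r) ^ n) := by
  have h : coordCube n r =
      (WithLp.ofLp : EuclideanSpace ℝ (Fin n) → Fin n → ℝ) ⁻¹' closedBall 0 r := by
    ext x
    simp [coordCube, mem_closedBall, dist_zero_right, pi_norm_le_iff_of_nonneg hr]
  rw [h, (PiLp.volume_preserving_ofLp (Fin n)).measure_preimage
    measurableSet_closedBall.nullMeasurableSet, Real.volume_pi_closedBall _ hr, Fintype.card_fin]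

theorem isCompact_coordCube (n : ℕ) (r : ℝ) : IsCompact (coordCube n r) := by
  refine Metric.isCompact_of_isClosed_isBounded ?_ ?_
  · simp only [coordCube, ← Set.iInter_ofPred]
    exact isClosed_iInter fun i => isClosed_le (by fun_prop) continuous_const
  · refine (isBounded_iff_forall_norm_le).2 ⟨√(∑ _i : Fin n, r ^ 2), fun x hx => ?_⟩
    rw [EuclideanSpace.norm_eq]
    refine Real.sqrt_le_sqrt (Finset.sum_le_sum fun i _ => ?_)
    exact pow_le_pow_left₀ (norm_nonneg _) (hx i) 2

theorem det_adjoint_eq {n : ℕ}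
    (L : EuclideanSpace ℝ (Fin n) →ₗ[ℝ] EuclideanSpace ℝ (Fin n)) :
    LinearMap.det (LinearMap.adjoint L) = LinearMap.det L := by
  let b := EuclideanSpace.basisFun (Fin n) ℝ
  rw [← LinearMap.det_toMatrix b.toBasis, ← LinearMap.det_toMatrix b.toBasis L,
    LinearMap.toMatrix_adjoint b b, Matrix.det_conjTranspose, star_trivial]

/-- The volume of a translated linear image of the cube. -/
theorem volume_image_coordCube {n : ℕ}
    (L : EuclideanSpace ℝ (Fin n) →ₗ[ℝ] EuclideanSpace ℝ (Fin n))
    (z : EuclideanSpace ℝ (Fin n)) {r : ℝ} (hr : 0 ≤ r) :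
    volume ((fun x => z + L x) '' coordCube n r) =
      ENNReal.ofReal (|LinearMap.det L| * (2 * r) ^ n) := by
  have h : (fun x => z + L x) '' coordCube n r = (fun x => z + x) '' (L '' coordCube n r) := by
    rw [image_image]
  rw [h, image_add_left, measure_preimage_add, Measure.addHaar_image_linearMap,
    volume_coordCube n hr, ENNReal.ofReal_mul (abs_nonneg _)]

/-- A convex function is at least its value at the centre of a point-symmetric set on at least
half of that set. -/
theorem volume_le_two_mul_superlevel {n : ℕ} {Ω E : Set (EuclideanSpace ℝ (Fin n))}
    {v : EuclideanSpace ℝ (Fin n) → ℝ} {z : EuclideanSpace ℝ (Fin n)}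
    (hv : ConvexOn ℝ Ω v) (hE : E ⊆ Ω) (hsymm : ∀ x ∈ E, (2 : ℝ) • z - x ∈ E) :
    volume E ≤ 2 * volume (E ∩ {x | v z ≤ v x}) := by
  have hcover : E ⊆ (E ∩ {x | v z ≤ v x}) ∪
      (fun x => (2 : ℝ) • z - x) ⁻¹' (E ∩ {x | v z ≤ v x}) := by
    intro x hx
    by_cases h : v z ≤ v x
    · exact Or.inl ⟨hx, h⟩
    · refine Or.inr ⟨hsymm x hx, ?_⟩
      have h2 := hv.2 (hE hx) (hE (hsymm x hx)) (by norm_num : (0 : ℝ) ≤ 1 / 2)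
        (by norm_num : (0 : ℝ) ≤ 1 / 2) (by norm_num)
      have h3 : (1 / 2 : ℝ) • x + (1 / 2 : ℝ) • ((2 : ℝ) • z - x) = z := by module
      rw [h3] at h2
      simp only [smul_eq_mul] at h2
      simp only [mem_ofPred_eq]
      linarith
  calc volume E ≤ _ := measure_mono hcover
    _ ≤ _ := measure_union_le _ _
    _ = _ := by
      have hR : MeasurePreserving (fun x : EuclideanSpace ℝ (Fin n) => (2 : ℝ) • z - x)
          volume volume := Measure.measurePreserving_sub_left _ _
      rw [show (fun x : EuclideanSpace ℝ (Fin n) => (2 : ℝ) • z - x) =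
        (MeasurableEquiv.subLeft ((2 : ℝ) • z)) from rfl] at hR ⊢
      rw [hR.measure_preimage_equiv, two_mul]

/-- The Monge–Ampère inequality on a parallelepiped where `v` is positive and at most `m`. -/
theorem mongeAmpere_parallelepiped {n : ℕ} {q lam : ℝ} (hq0 : 0 ≤ q)
    {Ω : Set (EuclideanSpace ℝ (Fin n))} {v : EuclideanSpace ℝ (Fin n) → ℝ}
    (hvc : ContinuousOn v Ω) (hv : ConvexOn ℝ Ω v) (hlam : 0 < lam)
    (hMA : ∀ E : Set (EuclideanSpace ℝ (Fin n)), MeasurableSet E → E ⊆ Ω →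
          ENNReal.ofReal lam * ∫⁻ x in E ∩ {x | 0 < v x}, ENNReal.ofReal (v x ^ q) ≤
            volume (subgradImg Ω v (E ∩ {x | 0 < v x})))
    {z : EuclideanSpace ℝ (Fin n)} {m : ℝ}
    {L : EuclideanSpace ℝ (Fin n) →ₗ[ℝ] EuclideanSpace ℝ (Fin n)}
    (hL : LinearMap.det L ≠ 0)
    (hbox : ∀ c ∈ coordCube n 1, z + L c ∈ Ω ∧ 0 < v (z + L c) ∧ v (z + L c) ≤ m) :
    lam * v z ^ q * LinearMap.det L ^ 2 ≤ 2 * (4 * m) ^ n := by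
  set d := |LinearMap.det L| with hd
  have hdpos : 0 < d := abs_pos.2 hL
  have hz := hbox 0 (by simp [coordCube])
  rw [map_zero, add_zero] at hz
  have hm : 0 < m := hz.2.1.trans_le hz.2.2
  set E := (fun x => z + L x) '' coordCube n (1 / 2) with hE
  have hhalf : coordCube n (1 / 2) ⊆ coordCube n 1 :=
    fun c hc i => (hc i).trans (by norm_num)
  have hEΩ : E ⊆ Ω := by
    rintro _ ⟨c, hc, rfl⟩; exact (hbox c (hhalf hc)).1
  have hEpos : E ∩ {x | 0 < v x} = E := by
    refine inter_eq_left.2 ?_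
    rintro _ ⟨c, hc, rfl⟩; exact (hbox c (hhalf hc)).2.1
  have hLc : Continuous L := L.continuous_of_finiteDimensional
  have hEcpt : IsCompact E := (isCompact_coordCube n _).image (by fun_prop)
  have hEvol : volume E = ENNReal.ofReal d := by
    rw [hE, volume_image_coordCube L z (by norm_num), hd]; norm_num
  have hsymm : ∀ x ∈ E, (2 : ℝ) • z - x ∈ E := by
    rintro _ ⟨c, hc, rfl⟩
    refine ⟨-c, fun i => by simpa using hc i, ?_⟩
    simp only [map_neg]; module
  have hhalfvol := volume_le_two_mul_superlevel hv hEΩ hsymm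
  have hGmeas : MeasurableSet (E ∩ {x | v z ≤ v x}) :=
    ((hvc.mono hEΩ).preimage_isClosed_of_isClosed hEcpt.isClosed isClosed_Ici).measurableSet
  have hlow : ENNReal.ofReal (v z ^ q) * volume (E ∩ {x | v z ≤ v x}) ≤
      ∫⁻ x in E, ENNReal.ofReal (v x ^ q) := by
    rw [← setLIntegral_const]
    refine (setLIntegral_mono' hGmeas fun x hx => ?_).trans
      (lintegral_mono_set inter_subset_left)
    exact ENNReal.ofReal_le_ofReal (Real.rpow_le_rpow hz.2.1.le hx.2 hq0)
  have hsub : subgradImg Ω v E ⊆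
      (LinearMap.adjoint L) ⁻¹' coordCube n (2 * m) := by
    intro p hp
    simp only [subgradImg, mem_iUnion] at hp
    obtain ⟨_, ⟨c, hc, rfl⟩, hp⟩ := hp
    intro i
    set e : EuclideanSpace ℝ (Fin n) := EuclideanSpace.single i (1 : ℝ) with he
    have hcoord : (LinearMap.adjoint L p) i = ⟪p, L e⟫ := by
      rw [← LinearMap.adjoint_inner_left, he, EuclideanSpace.inner_single_right]; simp
    have key : ∀ s : ℝ, |s| ≤ 1 / 2 → s * ⟪p, L e⟫ ≤ m := by
      intro s hs
      have hmem : c + s • e ∈ coordCube n 1 := by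
        intro j
        have h1 := hc j
        have h2 : |(s • e) j| ≤ 1 / 2 := by
          by_cases hij : j = i
          · subst hij; simpa [he] using hs
          · simp [he, hij]
        calc |(c + s • e) j| = |c j + (s • e) j| := rfl
          _ ≤ |c j| + |(s • e) j| := abs_add_le _ _
          _ ≤ 1 := by linarith
      have h1 := hbox _ hmem
      have h2 := hp _ h1.1
      have h3 := (hbox c (hhalf hc)).2.1
      have h4 : z + L (c + s • e) - (z + L c) = s • L e := by
        rw [map_add, map_smul]; module
      simp only at h2
      rw [h4, real_inner_smul_right] at h2
      linarith [h1.2.2]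
    rw [hcoord, abs_le]
    have k1 := key (1 / 2) (by norm_num)
    have k2 := key (-(1 / 2)) (by norm_num)
    constructor <;> linarith
  have hup : volume (subgradImg Ω v E) ≤ ENNReal.ofReal (d⁻¹ * (4 * m) ^ n) := by
    refine (measure_mono hsub).trans ?_
    refine le_of_eq ?_
    rw [Measure.addHaar_preimage_linearMap _ (by rwa [det_adjoint_eq]), det_adjoint_eq,
      volume_coordCube n (by positivity), ← ENNReal.ofReal_mul (abs_nonneg _), abs_inv,
      show 2 * (2 * m) = 4 * m by ring, hd]
  have hmain := hMA E hEcpt.measurableSet hEΩ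
  rw [hEpos] at hmain
  have hvq : 0 ≤ v z ^ q := Real.rpow_nonneg hz.2.1.le q
  have hfin : ENNReal.ofReal (lam * v z ^ q * d) ≤ ENNReal.ofReal (2 * (d⁻¹ * (4 * m) ^ n)) := by
    calc ENNReal.ofReal (lam * v z ^ q * d)
        = ENNReal.ofReal lam * ENNReal.ofReal (v z ^ q) * volume E := by
          rw [hEvol, ENNReal.ofReal_mul (by positivity), ENNReal.ofReal_mul hlam.le]
      _ ≤ ENNReal.ofReal lam * ENNReal.ofReal (v z ^ q) *
            (2 * volume (E ∩ {x | v z ≤ v x})) := by gcongr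
      _ = 2 * (ENNReal.ofReal lam *
            (ENNReal.ofReal (v z ^ q) * volume (E ∩ {x | v z ≤ v x}))) := by ring
      _ ≤ 2 * (ENNReal.ofReal lam * ∫⁻ x in E, ENNReal.ofReal (v x ^ q)) := by gcongr
      _ ≤ 2 * ENNReal.ofReal (d⁻¹ * (4 * m) ^ n) := by gcongr; exact hmain.trans hup
      _ = _ := by rw [ENNReal.ofReal_mul zero_le_two, ENNReal.ofReal_ofNat]
  rw [ENNReal.ofReal_le_ofReal_iff (by positivity)] at hfin
  have := mul_le_mul_of_nonneg_right hfin hdpos.le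
  rw [← sq_abs, ← hd]
  calc lam * v z ^ q * d ^ 2 = lam * v z ^ q * d * d := by ring
    _ ≤ _ := this
    _ = _ := by field_simp

theorem det_constr_basisFun {n : ℕ} (w : Fin n → EuclideanSpace ℝ (Fin n)) :
    LinearMap.det ((EuclideanSpace.basisFun (Fin n) ℝ).toBasis.constr ℝ w) =
      (EuclideanSpace.basisFun (Fin n) ℝ).toBasis.det w := by
  have h := (EuclideanSpace.basisFun (Fin n) ℝ).toBasis.det_comp
    ((EuclideanSpace.basisFun (Fin n) ℝ).toBasis.constr ℝ w)
    (EuclideanSpace.basisFun (Fin n) ℝ).toBasis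
  rw [Basis.det_self, mul_one] at h
  rw [← h]
  congr 1
  ext1 i
  simp only [Function.comp_apply, Basis.constr_basis]

/-- A set of nonzero volume contains a basis. -/
theorem exists_det_ne_zero_of_volume_ne_zero {n : ℕ} {T : Set (EuclideanSpace ℝ (Fin n))}
    (hT : volume T ≠ 0) :
    ∃ w : Fin n → EuclideanSpace ℝ (Fin n), (∀ i, w i ∈ T) ∧
      (EuclideanSpace.basisFun (Fin n) ℝ).toBasis.det w ≠ 0 := by
  have htop : Submodule.span ℝ T = ⊤ := by
    by_contra h
    exact hT (measure_mono_null Submodule.subset_span (Measure.addHaar_submodule volume _ h))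
  obtain ⟨f, hf, hspan, hli⟩ := Submodule.exists_fun_fin_finrank_span_eq ℝ T
  have hn : finrank ℝ (Submodule.span ℝ T) = n := by
    rw [htop, finrank_top, finrank_euclideanSpace_fin]
  refine ⟨f ∘ finCongr hn.symm, fun i => hf _, ?_⟩
  refine IsUnit.ne_zero (((EuclideanSpace.basisFun (Fin n) ℝ).toBasis.is_basis_iff_det).1 ⟨?_, ?_⟩)
  · exact hli.comp _ (finCongr hn.symm).injective
  · rw [(finCongr hn.symm).surjective.range_comp, hspan, htop]

/-- Linear maps sending the standard basis into `T`, with nearly maximal determinant, capture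
the volume of `T`. -/
theorem exists_linearMap_volume_le {n : ℕ} {T : Set (EuclideanSpace ℝ (Fin n))}
    (hT : volume T ≠ 0) :
    ∃ L : EuclideanSpace ℝ (Fin n) →ₗ[ℝ] EuclideanSpace ℝ (Fin n),
      (∀ i, L (EuclideanSpace.single i 1) ∈ T) ∧ LinearMap.det L ≠ 0 ∧
      (volume T).toReal ≤ 4 ^ n * |LinearMap.det L| := by
  let b := (EuclideanSpace.basisFun (Fin n) ℝ).toBasis
  suffices h : ∃ w : Fin n → EuclideanSpace ℝ (Fin n), (∀ i, w i ∈ T) ∧ b.det w ≠ 0 ∧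
      (volume T).toReal ≤ 4 ^ n * |b.det w| by
    obtain ⟨w, hw, hd, hvol⟩ := h
    refine ⟨b.constr ℝ w, fun i => ?_, ?_, ?_⟩
    · have : b.constr ℝ w (EuclideanSpace.single i 1) = w i := by
        simp [b]
      rw [this]; exact hw i
    · rwa [det_constr_basisFun]
    · rwa [det_constr_basisFun]
  obtain ⟨w₀, hw₀, hd₀⟩ := exists_det_ne_zero_of_volume_ne_zero hT
  let D : Set ℝ := {r | ∃ w : Fin n → EuclideanSpace ℝ (Fin n), (∀ i, w i ∈ T) ∧ r = |b.det w|}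
  have hD₀ : |b.det w₀| ∈ D := ⟨w₀, hw₀, rfl⟩
  have h4 : (1 : ℝ) ≤ 4 ^ n := one_le_pow₀ (by norm_num)
  by_cases hbdd : BddAbove D
  · have hpos : 0 < sSup D := (abs_pos.2 hd₀).trans_le (le_csSup hbdd hD₀)
    obtain ⟨_, ⟨w, hw, rfl⟩, hlt⟩ := exists_lt_of_lt_csSup ⟨_, hD₀⟩ (half_lt_self hpos)
    have hdpos : 0 < |b.det w| := (half_pos hpos).trans hlt
    have hd : b.det w ≠ 0 := abs_pos.1 hdpos
    refine ⟨w, hw, hd, ?_⟩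
    obtain ⟨hli, hsp⟩ := (b.is_basis_iff_det).2 (isUnit_iff_ne_zero.2 hd)
    have hsub : T ⊆ (fun x => 0 + (b.constr ℝ w) x) '' coordCube n 2 := by
      intro x hx
      refine ⟨WithLp.toLp 2 fun i => (Basis.mk hli hsp.ge).coord i x, fun i => ?_, ?_⟩
      · have h1 := LinearMap.congr_fun (b.det_smul_mk_coord_eq_det_update hli hsp.ge i) x
        simp only [LinearMap.smul_apply, smul_eq_mul, MultilinearMap.toLinearMap_apply] at h1
        have h2 : |b.det (Function.update w i x)| ≤ sSup D := by
          refine le_csSup hbdd ⟨_, fun j => ?_, rfl⟩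
          by_cases hij : j = i
          · subst hij; simpa using hx
          · simpa [hij] using hw j
        have h3 : |b.det w| * |(Basis.mk hli hsp.ge).coord i x| ≤ sSup D := by
          rw [← abs_mul, h1]; exact h2
        change |(Basis.mk hli hsp.ge).coord i x| ≤ 2
        by_contra! hc
        nlinarith
      · have h1 := (Basis.mk hli hsp.ge).sum_repr x
        simp only [zero_add, Basis.constr_apply_fintype]
        simpa [b] using h1
    have hvol := measure_mono (μ := volume) hsub
    rw [volume_image_coordCube _ _ (by norm_num), det_constr_basisFun] at hvol
    calc (volume T).toReal ≤ |b.det w| * (2 * 2) ^ n :=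
          ENNReal.toReal_le_of_le_ofReal (by positivity) hvol
      _ = _ := by norm_num; ring
  · rw [not_bddAbove_iff] at hbdd
    obtain ⟨_, ⟨w, hw, rfl⟩, hlt⟩ := hbdd (volume T).toReal
    have hlt' : 0 < |b.det w| := ENNReal.toReal_nonneg.trans_lt hlt
    exact ⟨w, hw, abs_pos.1 hlt', by nlinarith⟩

/-- A convex set containing `s` and all `s + L eᵢ` contains the simplex they span. -/
theorem simplex_subset {n : ℕ} {S : Set (EuclideanSpace ℝ (Fin n))} (hS : Convex ℝ S)
    {s : EuclideanSpace ℝ (Fin n)} (hs : s ∈ S)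
    {L : EuclideanSpace ℝ (Fin n) →ₗ[ℝ] EuclideanSpace ℝ (Fin n)}
    (hL : ∀ i, s + L (EuclideanSpace.single i 1) ∈ S) {c : EuclideanSpace ℝ (Fin n)}
    (hc : ∀ i, 0 ≤ c i) (hc1 : ∑ i, c i ≤ 1) : s + L c ∈ S := by
  have hexp : c = ∑ i, c i • EuclideanSpace.single i (1 : ℝ) := by
    have := (EuclideanSpace.basisFun (Fin n) ℝ).sum_repr c
    simpa using this.symm
  have h := hS.sum_mem (t := Finset.univ)
    (w := fun o : Option (Fin n) => o.elim (1 - ∑ i, c i) fun i => c i)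
    (z := fun o => o.elim s fun i => s + L (EuclideanSpace.single i 1))
    (by rintro (_ | i) _ <;> simp [hc1, hc]) (by simp [Fintype.sum_option])
    (by rintro (_ | i) _ <;> simp [hs, hL])
  convert h using 1
  conv_lhs => rw [hexp]
  simp only [Fintype.sum_option, Option.elim, map_sum, map_smul, smul_add, Finset.sum_add_distrib,
    ← Finset.sum_smul]
  module

/-- The barycentre of the simplex with vertices `s` and `s + L eᵢ`. -/
def simplexCenter {n : ℕ} (s : EuclideanSpace ℝ (Fin n))
    (L : EuclideanSpace ℝ (Fin n) →ₗ[ℝ] EuclideanSpace ℝ (Fin n)) : EuclideanSpace ℝ (Fin n) :=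
  s + L (WithLp.toLp 2 fun _ => ((n : ℝ) + 1)⁻¹)

theorem simplexCenter_add_mem {n : ℕ} (hn : 0 < n) {S : Set (EuclideanSpace ℝ (Fin n))}
    (hS : Convex ℝ S) {s : EuclideanSpace ℝ (Fin n)} (hs : s ∈ S)
    {L : EuclideanSpace ℝ (Fin n) →ₗ[ℝ] EuclideanSpace ℝ (Fin n)}
    (hL : ∀ i, s + L (EuclideanSpace.single i 1) ∈ S) {c : EuclideanSpace ℝ (Fin n)}
    (hc : c ∈ coordCube n 1) :
    simplexCenter s L + ((n : ℝ) * (n + 1))⁻¹ • L c ∈ S := by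
  have hn1 : (1 : ℝ) ≤ n := by exact_mod_cast hn
  have hκ : 0 < ((n : ℝ) * (n + 1))⁻¹ := by positivity
  have hκ1 : (n : ℝ) * ((n : ℝ) * (n + 1))⁻¹ = ((n : ℝ) + 1)⁻¹ := by field_simp
  have hbd := fun i => abs_le.1 (hc i)
  have h := simplex_subset hS hs hL
    (c := WithLp.toLp 2 (fun _ => ((n : ℝ) + 1)⁻¹) + ((n : ℝ) * (n + 1))⁻¹ • c)
    (fun i => by
      simp only [PiLp.add_apply, PiLp.smul_apply, smul_eq_mul]
      nlinarith [(hbd i).1])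
    (by
      calc ∑ i, (WithLp.toLp 2 (fun _ : Fin n => ((n : ℝ) + 1)⁻¹) +
              ((n : ℝ) * (n + 1))⁻¹ • c) i
          ≤ ∑ _i : Fin n, (((n : ℝ) + 1)⁻¹ + ((n : ℝ) * (n + 1))⁻¹) := by
            refine Finset.sum_le_sum fun i _ => ?_
            simp only [PiLp.add_apply, PiLp.smul_apply, smul_eq_mul]
            nlinarith [(hbd i).2]
        _ = 1 := by
            rw [Finset.sum_const, Finset.card_univ, Fintype.card_fin, nsmul_eq_mul]
            field_simp)
  rw [map_add, map_smul, ← add_assoc] at h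
  exact h

theorem simplexCenter_mem {n : ℕ} (hn : 0 < n) {S : Set (EuclideanSpace ℝ (Fin n))}
    (hS : Convex ℝ S) {s : EuclideanSpace ℝ (Fin n)} (hs : s ∈ S)
    {L : EuclideanSpace ℝ (Fin n) →ₗ[ℝ] EuclideanSpace ℝ (Fin n)}
    (hL : ∀ i, s + L (EuclideanSpace.single i 1) ∈ S) : simplexCenter s L ∈ S := by
  simpa using simplexCenter_add_mem hn hS hs hL (c := 0) (by simp [coordCube])

/-- The Monge–Ampère inequality for the parallelepiped obtained by contracting a simplex in the
zero set of `v` towards a point `X`. -/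
theorem mongeAmpere_contracted_simplex {n : ℕ} (hn : 0 < n) {q lam : ℝ} (hq0 : 0 ≤ q)
    {Ω : Set (EuclideanSpace ℝ (Fin n))} {v : EuclideanSpace ℝ (Fin n) → ℝ}
    (hvc : ContinuousOn v Ω) (hv : ConvexOn ℝ Ω v) (hlam : 0 < lam)
    (hMA : ∀ E : Set (EuclideanSpace ℝ (Fin n)), MeasurableSet E → E ⊆ Ω →
          ENNReal.ofReal lam * ∫⁻ x in E ∩ {x | 0 < v x}, ENNReal.ofReal (v x ^ q) ≤
            volume (subgradImg Ω v (E ∩ {x | 0 < v x})))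
    {S : Set (EuclideanSpace ℝ (Fin n))} (hS : Convex ℝ S) (hSΩ : S ⊆ Ω) (hS0 : ∀ x ∈ S, v x = 0)
    {s : EuclideanSpace ℝ (Fin n)} (hs : s ∈ S)
    {L : EuclideanSpace ℝ (Fin n) →ₗ[ℝ] EuclideanSpace ℝ (Fin n)}
    (hL : ∀ i, s + L (EuclideanSpace.single i 1) ∈ S) (hdet : LinearMap.det L ≠ 0)
    {X : EuclideanSpace ℝ (Fin n)} (hX : X ∈ Ω) (hvX : 0 ≤ v X) {θ : ℝ} (hθ0 : 0 < θ) (hθ1 : θ ≤ 1)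
    (hpos : ∀ x ∈ S, 0 < v ((1 - θ) • X + θ • x)) :
    lam * v ((1 - θ) • X + θ • simplexCenter s L) ^ q *
      ((θ * ((n : ℝ) * (n + 1))⁻¹) ^ n * |LinearMap.det L|) ^ 2 ≤ 2 * (4 * v X) ^ n := by
  have hn0 : (0 : ℝ) < n := by exact_mod_cast hn
  set κ := ((n : ℝ) * (n + 1))⁻¹ with hκ
  have hκ0 : 0 < κ := by positivity
  have hdet' : LinearMap.det ((θ * κ) • L) = (θ * κ) ^ n * LinearMap.det L := by
    rw [LinearMap.det_smul, finrank_euclideanSpace_fin]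
  have h := mongeAmpere_parallelepiped hq0 hvc hv hlam hMA
    (z := (1 - θ) • X + θ • simplexCenter s L) (m := v X) (L := (θ * κ) • L)
    (by rw [hdet']; exact mul_ne_zero (by positivity) hdet)
    (fun c hc => by
      have hmem := simplexCenter_add_mem hn hS hs hL hc
      rw [← hκ] at hmem
      have heq : (1 - θ) • X + θ • simplexCenter s L + ((θ * κ) • L) c =
          (1 - θ) • X + θ • (simplexCenter s L + κ • L c) := by
        rw [LinearMap.smul_apply]; module
      rw [heq]
      have hconv := hv.2 hX (hSΩ hmem) (sub_nonneg.2 hθ1) hθ0.le (by ring)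
      rw [hS0 _ hmem] at hconv
      simp only [smul_eq_mul, mul_zero, add_zero] at hconv
      exact ⟨hv.1 hX (hSΩ hmem) (sub_nonneg.2 hθ1) hθ0.le (by ring), hpos _ hmem, by nlinarith⟩)
  rw [hdet'] at h
  rwa [mul_pow, sq_abs, ← mul_pow]

/-- If the Monge–Ampère inequality relates consecutive values `a`, `a'` at scale `2 ^ (-k)`, then
geometric decay propagates from `a` to `a'`. -/
theorem geometric_decay_step {n : ℕ} {q lam κ D C Q a a' θ : ℝ} (hq0 : 0 ≤ q) (hqn : q < n)
    (hlam : 0 < lam) (hκ : 0 < κ) (hD : 0 < D) (hC : 0 < C) (hCn : C ^ ((n : ℝ) - q) = 4 ^ n)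
    (hQ0 : 0 < Q)
    (hQ : Q ^ ((n : ℝ) - q) = lam * C⁻¹ ^ q * ((κ / 8) ^ n) ^ 2 / (2 * 4 ^ n) * D ^ 2)
    {k : ℕ} (ha0 : 0 < a) (hθ : (1 / 2) ^ k / 8 ≤ θ)
    (hMA : lam * a' ^ q * ((θ * κ) ^ n * D) ^ 2 ≤ 2 * (4 * a) ^ n)
    (ha : a < Q * C⁻¹ ^ k) : a' < Q * C⁻¹ ^ (k + 1) := by
  by_contra! hcon
  have hnq : 0 < (n : ℝ) - q := sub_pos.2 hqn
  have hCi : 0 < C⁻¹ := inv_pos.2 hC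
  have haa : a * C⁻¹ ≤ a' := by
    refine le_trans ?_ hcon
    rw [pow_succ, ← mul_assoc]
    exact mul_le_mul_of_nonneg_right ha.le hCi.le
  have h1 : lam * (a * C⁻¹) ^ q * (((1 / 2) ^ k / 8 * κ) ^ n * D) ^ 2 ≤ 2 * (4 * a) ^ n := by
    refine le_trans ?_ hMA
    have : (a * C⁻¹) ^ q ≤ a' ^ q := Real.rpow_le_rpow (by positivity) haa hq0
    have ha' : 0 < a' := (mul_pos ha0 hCi).trans_le haa
    gcongr
  have h2 : a ^ ((n : ℝ) - q) < (Q * C⁻¹ ^ k) ^ ((n : ℝ) - q) :=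
    Real.rpow_lt_rpow ha0.le ha hnq
  have h3 : (C⁻¹ ^ k) ^ ((n : ℝ) - q) = ((4 ^ n)⁻¹) ^ k := by
    rw [← Real.rpow_natCast, ← Real.rpow_mul hCi.le, mul_comm, Real.rpow_mul hCi.le,
      Real.inv_rpow hC.le, hCn, Real.rpow_natCast]
  rw [Real.mul_rpow hQ0.le (by positivity), h3, hQ] at h2
  rw [Real.mul_rpow ha0.le hCi.le] at h1
  have h4 : a ^ n = a ^ ((n : ℝ) - q) * a ^ q := by
    rw [← Real.rpow_add ha0, sub_add_cancel, Real.rpow_natCast]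
  have haq : 0 < a ^ q := Real.rpow_pos_of_pos ha0 q
  have h5 : (((1 / 2 : ℝ) ^ k / 8 * κ) ^ n) ^ 2 = ((κ / 8) ^ n) ^ 2 * ((4 ^ n)⁻¹) ^ k := by
    rw [show (1 / 2 : ℝ) ^ k / 8 * κ = (κ / 8) * (1 / 2) ^ k by ring, mul_pow, mul_pow,
      ← inv_pow, ← pow_mul, ← pow_mul, ← pow_mul, ← pow_mul,
      show (4⁻¹ : ℝ) = (1 / 2) ^ 2 by norm_num, ← pow_mul]
    congr 2
    ring
  rw [mul_pow _ D, h5, mul_pow, h4] at h1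
  have h6 := mul_lt_mul_of_pos_right h2 (mul_pos haq (by positivity : (0 : ℝ) < 2 * 4 ^ n))
  have h7 : lam * C⁻¹ ^ q * ((κ / 8) ^ n) ^ 2 / (2 * 4 ^ n) * D ^ 2 * (4 ^ n)⁻¹ ^ k *
      (a ^ q * (2 * 4 ^ n)) =
      lam * (a ^ q * C⁻¹ ^ q) * (((κ / 8) ^ n) ^ 2 * (4 ^ n)⁻¹ ^ k * D ^ 2) := by
    field_simp
  rw [h7] at h6
  linarith

theorem lastCoord_combo {n : ℕ} (a b : ℝ) (x y : EuclideanSpace ℝ (Fin n)) :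
    lastCoord (a • x + b • y) = a * lastCoord x + b * lastCoord y := by
  unfold lastCoord
  split_ifs <;> simp

theorem volume_lastCoord_eq_zero {n : ℕ} (hn : 0 < n) :
    volume {x : EuclideanSpace ℝ (Fin n) | lastCoord x = 0} = 0 := by
  let p : EuclideanSpace ℝ (Fin n) →L[ℝ] ℝ := EuclideanSpace.proj ⟨n - 1, by omega⟩
  have h : {x : EuclideanSpace ℝ (Fin n) | lastCoord x = 0} =
      (LinearMap.ker (p : EuclideanSpace ℝ (Fin n) →ₗ[ℝ] ℝ) :
        Set (EuclideanSpace ℝ (Fin n))) := by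
    ext x
    simp [lastCoord, hn, p]
  rw [h]
  refine Measure.addHaar_submodule _ _ fun htop => ?_
  have hmem : EuclideanSpace.single (⟨n - 1, by omega⟩ : Fin n) (1 : ℝ) ∈
      LinearMap.ker (p : EuclideanSpace ℝ (Fin n) →ₗ[ℝ] ℝ) := htop ▸ Submodule.mem_top
  simp [p] at hmem

/-- A lower bound for `v y` in terms of the volume of a simplex in the zero set, when `v` is
positive on the half of the cone towards `y`. -/
theorem le_of_simplex_in_zeroSet {n : ℕ} (hn : 0 < n) {q lam : ℝ} (hq0 : 0 ≤ q) (hqn : q < n)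
    {Ω : Set (EuclideanSpace ℝ (Fin n))} {v : EuclideanSpace ℝ (Fin n) → ℝ}
    (hvc : ContinuousOn v Ω) (hv : ConvexOn ℝ Ω v) (hlam : 0 < lam)
    (hMA : ∀ E : Set (EuclideanSpace ℝ (Fin n)), MeasurableSet E → E ⊆ Ω →
          ENNReal.ofReal lam * ∫⁻ x in E ∩ {x | 0 < v x}, ENNReal.ofReal (v x ^ q) ≤
            volume (subgradImg Ω v (E ∩ {x | 0 < v x})))
    {S : Set (EuclideanSpace ℝ (Fin n))} (hS : Convex ℝ S) (hSΩ : S ⊆ Ω) (hS0 : ∀ x ∈ S, v x = 0)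
    {s : EuclideanSpace ℝ (Fin n)} (hs : s ∈ S)
    {L : EuclideanSpace ℝ (Fin n) →ₗ[ℝ] EuclideanSpace ℝ (Fin n)}
    (hL : ∀ i, s + L (EuclideanSpace.single i 1) ∈ S) (hdet : LinearMap.det L ≠ 0)
    {y : EuclideanSpace ℝ (Fin n)} (hy : y ∈ Ω)
    (hpos : ∀ t : ℝ, 0 ≤ t → t < 1 / 2 → ∀ x ∈ S, 0 < v ((1 - t) • y + t • x))
    {C Q : ℝ} (hC : 1 < C) (hCn : C ^ ((n : ℝ) - q) = 4 ^ n) (hQ0 : 0 < Q)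
    (hQ : Q ^ ((n : ℝ) - q) = lam * C⁻¹ ^ q * ((((n : ℝ) * (n + 1))⁻¹ / 8) ^ n) ^ 2 / (2 * 4 ^ n) *
      |LinearMap.det L| ^ 2) : Q ≤ v y := by
  by_contra! hlt
  have hn0 : (0 : ℝ) < n := by exact_mod_cast hn
  set b := simplexCenter s L with hb
  have hbS : b ∈ S := simplexCenter_mem hn hS hs hL
  let τ : ℕ → ℝ := fun k => (1 - (1 / 2) ^ k) / 4
  have hhalf0 : ∀ k : ℕ, (0 : ℝ) < (1 / 2) ^ k := fun k => by positivity
  have hhalf1 : ∀ k : ℕ, (1 / 2 : ℝ) ^ k ≤ 1 := fun k => pow_le_one₀ (by norm_num) (by norm_num)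
  have hτ0 : ∀ k, 0 ≤ τ k := fun k => by
    have := hhalf1 k
    simp only [τ]; linarith
  have hτ1 : ∀ k, τ k < 1 / 4 := fun k => by
    have := hhalf0 k
    simp only [τ]; linarith
  let Z : ℝ → EuclideanSpace ℝ (Fin n) := fun t => (1 - t) • y + t • b
  have hZpos : ∀ t : ℝ, 0 ≤ t → t ≤ 1 / 4 → 0 < v (Z t) := fun t h0 h1 =>
    hpos t h0 (by linarith) b hbS
  have hZΩ : ∀ t : ℝ, 0 ≤ t → t ≤ 1 / 4 → Z t ∈ Ω := fun t h0 h1 =>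
    hv.1 hy (hSΩ hbS) (by linarith) h0 (by ring)
  have hZstep : ∀ τ t : ℝ, τ ≠ 1 →
      Z t = (1 - (t - τ) / (1 - τ)) • Z τ + ((t - τ) / (1 - τ)) • b := by
    intro τ t hτ
    have h1 : 1 - τ ≠ 0 := sub_ne_zero.2 hτ.symm
    have e1 : (1 - (t - τ) / (1 - τ)) * (1 - τ) = 1 - t := by field_simp; ring
    have e2 : (1 - (t - τ) / (1 - τ)) * τ + (t - τ) / (1 - τ) = t := by field_simp; ring
    simp only [Z]
    rw [smul_add, smul_smul, smul_smul, e1, add_assoc, ← add_smul, e2]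
  have hdecay : ∀ k, v (Z (τ k)) < Q * C⁻¹ ^ k := by
    intro k
    induction k with
    | zero => simpa [Z, τ] using hlt
    | succ k ih =>
      have h0 := hτ0 k
      have h1 := hτ1 k
      have hδ : τ (k + 1) - τ k = (1 / 2) ^ k / 8 := by simp only [τ, pow_succ]; ring
      have hδ0 : 0 < τ (k + 1) - τ k := hδ ▸ by positivity
      have ht0 : 0 < τ (k + 1) := by linarith
      have ht1 := hτ1 (k + 1)
      have h1τ : 0 < 1 - τ k := by linarith
      set θ := (τ (k + 1) - τ k) / (1 - τ k) with hθ
      have hθ0 : 0 < θ := div_pos hδ0 h1τ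
      have hθ1 : θ ≤ 1 := (div_le_one h1τ).2 (by linarith)
      have e1 : (1 - θ) * (1 - τ k) = 1 - τ (k + 1) := by rw [hθ]; field_simp; ring
      have e2 : (1 - θ) * τ k + θ = τ (k + 1) := by rw [hθ]; field_simp; ring
      have hpos' : ∀ x ∈ S, 0 < v ((1 - θ) • Z (τ k) + θ • x) := by
        intro x hx
        have hmem : ((1 - θ) * τ k / τ (k + 1)) • b + (θ / τ (k + 1)) • x ∈ S := by
          refine hS hbS hx ?_ (by positivity) ?_
          · exact div_nonneg (mul_nonneg (sub_nonneg.2 hθ1) h0) ht0.le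
          · rw [← add_div, e2, div_self ht0.ne']
        have heq : (1 - θ) • Z (τ k) + θ • x = (1 - τ (k + 1)) • y +
            τ (k + 1) • (((1 - θ) * τ k / τ (k + 1)) • b + (θ / τ (k + 1)) • x) := by
          simp only [Z]
          rw [smul_add, smul_add, smul_smul, smul_smul, smul_smul, smul_smul, e1,
            mul_div_cancel₀ _ ht0.ne', mul_div_cancel₀ _ ht0.ne', add_assoc]
        rw [heq]
        exact hpos _ ht0.le (by linarith) _ hmem
      have hstep := mongeAmpere_contracted_simplex hn hq0 hvc hv hlam hMA hS hSΩ hS0 hs hL hdet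
        (hZΩ _ h0 h1.le) (hZpos _ h0 h1.le).le hθ0 hθ1 hpos'
      rw [← hb, hθ, ← hZstep _ _ (by linarith), ← hθ] at hstep
      refine geometric_decay_step hq0 hqn hlam (by positivity) (abs_pos.2 hdet)
        (by linarith) hCn hQ0 hQ (hZpos _ h0 h1.le) ?_ hstep ih
      rw [← hδ, hθ, le_div_iff₀ h1τ]
      nlinarith
  have hlim : ∀ k, v (Z (1 / 4)) ≤ v (Z (τ k)) := by
    intro k
    have h0 := hτ0 k
    have h1 := hτ1 k
    have h1τ : 0 < 1 - τ k := by linarith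
    have hθ0 : 0 ≤ (1 / 4 - τ k) / (1 - τ k) := div_nonneg (by linarith) h1τ.le
    have hθ1 : (1 / 4 - τ k) / (1 - τ k) ≤ 1 := (div_le_one h1τ).2 (by linarith)
    have h := hv.2 (hZΩ _ h0 h1.le) (hSΩ hbS) (sub_nonneg.2 hθ1) hθ0 (by ring)
    rw [← hZstep _ _ (by linarith), hS0 b hbS] at h
    simp only [smul_eq_mul, mul_zero, add_zero] at h
    nlinarith [hZpos _ h0 h1.le]
  have hlimpos : 0 < v (Z (1 / 4)) := hZpos _ (by norm_num) le_rfl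
  obtain ⟨k, hk⟩ := exists_pow_lt_of_lt_one (div_pos hlimpos hQ0) (inv_lt_one_of_one_lt₀ hC)
  rw [lt_div_iff₀ hQ0] at hk
  linarith [hlim k, hdecay k]

/-- **Lower bound for the growth of `v` away from the coincidence set** (Lemma 2.6):
if `0 ∈ ∂K` and `K ⊆ {x_n ≥ 0}`, then for `y ∈ Ω` with `y_n ≤ 0`,
`v(y) ≥ c(n,q,λ) |K ∩ {x_n ≤ |y_n|}|^{2/(n−q)}`. -/
theorem lower_bound_below_coincidence
    (n : ℕ) (hn : 2 ≤ n) (q lam : ℝ) (hq0 : 0 ≤ q) (hqn : q < n) (hlam : 0 < lam) :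
    ∃ c : ℝ, 0 < c ∧
      ∀ (Ω : Set (EuclideanSpace ℝ (Fin n))) (v : EuclideanSpace ℝ (Fin n) → ℝ),
        IsOpen Ω → Convex ℝ Ω →
        ContinuousOn v Ω → ConvexOn ℝ Ω v → (∀ x ∈ Ω, 0 ≤ v x) →
        (∀ E : Set (EuclideanSpace ℝ (Fin n)), MeasurableSet E → E ⊆ Ω →
          ENNReal.ofReal lam * ∫⁻ x in E ∩ {x | 0 < v x}, ENNReal.ofReal (v x ^ q) ≤
            volume (subgradImg Ω v (E ∩ {x | 0 < v x}))) →
        (0 : EuclideanSpace ℝ (Fin n)) ∈ frontier {x ∈ Ω | v x = 0} →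
        (∀ x ∈ Ω, v x = 0 → 0 ≤ lastCoord x) →
        ∀ y ∈ Ω, lastCoord y ≤ 0 →
          c * (volume ({x ∈ Ω | v x = 0} ∩ {x | lastCoord x ≤ |lastCoord y|})).toReal
              ^ (2 / ((n : ℝ) - q)) ≤ v y := by
  have hnpos : 0 < n := by omega
  have hn0 : (0 : ℝ) < n := by exact_mod_cast hnpos
  have hnq : 0 < (n : ℝ) - q := sub_pos.2 hqn
  set C : ℝ := 4 ^ ((n : ℝ) / (n - q)) with hC
  have hC1 : 1 < C := Real.one_lt_rpow (by norm_num) (div_pos hn0 hnq)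
  have hC0 : 0 < C := by linarith
  have hCn : C ^ ((n : ℝ) - q) = 4 ^ n := by
    rw [hC, ← Real.rpow_mul (by norm_num), div_mul_cancel₀ _ hnq.ne', Real.rpow_natCast]
  set c₁ : ℝ := lam * C⁻¹ ^ q * ((((n : ℝ) * (n + 1))⁻¹ / 8) ^ n) ^ 2 / (2 * 4 ^ n) with hc₁
  have hc₁0 : 0 < c₁ := by positivity
  refine ⟨(c₁ / 16 ^ n) ^ (1 / ((n : ℝ) - q)), by positivity, ?_⟩
  intro Ω v _ hΩ hvc hv hv0 hMA _ hK y hy hyn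
  set S := {x ∈ Ω | v x = 0} ∩ {x | lastCoord x ≤ |lastCoord y|} with hSdef
  by_cases hvol : (volume S).toReal = 0
  · rw [hvol, Real.zero_rpow (by positivity), mul_zero]
    exact hv0 y hy
  have hvol0 : volume S ≠ 0 := fun h => hvol (by rw [h, ENNReal.toReal_zero])
  have hyneg : lastCoord y < 0 := by
    refine lt_of_le_of_ne hyn fun h => hvol0 (measure_mono_null ?_ (volume_lastCoord_eq_zero hnpos))
    rintro x ⟨⟨hxΩ, hx0⟩, hx⟩
    rw [mem_ofPred_eq, h, abs_zero] at hx
    exact le_antisymm hx (hK x hxΩ hx0)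
  have hSΩ : S ⊆ Ω := fun x hx => hx.1.1
  have hS0 : ∀ x ∈ S, v x = 0 := fun x hx => hx.1.2
  have hS : Convex ℝ S := by
    intro x hx x' hx' a b ha hb hab
    have hmem := hΩ (hSΩ hx) (hSΩ hx') ha hb hab
    refine ⟨⟨hmem, le_antisymm ?_ (hv0 _ hmem)⟩, ?_⟩
    · have := hv.2 (hSΩ hx) (hSΩ hx') ha hb hab
      simpa [hS0 x hx, hS0 x' hx'] using this
    · rw [mem_ofPred_eq, lastCoord_combo]
      have h1 := mul_le_mul_of_nonneg_left hx.2 ha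
      have h2 := mul_le_mul_of_nonneg_left hx'.2 hb
      calc _ ≤ a * |lastCoord y| + b * |lastCoord y| := add_le_add h1 h2
        _ = |lastCoord y| := by rw [← add_mul, hab, one_mul]
  obtain ⟨s, hs⟩ := nonempty_of_measure_ne_zero hvol0
  have hT : volume ((fun x => s + x) ⁻¹' S) = volume S := measure_preimage_add _ _ _
  obtain ⟨L, hL, hdet, hLvol⟩ := exists_linearMap_volume_le (hT.trans_ne hvol0)
  rw [hT] at hLvol
  have hpos : ∀ t : ℝ, 0 ≤ t → t < 1 / 2 → ∀ x ∈ S, 0 < v ((1 - t) • y + t • x) := by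
    intro t ht0 ht1 x hx
    have hmem := hΩ hy (hSΩ hx) (by linarith : 0 ≤ 1 - t) ht0 (by ring)
    refine lt_of_le_of_ne (hv0 _ hmem) fun h0 => ?_
    have h1 := hK _ hmem h0.symm
    rw [lastCoord_combo] at h1
    have h2 := hx.2
    rw [mem_ofPred_eq, abs_of_neg hyneg] at h2
    nlinarith [mul_le_mul_of_nonneg_left h2 ht0]
  have hd0 : 0 < |LinearMap.det L| := abs_pos.2 hdet
  have hmain := le_of_simplex_in_zeroSet hnpos hq0 hqn hvc hv hlam hMA hS hSΩ hS0 hs hL hdet hy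
    hpos hC1 hCn (Q := (c₁ * |LinearMap.det L| ^ 2) ^ (1 / ((n : ℝ) - q))) (by positivity)
    (by rw [← Real.rpow_mul (by positivity), one_div_mul_cancel hnq.ne', Real.rpow_one])
  refine le_trans ?_ hmain
  have hexp : (volume S).toReal ^ (2 / ((n : ℝ) - q)) =
      ((volume S).toReal ^ 2) ^ (1 / ((n : ℝ) - q)) := by
    rw [← Real.rpow_natCast, ← Real.rpow_mul ENNReal.toReal_nonneg]
    congr 1
    push_cast
    ring
  rw [hexp, ← Real.mul_rpow (by positivity) (by positivity)]
  refine Real.rpow_le_rpow (by positivity) ?_ (by positivity)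
  have hsq := pow_le_pow_left₀ ENNReal.toReal_nonneg hLvol 2
  calc c₁ / 16 ^ n * (volume S).toReal ^ 2
      ≤ c₁ / 16 ^ n * (4 ^ n * |LinearMap.det L|) ^ 2 := by gcongr
    _ = c₁ * |LinearMap.det L| ^ 2 := by
      rw [mul_pow, ← pow_mul, mul_comm n 2, pow_mul, show (4 : ℝ) ^ 2 = 16 by norm_num]
      field_simp
end
end

section
/- Let n ≥ 2, q ∈ [0,n), let Ω ⊆ ℝⁿ be a bounded open convex set, let μ₀ be a finite nonnegative Borel measure on Ω, and let φ : Ω̄ → ℝ be a continuous convex function with φ ≥ 0 on ∂Ω. Define 𝒟 := { w : Ω̄ → ℝ continuous : w ≥ 0, w convex, w = φ on ∂Ω, and |∂w(E)| ≤ ∫_E w^q dμ₀ for every Borel set E ⊆ Ω }, and let v(x) := inf { w(x) : w ∈ 𝒟 } for x ∈ Ω̄. Then 𝒟 is nonempty, v ∈ 𝒟, and |∂v(E)| = ∫_E v^q dμ₀ for every Borel set E ⊆ {x ∈ Ω : v(x) > 0}. -/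
open MeasureTheory Set Metric
open scoped RealInnerProductSpace

noncomputable section

/-- The admissible class `𝒟_{μ₀,φ}`: nonnegative continuous convex functions on `Ω̄`,
equal to `φ` on `∂Ω`, with Monge–Ampère measure `≤ w^q μ₀`. -/
def obstacleClass (n : ℕ) (q : ℝ) (Ω : Set (EuclideanSpace ℝ (Fin n)))
    (μ₀ : Measure (EuclideanSpace ℝ (Fin n))) (φ : EuclideanSpace ℝ (Fin n) → ℝ) :
    Set (EuclideanSpace ℝ (Fin n) → ℝ) :=
  {w | ContinuousOn w (closure Ω) ∧ (∀ x ∈ closure Ω, 0 ≤ w x) ∧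
    ConvexOn ℝ (closure Ω) w ∧ (∀ x ∈ frontier Ω, w x = φ x) ∧
    ∀ E : Set (EuclideanSpace ℝ (Fin n)), MeasurableSet E → E ⊆ Ω →
      volume (subgradImg Ω w E) ≤ ∫⁻ x in E, ENNReal.ofReal (w x ^ q) ∂μ₀}

/-- The Perron infimum `v = inf { w : w ∈ 𝒟_{μ₀,φ} }`. -/
def obstacleInf (n : ℕ) (q : ℝ) (Ω : Set (EuclideanSpace ℝ (Fin n)))
    (μ₀ : Measure (EuclideanSpace ℝ (Fin n))) (φ : EuclideanSpace ℝ (Fin n) → ℝ)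
    (x : EuclideanSpace ℝ (Fin n)) : ℝ :=
  ⨅ w : obstacleClass n q Ω μ₀ φ, w.1 x

section

open Filter Topology
open scoped ENNReal NNReal

/-- A convex function on an open set has a subgradient at each point. -/
theorem subgrad_nonempty {n : ℕ} {Ω : Set (EuclideanSpace ℝ (Fin n))} (hΩo : IsOpen Ω)
    {w : EuclideanSpace ℝ (Fin n) → ℝ} (hw : ConvexOn ℝ Ω w)
    {x : EuclideanSpace ℝ (Fin n)} (hx : x ∈ Ω) : (subgrad Ω w x).Nonempty := by
  have hcont : ContinuousOn w Ω := hw.continuousOn hΩo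
  have hopen : IsOpen {p : EuclideanSpace ℝ (Fin n) × ℝ | p.1 ∈ Ω ∧ w p.1 < p.2} := by
    have h1 : ContinuousOn (fun p : EuclideanSpace ℝ (Fin n) × ℝ => p.2 - w p.1)
        (Prod.fst ⁻¹' Ω) :=
      continuous_snd.continuousOn.sub (hcont.comp continuous_fst.continuousOn fun _ h => h)
    convert h1.isOpen_inter_preimage (hΩo.preimage continuous_fst)
      (isOpen_Ioi (a := (0 : ℝ))) using 1
    ext p
    simp
  obtain ⟨f, hf⟩ := geometric_hahn_banach_open_point hw.convex_strict_epigraph hopen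
    (x := (x, w x)) (by simp)
  set a : StrongDual ℝ (EuclideanSpace ℝ (Fin n)) :=
    f.comp (ContinuousLinearMap.inl ℝ (EuclideanSpace ℝ (Fin n)) ℝ) with ha
  set b : ℝ := f (0, 1) with hb
  have hfab : ∀ y s, f (y, s) = a y + s * b := by
    intro y s
    have : ((y, s) : EuclideanSpace ℝ (Fin n) × ℝ) = (y, 0) + s • (0, 1) := by simp
    rw [this, map_add, map_smul]
    simp [ha, hb]
  have hlt : ∀ y ∈ Ω, ∀ s, w y < s → a y + s * b < a x + w x * b := by
    intro y hy s hs
    have := hf (y, s) ⟨hy, hs⟩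
    rwa [hfab, hfab] at this
  have hb0 : b < 0 := by
    have := hlt x hx (w x + 1) (by linarith)
    linarith
  have hle : ∀ y ∈ Ω, a y + w y * b ≤ a x + w x * b := by
    intro y hy
    by_contra! hcon
    have := hlt y hy (w y + (a y + w y * b - (a x + w x * b)) / (-b))
      (by have := div_pos (sub_pos.2 hcon) (neg_pos.2 hb0); linarith)
    have h2 : (a y + w y * b - (a x + w x * b)) / (-b) * b
        = -(a y + w y * b - (a x + w x * b)) := by
      rw [div_neg, neg_mul, div_mul_cancel₀ _ hb0.ne]
    rw [add_mul, h2] at this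
    linarith
  refine ⟨(-b⁻¹) • (InnerProductSpace.toDual ℝ (EuclideanSpace ℝ (Fin n))).symm a, ?_⟩
  intro y hy
  rw [inner_smul_left, InnerProductSpace.toDual_symm_apply, map_sub]
  have := hle y hy
  simp only [conj_trivial]
  have h3 : w x + -b⁻¹ * (a y - a x) - w y = (-b)⁻¹ * ((a y + w y * b) - (a x + w x * b)) := by
    have hb' := hb0.ne
    field_simp
    ring
  have h4 : (-b)⁻¹ * ((a y + w y * b) - (a x + w x * b)) ≤ 0 :=
    mul_nonpos_of_nonneg_of_nonpos (inv_nonneg.2 (by linarith)) (by linarith)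
  linarith

theorem le_of_mem_subgrad_of_mem_closure {n : ℕ} {Ω : Set (EuclideanSpace ℝ (Fin n))}
    {w : EuclideanSpace ℝ (Fin n) → ℝ} (hw : ContinuousOn w (closure Ω))
    {x p : EuclideanSpace ℝ (Fin n)} (hp : p ∈ subgrad Ω w x) :
    ∀ y ∈ closure Ω, w x + ⟪p, y - x⟫ ≤ w y := fun y hy =>
  le_on_closure (f := fun y => w x + ⟪p, y - x⟫) hp (by fun_prop) hw hy

theorem subgradImg_mono {n : ℕ} {Ω E F : Set (EuclideanSpace ℝ (Fin n))}
    {w : EuclideanSpace ℝ (Fin n) → ℝ} (h : E ⊆ F) : subgradImg Ω w E ⊆ subgradImg Ω w F :=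
  biUnion_subset_biUnion_left h

theorem mem_subgradImg {n : ℕ} {Ω E : Set (EuclideanSpace ℝ (Fin n))}
    {w : EuclideanSpace ℝ (Fin n) → ℝ} {p : EuclideanSpace ℝ (Fin n)} :
    p ∈ subgradImg Ω w E ↔ ∃ x ∈ E, p ∈ subgrad Ω w x := by
  simp [subgradImg]

/-- If an affine function with slope `p` touches `w` at a point of `G` but lies strictly below
`w` on the boundary of `G`, then `p` is a subgradient of `w` at some point of `G`. -/
theorem mem_subgradImg_of_lt_frontier {n : ℕ} {Ω G : Set (EuclideanSpace ℝ (Fin n))}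
    (hΩb : Bornology.IsBounded Ω) {w : EuclideanSpace ℝ (Fin n) → ℝ}
    (hw : ConvexOn ℝ (closure Ω) w) (hwc : ContinuousOn w (closure Ω))
    (hGo : IsOpen G) (hG : G ⊆ Ω) {x₀ p : EuclideanSpace ℝ (Fin n)} (hx₀ : x₀ ∈ G)
    (h : ∀ y ∈ frontier G, w x₀ + ⟪p, y - x₀⟫ < w y) : p ∈ subgradImg Ω w G := by
  have hGc : IsCompact (closure G) := (hΩb.subset hG).isCompact_closure
  obtain ⟨x₁, hx₁, hmin⟩ := hGc.exists_isMinOn ⟨x₀, subset_closure hx₀⟩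
    (f := fun y => w y - ⟪p, y⟫) ((hwc.mono (closure_mono hG)).sub (by fun_prop))
  have hx₁G : x₁ ∈ G := by
    by_contra hn
    have h1 := h x₁ (by rw [hGo.frontier_eq]; exact ⟨hx₁, hn⟩)
    have h2 := hmin (subset_closure hx₀)
    simp only [mem_ofPred_eq] at h2
    rw [inner_sub_right] at h1
    linarith
  have hconv : ConvexOn ℝ (closure Ω) fun y => w y - ⟪p, y⟫ :=
    hw.sub ((innerₛₗ ℝ p).concaveOn hw.1)
  have hmem : x₁ ∈ closure Ω := subset_closure (hG hx₁G)
  have hmin' : IsMinOn (fun y => w y - ⟪p, y⟫) (closure Ω) x₁ := by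
    refine IsMinOn.of_isLocalMinOn_of_convexOn hmem ?_ hconv
    refine (IsMinOn.isLocalMin (s := closure G) hmin ?_).on _
    exact mem_of_superset (hGo.mem_nhds hx₁G) subset_closure
  refine mem_subgradImg.2 ⟨x₁, hx₁G, fun y hy => ?_⟩
  have := hmin' (subset_closure hy)
  simp only [mem_ofPred_eq] at this
  rw [inner_sub_right]
  linarith

/-- The slopes of affine functions supporting `w` at two different points of `closure Ω`. -/
def multiSlopes {n : ℕ} (Ω : Set (EuclideanSpace ℝ (Fin n)))
    (w : EuclideanSpace ℝ (Fin n) → ℝ) : Set (EuclideanSpace ℝ (Fin n)) :=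
  {p | ∃ x ∈ closure Ω, ∃ y ∈ closure Ω, x ≠ y ∧ (∀ z ∈ closure Ω, w x + ⟪p, z - x⟫ ≤ w z) ∧
    ∀ z ∈ closure Ω, w y + ⟪p, z - y⟫ ≤ w z}

/-- The conjugate function is differentiable almost everywhere, and its gradient is the unique
point of support. -/
theorem volume_multiSlopes {n : ℕ} {Ω : Set (EuclideanSpace ℝ (Fin n))}
    (hΩb : Bornology.IsBounded Ω) {w : EuclideanSpace ℝ (Fin n) → ℝ}
    (hwc : ContinuousOn w (closure Ω)) : volume (multiSlopes Ω w) = 0 := by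
  rcases Ω.eq_empty_or_nonempty with rfl | hne
  · simp [multiSlopes]
  have hcomp : IsCompact (closure Ω) := hΩb.isCompact_closure
  have : Nonempty (closure Ω) := hne.closure.to_subtype
  set U : EuclideanSpace ℝ (Fin n) → ℝ := fun p =>
    ⨆ z : closure Ω, (⟪p, (z : EuclideanSpace ℝ (Fin n))⟫ - w z) with hU
  have hbdd : ∀ p : EuclideanSpace ℝ (Fin n),
      BddAbove (range fun z : closure Ω => (⟪p, (z : EuclideanSpace ℝ (Fin n))⟫ - w z)) := by
    intro p
    have := hcomp.bddAbove_image (f := fun z => ⟪p, z⟫ - w z)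
      (ContinuousOn.sub (by fun_prop) hwc)
    rwa [image_eq_range] at this
  have hle : ∀ p, ∀ z ∈ closure Ω, ⟪p, z⟫ - w z ≤ U p := fun p z hz =>
    le_ciSup (hbdd p) ⟨z, hz⟩
  obtain ⟨R, hR⟩ := hcomp.isBounded.exists_norm_le
  have hlip : LipschitzWith R.toNNReal U := by
    refine LipschitzWith.of_le_add_mul _ fun p p' => ciSup_le fun z => ?_
    have h1 := hle p' z z.2
    have h2 : ⟪p - p', (z : EuclideanSpace ℝ (Fin n))⟫ ≤
        ‖p - p'‖ * ‖(z : EuclideanSpace ℝ (Fin n))‖ :=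
      real_inner_le_norm _ _
    have h3 := hR z z.2
    have h4 : ‖p - p'‖ * ‖(z : EuclideanSpace ℝ (Fin n))‖ ≤ ‖p - p'‖ * R := by gcongr
    rw [inner_sub_left] at h2
    rw [dist_eq_norm, Real.coe_toNNReal _ ((norm_nonneg _).trans h3)]
    linarith
  refine measure_mono_null ?_ (hlip.ae_differentiableAt (μ := volume))
  rintro p ⟨x, hx, y, hy, hxy, hpx, hpy⟩ hdiff
  have key : ∀ x ∈ closure Ω, (∀ z ∈ closure Ω, w x + ⟪p, z - x⟫ ≤ w z) →
      fderiv ℝ U p = innerSL ℝ x := by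
    intro x hx hpx
    have hUp : U p = ⟪p, x⟫ - w x := by
      refine le_antisymm (ciSup_le fun z => ?_) (hle p x hx)
      have := hpx z z.2
      rw [inner_sub_right] at this
      linarith
    have hd : HasFDerivAt (fun p' => U p' - innerSL ℝ x p') (fderiv ℝ U p - innerSL ℝ x) p :=
      hdiff.hasFDerivAt.sub (innerSL ℝ x).hasFDerivAt
    have hmin : IsLocalMin (fun p' => U p' - innerSL ℝ x p') p := by
      refine Filter.Eventually.of_forall fun p' => ?_
      have := hle p' x hx
      simp only [innerSL_apply_apply, hUp, real_inner_comm _ x]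
      linarith
    exact sub_eq_zero.1 (hmin.hasFDerivAt_eq_zero hd)
  have h := (key x hx hpx).symm.trans (key y hy hpy)
  exact hxy (innerSL_inj.1 h)

/-- Lower semicontinuity of the Monge–Ampère measure on open sets. -/
theorem volume_subgradImg_le_liminf {n : ℕ} {Ω : Set (EuclideanSpace ℝ (Fin n))}
    (hΩb : Bornology.IsBounded Ω) {w : ℕ → EuclideanSpace ℝ (Fin n) → ℝ}
    {v : EuclideanSpace ℝ (Fin n) → ℝ}
    (hw : ∀ k, ConvexOn ℝ (closure Ω) (w k)) (hwc : ∀ k, ContinuousOn (w k) (closure Ω))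
    (hvc : ContinuousOn v (closure Ω)) (hlim : TendstoUniformlyOn w v atTop (closure Ω))
    {U : Set (EuclideanSpace ℝ (Fin n))} (hUo : IsOpen U) (hU : U ⊆ Ω) :
    volume (subgradImg Ω v U) ≤ liminf (fun k => volume (subgradImg Ω (w k) U)) atTop := by
  set A : ℕ → Set (EuclideanSpace ℝ (Fin n)) := fun N => ⋂ k ≥ N, subgradImg Ω (w k) U with hA
  have hsub : subgradImg Ω v U ⊆ multiSlopes Ω v ∪ ⋃ N, A N := by
    intro p hp
    by_cases hpm : p ∈ multiSlopes Ω v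
    · exact Or.inl hpm
    right
    obtain ⟨x, hxU, hpx⟩ := mem_subgradImg.1 hp
    have hpx' := le_of_mem_subgrad_of_mem_closure hvc hpx
    have hfr : frontier U ⊆ closure Ω := frontier_subset_closure.trans (closure_mono hU)
    have hstrict : ∀ y ∈ frontier U, 0 < v y - (v x + ⟪p, y - x⟫) := by
      intro y hy
      have hyx : x ≠ y := by
        rintro rfl
        rw [hUo.frontier_eq] at hy
        exact hy.2 hxU
      by_contra! hcon
      refine hpm ⟨x, subset_closure (hU hxU), y, hfr hy, hyx, hpx', fun z hz => ?_⟩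
      have h1 := hpx' z hz
      rw [inner_sub_right] at h1 hcon ⊢
      linarith
    have hcomp : IsCompact (frontier U) :=
      (hΩb.subset hU).isCompact_closure.of_isClosed_subset isClosed_frontier
        frontier_subset_closure
    obtain ⟨δ, hδ, hδle⟩ := hcomp.exists_forall_le' (f := fun y => v y - (v x + ⟪p, y - x⟫))
      ((hvc.mono hfr).sub (by fun_prop)) hstrict
    have hev := Metric.tendstoUniformlyOn_iff.1 hlim (δ / 2) (by positivity)
    obtain ⟨N, hN⟩ := eventually_atTop.1 hev
    refine mem_iUnion.2 ⟨N, mem_iInter₂.2 fun k hk => ?_⟩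
    refine mem_subgradImg_of_lt_frontier hΩb (hw k) (hwc k) hUo hU hxU fun y hy => ?_
    have h1 := hN k hk x (subset_closure (hU hxU))
    have h2 := hN k hk y (hfr hy)
    have h3 := hδle y hy
    rw [Real.dist_eq, abs_lt] at h1 h2
    linarith [h1.1, h1.2, h2.1, h2.2]
  have hmono : Monotone A := fun N N' hNN' =>
    biInter_mono (fun k hk => le_trans hNN' hk) fun _ _ => subset_rfl
  calc volume (subgradImg Ω v U) ≤ volume (multiSlopes Ω v ∪ ⋃ N, A N) := measure_mono hsub
    _ ≤ volume (multiSlopes Ω v) + volume (⋃ N, A N) := measure_union_le _ _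
    _ = ⨆ N, volume (A N) := by
        rw [volume_multiSlopes hΩb hvc, zero_add, hmono.measure_iUnion]
    _ ≤ _ := by
        rw [liminf_eq_iSup_iInf_of_nat]
        exact iSup_mono fun N => le_iInf₂ fun k hk => measure_mono (biInter_subset_of_mem hk)

theorem norm_le_of_mem_subgrad {n : ℕ} {Ω : Set (EuclideanSpace ℝ (Fin n))}
    {w : EuclideanSpace ℝ (Fin n) → ℝ} {M r : ℝ} (hM : ∀ x ∈ Ω, |w x| ≤ M) (hr : 0 < r)
    {x p : EuclideanSpace ℝ (Fin n)} (hx : closedBall x r ⊆ Ω) (hp : p ∈ subgrad Ω w x) :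
    ‖p‖ ≤ 2 * M / r := by
  have h1 := hM x (hx (mem_closedBall_self hr.le))
  have hM0 : 0 ≤ M := (abs_nonneg _).trans h1
  rcases eq_or_ne p 0 with rfl | hp0
  · simp only [norm_zero]
    positivity
  have hn : 0 < ‖p‖ := norm_pos_iff.2 hp0
  have hy : x + (r / ‖p‖) • p ∈ closedBall x r := by
    rw [mem_closedBall, dist_eq_norm, add_sub_cancel_left, norm_smul, Real.norm_of_nonneg
      (by positivity), div_mul_cancel₀ _ hn.ne']
  have h2 := hM _ (hx hy)
  have h3 := hp _ (hx hy)
  rw [add_sub_cancel_left, inner_smul_right, real_inner_self_eq_norm_sq] at h3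
  have h4 : r / ‖p‖ * ‖p‖ ^ 2 = ‖p‖ * r := by
    field_simp
  rw [h4] at h3
  rw [abs_le] at h1 h2
  rw [le_div_iff₀ hr]
  linarith [h1.1, h2.2]

/-- Upper semicontinuity of the subdifferential along uniformly convergent sequences. -/
theorem eventually_subgradImg_subset {n : ℕ} {Ω : Set (EuclideanSpace ℝ (Fin n))}
    (hΩo : IsOpen Ω) {w : ℕ → EuclideanSpace ℝ (Fin n) → ℝ}
    {v : EuclideanSpace ℝ (Fin n) → ℝ} {M : ℝ} (hM : ∀ k, ∀ x ∈ Ω, |w k x| ≤ M)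
    (hvc : ContinuousOn v Ω) (hlim : TendstoUniformlyOn w v atTop Ω)
    {K : Set (EuclideanSpace ℝ (Fin n))} (hK : IsCompact K) (hKΩ : K ⊆ Ω)
    {V : Set (EuclideanSpace ℝ (Fin n))} (hVo : IsOpen V) (hV : subgradImg Ω v K ⊆ V) :
    ∃ δ > 0, cthickening δ K ⊆ Ω ∧
      ∀ᶠ k in atTop, subgradImg Ω (w k) (cthickening δ K) ⊆ V := by
  obtain ⟨δ₀, hδ₀, hδ₀Ω⟩ := hK.exists_cthickening_subset_open hΩo hKΩ
  by_contra! hcon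
  have hδ : ∀ j : ℕ, 0 < δ₀ / 2 * (1 / ((j : ℝ) + 1)) := fun j => by positivity
  have hδle : ∀ j : ℕ, δ₀ / 2 * (1 / ((j : ℝ) + 1)) ≤ δ₀ / 2 := fun j =>
    mul_le_of_le_one_right (by positivity) (by
      rw [div_le_one (by positivity)]
      linarith [Nat.cast_nonneg (α := ℝ) j])
  have hex : ∀ j : ℕ, ∃ k ≥ j, ∃ x ∈ cthickening (δ₀ / 2 * (1 / ((j : ℝ) + 1))) K,
      ∃ p ∈ subgrad Ω (w k) x, p ∉ V := by
    intro j
    have h := hcon _ (hδ j) ((cthickening_mono (by linarith [hδle j]) K).trans hδ₀Ω)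
    obtain ⟨k, hk, hk'⟩ := (frequently_atTop.1 h) j
    obtain ⟨p, hp, hpV⟩ := not_subset.1 hk'
    obtain ⟨x, hx, hpx⟩ := mem_subgradImg.1 hp
    exact ⟨k, hk, x, hx, p, hpx, hpV⟩
  choose k hk x hx p hp hpV using hex
  have hxK : ∀ j, x j ∈ cthickening (δ₀ / 2) K := fun j => cthickening_mono (hδle j) K (hx j)
  have hball : ∀ j, closedBall (x j) (δ₀ / 2) ⊆ Ω := by
    intro j
    refine (closedBall_subset_cthickening (hxK j) (δ₀ / 2)).trans
      ((cthickening_cthickening_subset (by positivity) (by positivity) K).trans ?_)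
    rwa [add_halves]
  have hpb : ∀ j, p j ∈ closedBall (0 : EuclideanSpace ℝ (Fin n)) (2 * M / (δ₀ / 2)) := by
    intro j
    rw [mem_closedBall_zero_iff]
    exact norm_le_of_mem_subgrad (hM (k j)) (by positivity) (hball j) (hp j)
  obtain ⟨⟨a, b⟩, hab, ψ, hψ, htends⟩ :=
    ((hK.cthickening (r := δ₀ / 2)).prod
      (isCompact_closedBall (0 : EuclideanSpace ℝ (Fin n)) (2 * M / (δ₀ / 2)))).tendsto_subseq
      (x := fun j => (x j, p j)) (fun j => ⟨hxK j, hpb j⟩)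
  have hta : Tendsto (fun j => x (ψ j)) atTop (𝓝 a) := (continuous_fst.tendsto _).comp htends
  have htb : Tendsto (fun j => p (ψ j)) atTop (𝓝 b) := (continuous_snd.tendsto _).comp htends
  have haΩ : a ∈ Ω := hδ₀Ω (cthickening_mono (by linarith) K hab.1)
  have hxΩ : ∀ j, x j ∈ Ω := fun j => hball j (mem_closedBall_self (by positivity))
  have haK : a ∈ K := by
    have hKne : K.Nonempty := by
      by_contra hne
      rw [not_nonempty_iff_eq_empty] at hne
      have := hx 0
      simp [hne] at this
    have h1 : ∀ j, infDist (x (ψ j)) K ≤ δ₀ / 2 * (1 / ((ψ j : ℝ) + 1)) := fun j =>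
      ENNReal.toReal_le_of_le_ofReal (hδ _).le (mem_cthickening_iff.1 (hx (ψ j)))
    have h2 : Tendsto (fun j => δ₀ / 2 * (1 / ((ψ j : ℝ) + 1))) atTop (𝓝 0) := by
      simpa using (tendsto_one_div_add_atTop_nhds_zero_nat (𝕜 := ℝ)).comp hψ.tendsto_atTop
        |>.const_mul (δ₀ / 2)
    have h3 : Tendsto (fun j => infDist (x (ψ j)) K) atTop (𝓝 (infDist a K)) :=
      ((continuous_infDist_pt K).tendsto a).comp hta
    have h4 : infDist a K ≤ 0 := le_of_tendsto_of_tendsto' h3 h2 h1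
    exact (hK.isClosed.mem_iff_infDist_zero hKne).2 (le_antisymm h4 infDist_nonneg)
  have hkt : Tendsto (fun j => k (ψ j)) atTop atTop :=
    tendsto_atTop_mono (fun j => hk (ψ j)) hψ.tendsto_atTop
  have hbsub : b ∈ subgrad Ω v a := by
    intro y hy
    have h1 : Tendsto (fun j => w (k (ψ j)) y) atTop (𝓝 (v y)) :=
      (hlim.tendsto_at hy).comp hkt
    have h2 : Tendsto (fun j => v (x (ψ j))) atTop (𝓝 (v a)) :=
      ((hvc.continuousAt (hΩo.mem_nhds haΩ)).tendsto).comp hta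
    have h3 : Tendsto (fun j => w (k (ψ j)) (x (ψ j))) atTop (𝓝 (v a)) := by
      rw [Metric.tendsto_atTop'] at h2 ⊢
      intro ε hε
      obtain ⟨N₁, hN₁⟩ := h2 (ε / 2) (by positivity)
      obtain ⟨N₂, hN₂⟩ := eventually_atTop.1 (hkt.eventually
        (Metric.tendstoUniformlyOn_iff.1 hlim (ε / 2) (by positivity)))
      refine ⟨max N₁ N₂, fun j hj => ?_⟩
      have e1 := hN₁ j (lt_of_le_of_lt (le_max_left _ _) hj)
      have e2 := hN₂ j ((le_max_right _ _).trans hj.le) (x (ψ j)) (hxΩ _)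
      calc dist (w (k (ψ j)) (x (ψ j))) (v a)
          ≤ dist (w (k (ψ j)) (x (ψ j))) (v (x (ψ j))) + dist (v (x (ψ j))) (v a) :=
            dist_triangle _ _ _
        _ < ε := by rw [dist_comm] at e2; linarith
    exact le_of_tendsto_of_tendsto' (h3.add (htb.inner (tendsto_const_nhds.sub hta))) h1
      fun j => hp (ψ j) y hy
  have hbV : b ∈ Vᶜ := hVo.isClosed_compl.mem_of_tendsto htb
    (Eventually.of_forall fun j => hpV (ψ j))
  exact hbV (hV (mem_subgradImg.2 ⟨a, haK, hbsub⟩))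

/-- The Monge–Ampère measure of `w` is bounded by the push-forward under `T` of the measure
`(w ∘ T)^q μ`. -/
def MongeAmpereLE {n : ℕ} (q : ℝ) (Ω : Set (EuclideanSpace ℝ (Fin n)))
    (μ : Measure (EuclideanSpace ℝ (Fin n)))
    (T : EuclideanSpace ℝ (Fin n) → EuclideanSpace ℝ (Fin n))
    (w : EuclideanSpace ℝ (Fin n) → ℝ) : Prop :=
  ∀ E : Set (EuclideanSpace ℝ (Fin n)), MeasurableSet E → E ⊆ Ω →
    volume (subgradImg Ω w E) ≤ ∫⁻ x in T ⁻¹' E, ENNReal.ofReal (w (T x) ^ q) ∂μ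

theorem tendsto_comp_of_tendstoUniformlyOn {n : ℕ} {Ω : Set (EuclideanSpace ℝ (Fin n))}
    (hΩo : IsOpen Ω) {w : ℕ → EuclideanSpace ℝ (Fin n) → ℝ}
    {v : EuclideanSpace ℝ (Fin n) → ℝ} (hvc : ContinuousOn v (closure Ω))
    (hlim : TendstoUniformlyOn w v atTop (closure Ω))
    {x : ℕ → EuclideanSpace ℝ (Fin n)} {y : EuclideanSpace ℝ (Fin n)} (hy : y ∈ Ω)
    (hx : Tendsto x atTop (𝓝 y)) : Tendsto (fun k => w k (x k)) atTop (𝓝 (v y)) := by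
  have hnhds : closure Ω ∈ 𝓝 y := mem_of_superset (hΩo.mem_nhds hy) subset_closure
  have h2 : Tendsto (fun k => v (x k)) atTop (𝓝 (v y)) :=
    (hvc.continuousAt hnhds).tendsto.comp hx
  have h3 : Tendsto (fun k => w k (x k) - v (x k)) atTop (𝓝 0) := by
    rw [Metric.tendsto_nhds]
    intro ε hε
    filter_upwards [Metric.tendstoUniformlyOn_iff.1 hlim ε hε, hx hnhds] with k hk hxk
    have := hk (x k) hxk
    rw [dist_comm, Real.dist_eq] at this
    simpa [Real.dist_eq] using this
  simpa using h3.add h2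

theorem MongeAmpereLE.of_tendstoUniformlyOn {n : ℕ} {q : ℝ} (hq : 0 ≤ q)
    {Ω : Set (EuclideanSpace ℝ (Fin n))} (hΩo : IsOpen Ω) (hΩb : Bornology.IsBounded Ω)
    {μ : Measure (EuclideanSpace ℝ (Fin n))} [IsFiniteMeasure μ] (hμΩ : μ Ωᶜ = 0)
    {T : ℕ → SimpleFunc (EuclideanSpace ℝ (Fin n)) (EuclideanSpace ℝ (Fin n))}
    {S : EuclideanSpace ℝ (Fin n) → EuclideanSpace ℝ (Fin n)} (hSm : Measurable S)
    (hT : ∀ k x, T k x ∈ Ω) (hS : ∀ x ∈ Ω, S x ∈ Ω)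
    (hTS : ∀ x ∈ Ω, Tendsto (fun k => T k x) atTop (𝓝 (S x)))
    {w : ℕ → EuclideanSpace ℝ (Fin n) → ℝ} {v : EuclideanSpace ℝ (Fin n) → ℝ} {M : ℝ}
    (hw : ∀ k, ConvexOn ℝ (closure Ω) (w k)) (hwc : ∀ k, ContinuousOn (w k) (closure Ω))
    (hw0 : ∀ k, ∀ x ∈ closure Ω, 0 ≤ w k x) (hwM : ∀ k, ∀ x ∈ closure Ω, w k x ≤ M)
    (hvc : ContinuousOn v (closure Ω)) (hlim : TendstoUniformlyOn w v atTop (closure Ω))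
    (hle : ∀ k, MongeAmpereLE q Ω μ (T k) (w k)) : MongeAmpereLE q Ω μ S v := by
  have hae : ∀ᵐ x ∂μ, x ∈ Ω := hμΩ
  have hbound : ∀ k x, ENNReal.ofReal (w k (T k x) ^ q) ≤ ENNReal.ofReal (M ^ q) := fun k x =>
    ENNReal.ofReal_le_ofReal (Real.rpow_le_rpow (hw0 k _ (subset_closure (hT k x)))
      (hwM k _ (subset_closure (hT k x))) hq)
  have hpt : ∀ x ∈ Ω, Tendsto (fun k => ENNReal.ofReal (w k (T k x) ^ q)) atTop
      (𝓝 (ENNReal.ofReal (v (S x) ^ q))) := fun x hx =>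
    ENNReal.tendsto_ofReal (((Real.continuous_rpow_const hq).tendsto _).comp
      (tendsto_comp_of_tendstoUniformlyOn hΩo hvc hlim (hS x hx) (hTS x hx)))
  have hcompact : ∀ U : Set (EuclideanSpace ℝ (Fin n)), IsOpen U → U ⊆ Ω →
      ∀ F : Set (EuclideanSpace ℝ (Fin n)), IsCompact F → F ⊆ U →
      volume (subgradImg Ω v F) ≤ ∫⁻ x in S ⁻¹' U, ENNReal.ofReal (v (S x) ^ q) ∂μ := by
    intro U hUo hU F hF hFU
    obtain ⟨δ, hδ, hδU⟩ := hF.exists_cthickening_subset_open hUo hFU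
    set U' := thickening δ F with hU'
    have hU'U : U' ⊆ U := (thickening_subset_cthickening δ F).trans hδU
    have hmeas : ∀ k, Measurable ((T k ⁻¹' U').indicator
        fun x => ENNReal.ofReal (w k (T k x) ^ q)) := fun k =>
      ((T k).map fun y => ENNReal.ofReal (w k y ^ q)).measurable.indicator
        ((T k).measurable isOpen_thickening.measurableSet)
    calc volume (subgradImg Ω v F) ≤ volume (subgradImg Ω v U') :=
          measure_mono (subgradImg_mono (self_subset_thickening hδ F))
      _ ≤ liminf (fun k => volume (subgradImg Ω (w k) U')) atTop :=
          volume_subgradImg_le_liminf hΩb hw hwc hvc hlim isOpen_thickening (hU'U.trans hU)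
      _ ≤ liminf (fun k => ∫⁻ x, (T k ⁻¹' U').indicator
            (fun x => ENNReal.ofReal (w k (T k x) ^ q)) x ∂μ) atTop := by
          refine liminf_le_liminf (Eventually.of_forall fun k => ?_)
          rw [lintegral_indicator ((T k).measurable isOpen_thickening.measurableSet)]
          exact hle k U' isOpen_thickening.measurableSet (hU'U.trans hU)
      _ ≤ limsup (fun k => ∫⁻ x, (T k ⁻¹' U').indicator
            (fun x => ENNReal.ofReal (w k (T k x) ^ q)) x ∂μ) atTop := liminf_le_limsup
      _ ≤ ∫⁻ x, limsup (fun k => (T k ⁻¹' U').indicator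
            (fun x => ENNReal.ofReal (w k (T k x) ^ q)) x) atTop ∂μ := by
          refine limsup_lintegral_le (fun _ => ENNReal.ofReal (M ^ q)) hmeas (fun k => ?_) ?_
          · exact Eventually.of_forall fun x => indicator_le (fun x _ => hbound k x) x
          · simp [ENNReal.mul_eq_top]
      _ ≤ ∫⁻ x, (S ⁻¹' U).indicator (fun x => ENNReal.ofReal (v (S x) ^ q)) x ∂μ := by
          refine lintegral_mono_ae (hae.mono fun x hx => ?_)
          by_cases hxU : S x ∈ U
          · rw [indicator_of_mem (by exact hxU), ← (hpt x hx).limsup_eq]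
            exact limsup_le_limsup (Eventually.of_forall fun k => indicator_le_self _ _ _)
          · have hev : ∀ᶠ k in atTop, T k x ∉ U' := by
              have : S x ∈ (cthickening δ F)ᶜ := fun h => hxU (hδU h)
              filter_upwards [hTS x hx (isClosed_cthickening.isOpen_compl.mem_nhds this)]
                with k hk h
              exact hk (thickening_subset_cthickening δ F h)
            rw [limsup_congr (v := fun _ => 0) (hev.mono fun k hk =>
              indicator_of_notMem (by exact hk) _)]
            simp
      _ = _ := lintegral_indicator (hSm hUo.measurableSet) _
  have hopen : ∀ U : Set (EuclideanSpace ℝ (Fin n)), IsOpen U → U ⊆ Ω →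
      volume (subgradImg Ω v U) ≤ ∫⁻ x in S ⁻¹' U, ENNReal.ofReal (v (S x) ^ q) ∂μ := by
    intro U hUo hU
    obtain ⟨F, hFc, hFU, hFun, hFm⟩ := hUo.exists_iUnion_isClosed
    have hun : subgradImg Ω v U = ⋃ j, subgradImg Ω v (F j) := by
      ext p
      simp only [mem_iUnion, mem_subgradImg, ← hFun]
      exact ⟨fun ⟨x, ⟨j, hj⟩, h⟩ => ⟨j, x, hj, h⟩, fun ⟨j, x, hj, h⟩ => ⟨x, ⟨j, hj⟩, h⟩⟩
    have hmono : Monotone fun j => subgradImg Ω v (F j) := fun i j hij =>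
      subgradImg_mono (hFm hij)
    rw [hun, hmono.measure_iUnion]
    refine iSup_le fun j => hcompact U hUo hU (F j) ?_ (hFU j)
    exact isCompact_of_isClosed_isBounded (hFc j) (hΩb.subset ((hFU j).trans hU))
  intro E hE hEΩ
  set ν : Measure (EuclideanSpace ℝ (Fin n)) :=
    Measure.map S (μ.withDensity fun x => ENNReal.ofReal (v (S x) ^ q)) with hν
  have hνapply : ∀ A : Set (EuclideanSpace ℝ (Fin n)), MeasurableSet A →
      ν A = ∫⁻ x in S ⁻¹' A, ENNReal.ofReal (v (S x) ^ q) ∂μ := fun A hA => by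
    rw [hν, Measure.map_apply hSm hA, withDensity_apply _ (hSm hA)]
  have hfin : IsFiniteMeasure ν := by
    refine ⟨?_⟩
    rw [hνapply _ MeasurableSet.univ, preimage_univ, Measure.restrict_univ]
    calc ∫⁻ x, ENNReal.ofReal (v (S x) ^ q) ∂μ ≤ ∫⁻ _, ENNReal.ofReal (M ^ q) ∂μ :=
          lintegral_mono_ae (hae.mono fun x hx =>
            le_of_tendsto' (hpt x hx) fun k => hbound k x)
      _ < ⊤ := by
          rw [lintegral_const]
          exact ENNReal.mul_lt_top ENNReal.ofReal_lt_top (measure_lt_top _ _)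
  rw [← hνapply E hE]
  refine ENNReal.le_of_forall_pos_le_add fun ε hε _ => ?_
  obtain ⟨U, hEU, hUo, hUle⟩ := E.exists_isOpen_le_add ν (ε := ε) (by simpa using hε.ne')
  calc volume (subgradImg Ω v E) ≤ volume (subgradImg Ω v (U ∩ Ω)) :=
        measure_mono (subgradImg_mono (subset_inter hEU hEΩ))
    _ ≤ ν (U ∩ Ω) := by
        rw [hνapply _ (hUo.inter hΩo).measurableSet]
        exact hopen _ (hUo.inter hΩo) inter_subset_right
    _ ≤ ν U := measure_mono inter_subset_left
    _ ≤ _ := hUle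

theorem lintegral_le_volume_subgradImg_of_tendsto {n : ℕ} {q : ℝ} (hq : 0 ≤ q)
    {Ω : Set (EuclideanSpace ℝ (Fin n))} (hΩo : IsOpen Ω)
    {μ : Measure (EuclideanSpace ℝ (Fin n))} [IsFiniteMeasure μ]
    {T : ℕ → SimpleFunc (EuclideanSpace ℝ (Fin n)) (EuclideanSpace ℝ (Fin n))}
    (hTid : ∀ x ∈ Ω, Tendsto (fun k => T k x) atTop (𝓝 x))
    {w : ℕ → EuclideanSpace ℝ (Fin n) → ℝ} {v : EuclideanSpace ℝ (Fin n) → ℝ} {M : ℝ}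
    (hw0 : ∀ k, ∀ x ∈ closure Ω, 0 ≤ w k x) (hwM : ∀ k, ∀ x ∈ closure Ω, w k x ≤ M)
    (hvc : ContinuousOn v (closure Ω)) (hlim : TendstoUniformlyOn w v atTop (closure Ω))
    (hge : ∀ k, ∀ E : Set (EuclideanSpace ℝ (Fin n)), MeasurableSet E →
      E ⊆ {x ∈ Ω | 0 < w k x} → ∫⁻ x in T k ⁻¹' E, ENNReal.ofReal (w k (T k x) ^ q) ∂μ
        ≤ volume (subgradImg Ω (w k) E))
    {E : Set (EuclideanSpace ℝ (Fin n))} (hE : MeasurableSet E)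
    (hEpos : E ⊆ {x ∈ Ω | 0 < v x}) :
    ∫⁻ x in E, ENNReal.ofReal (v x ^ q) ∂μ ≤ volume (subgradImg Ω v E) := by
  have hv0 : ∀ x ∈ Ω, v x ≤ M := fun x hx =>
    le_of_tendsto' (hlim.tendsto_at (subset_closure hx)) fun k => hwM k x (subset_closure hx)
  have hposo : IsOpen {x ∈ Ω | 0 < v x} :=
    (hvc.mono subset_closure).isOpen_inter_preimage hΩo isOpen_Ioi
  have hcompact : ∀ K ⊆ E, IsCompact K →
      ∫⁻ x in K, ENNReal.ofReal (v x ^ q) ∂μ ≤ volume (subgradImg Ω v K) := by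
    intro K hKE hK
    have hKpos := hKE.trans hEpos
    have hKΩ : K ⊆ Ω := fun x hx => (hKpos hx).1
    rw [Set.measure_eq_iInf_isOpen (subgradImg Ω v K)]
    refine le_iInf₂ fun V hV => le_iInf fun hVo => ?_
    obtain ⟨δ₁, hδ₁, -, hev₁⟩ := eventually_subgradImg_subset (M := M) hΩo
      (fun k x hx => by
        rw [abs_of_nonneg (hw0 k x (subset_closure hx))]
        exact hwM k x (subset_closure hx))
      (hvc.mono subset_closure) (hlim.mono subset_closure) hK hKΩ hVo hV
    obtain ⟨δ₂, hδ₂, hδ₂pos⟩ := hK.exists_cthickening_subset_open hposo hKpos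
    set δ := min δ₁ δ₂ with hδdef
    have hδ : 0 < δ := lt_min hδ₁ hδ₂
    set K' := cthickening δ K with hK'
    have hK'pos : K' ⊆ {x ∈ Ω | 0 < v x} := (cthickening_mono (min_le_right _ _) K).trans hδ₂pos
    have hK'Ω : K' ⊆ Ω := fun x hx => (hK'pos hx).1
    obtain ⟨c, hc, hcle⟩ := (hK.cthickening (r := δ)).exists_forall_le' (f := v)
      (hvc.mono (hK'Ω.trans subset_closure)) (fun x hx => (hK'pos hx).2)
    have hK'm : MeasurableSet K' := isClosed_cthickening.measurableSet
    have hmeas : ∀ k, Measurable ((T k ⁻¹' K').indicator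
        fun x => ENNReal.ofReal (w k (T k x) ^ q)) := fun k =>
      ((T k).map fun y => ENNReal.ofReal (w k y ^ q)).measurable.indicator
        ((T k).measurable hK'm)
    have hev : ∀ᶠ k in atTop, ∫⁻ x, (T k ⁻¹' K').indicator
        (fun x => ENNReal.ofReal (w k (T k x) ^ q)) x ∂μ ≤ volume V := by
      filter_upwards [hev₁, Metric.tendstoUniformlyOn_iff.1 hlim c hc] with k hk₁ hk₂
      rw [lintegral_indicator ((T k).measurable hK'm)]
      refine (hge k K' hK'm fun x hx => ⟨hK'Ω hx, ?_⟩).trans (measure_mono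
        ((subgradImg_mono (cthickening_mono (min_le_left _ _) K)).trans hk₁))
      have := hk₂ x (subset_closure (hK'Ω hx))
      rw [Real.dist_eq, abs_lt] at this
      linarith [hcle x hx, this.2]
    calc ∫⁻ x in K, ENNReal.ofReal (v x ^ q) ∂μ
        = ∫⁻ x, K.indicator (fun x => ENNReal.ofReal (v x ^ q)) x ∂μ :=
          (lintegral_indicator hK.isClosed.measurableSet _).symm
      _ ≤ ∫⁻ x, liminf (fun k => (T k ⁻¹' K').indicator
            (fun x => ENNReal.ofReal (w k (T k x) ^ q)) x) atTop ∂μ := by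
          refine lintegral_mono fun x => ?_
          by_cases hx : x ∈ K
          · rw [indicator_of_mem hx]
            have hnear : ∀ᶠ k in atTop, T k x ∈ K' := by
              filter_upwards [hTid x (hKΩ hx) (isOpen_thickening.mem_nhds
                (self_subset_thickening hδ K hx))] with k hk
              exact thickening_subset_cthickening δ K hk
            have htend : Tendsto (fun k => ENNReal.ofReal (w k (T k x) ^ q)) atTop
                (𝓝 (ENNReal.ofReal (v x ^ q))) :=
              ENNReal.tendsto_ofReal (((Real.continuous_rpow_const hq).tendsto _).comp
                (tendsto_comp_of_tendstoUniformlyOn hΩo hvc hlim (hKΩ hx) (hTid x (hKΩ hx))))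
            refine le_of_eq (Tendsto.liminf_eq (htend.congr' (hnear.mono fun k hk => ?_))).symm
            rw [indicator_of_mem (by exact hk)]
          · simp [indicator_of_notMem hx]
      _ ≤ liminf (fun k => ∫⁻ x, (T k ⁻¹' K').indicator
            (fun x => ENNReal.ofReal (w k (T k x) ^ q)) x ∂μ) atTop :=
          lintegral_liminf_le' fun k => (hmeas k).aemeasurable
      _ ≤ volume V := by
          refine liminf_le_of_frequently_le' hev.frequently
  set ν : Measure (EuclideanSpace ℝ (Fin n)) :=
    (μ.restrict E).withDensity fun x => ENNReal.ofReal (v x ^ q) with hν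
  have hfin : IsFiniteMeasure ν := by
    refine isFiniteMeasure_withDensity (ne_of_lt ?_)
    calc ∫⁻ x in E, ENNReal.ofReal (v x ^ q) ∂μ ≤ ∫⁻ _ in E, ENNReal.ofReal (M ^ q) ∂μ :=
          setLIntegral_mono' hE fun x hx => ENNReal.ofReal_le_ofReal
            (Real.rpow_le_rpow (hEpos hx).2.le (hv0 x (hEpos hx).1) hq)
      _ < ⊤ := by
          rw [setLIntegral_const]
          exact ENNReal.mul_lt_top ENNReal.ofReal_lt_top (measure_lt_top _ _)
  have hνE : ∀ A ⊆ E, MeasurableSet A → ν A = ∫⁻ x in A, ENNReal.ofReal (v x ^ q) ∂μ := by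
    intro A hAE hA
    rw [hν, withDensity_apply _ hA, Measure.restrict_restrict hA, inter_eq_left.2 hAE]
  rw [← hνE E subset_rfl hE, hE.measure_eq_iSup_isCompact_of_ne_top (measure_ne_top _ _)]
  refine iSup₂_le fun K hKE => iSup_le fun hK => ?_
  rw [hνE K hKE hK.isClosed.measurableSet]
  exact (hcompact K hKE hK).trans (measure_mono (subgradImg_mono hKE))

theorem exists_radial_gauge {n : ℕ} {Ω : Set (EuclideanSpace ℝ (Fin n))} (hΩo : IsOpen Ω)
    (hΩc : Convex ℝ Ω) (hΩb : Bornology.IsBounded Ω) {z : EuclideanSpace ℝ (Fin n)}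
    (hz : z ∈ Ω) : ∃ t : EuclideanSpace ℝ (Fin n) → ℝ, Continuous t ∧ (∀ x, x ≠ z → 0 < t x) ∧
      (∀ s : ℝ, 0 ≤ s → ∀ e, t (z + s • e) = s * t (z + e)) ∧
      (∀ x, t x ≤ 1 ↔ x ∈ closure Ω) ∧ ∀ x, t x = 1 ↔ x ∈ frontier Ω := by
  set S : Set (EuclideanSpace ℝ (Fin n)) := Homeomorph.addLeft z ⁻¹' Ω with hS
  have hSo : IsOpen S := hΩo.preimage (Homeomorph.addLeft z).continuous
  have h0 : S ∈ 𝓝 0 := hSo.mem_nhds (by simpa [hS] using hz)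
  have hSc : Convex ℝ S := by
    have := hΩc.translate_preimage_right z
    simpa [hS] using this
  have hSb : Bornology.IsBounded S := by
    obtain ⟨R, hR⟩ := hΩb.exists_norm_le
    refine isBounded_iff_forall_norm_le.2 ⟨R + ‖z‖, fun x hx => ?_⟩
    have h1 := hR (z + x) hx
    have h2 := norm_sub_le (z + x) z
    rw [add_sub_cancel_left] at h2
    linarith
  have hmem : ∀ x, x - z ∈ closure S ↔ x ∈ closure Ω := fun x => by
    rw [hS, ← Homeomorph.preimage_closure]; simp
  have hmem' : ∀ x, x - z ∈ frontier S ↔ x ∈ frontier Ω := fun x => by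
    rw [hS, ← Homeomorph.preimage_frontier]; simp
  refine ⟨fun x => gauge S (x - z), (continuous_gauge hSc h0).comp (by fun_prop),
    fun x hx => ?_, fun s hs e => ?_, fun x => ?_, fun x => ?_⟩
  · exact (gauge_pos (absorbent_nhds_zero h0) ((NormedSpace.isVonNBounded_iff ℝ).2 hSb)).2
      (sub_ne_zero.2 hx)
  · simp [gauge_smul_of_nonneg hs]
  · rw [← hmem, gauge_le_one_iff_mem_closure hSc h0]
  · rw [← hmem', gauge_eq_one_iff_mem_frontier hSc h0]

theorem exists_smul_mem_frontier {n : ℕ} {Ω : Set (EuclideanSpace ℝ (Fin n))} (hΩo : IsOpen Ω)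
    (hΩc : Convex ℝ Ω) (hΩb : Bornology.IsBounded Ω) {z : EuclideanSpace ℝ (Fin n)}
    (hz : z ∈ Ω) {e : EuclideanSpace ℝ (Fin n)} (he : e ≠ 0) :
    ∃ s : ℝ, 0 < s ∧ z + s • e ∈ frontier Ω := by
  obtain ⟨t, -, hpos, hsmul, -, hfr⟩ := exists_radial_gauge hΩo hΩc hΩb hz
  have hte : 0 < t (z + e) := hpos _ (by simpa using he)
  refine ⟨(t (z + e))⁻¹, inv_pos.2 hte, (hfr _).1 ?_⟩
  rw [hsmul _ (inv_pos.2 hte).le, inv_mul_cancel₀ hte.ne']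

/-- The maximum principle for convex functions. -/
theorem le_of_convexOn_of_le_frontier {n : ℕ} (hn : n ≠ 0)
    {Ω : Set (EuclideanSpace ℝ (Fin n))} (hΩo : IsOpen Ω)
    (hΩc : Convex ℝ Ω) (hΩb : Bornology.IsBounded Ω) {w : EuclideanSpace ℝ (Fin n) → ℝ}
    (hw : ConvexOn ℝ (closure Ω) w) {M : ℝ} (hM : ∀ x ∈ frontier Ω, w x ≤ M) :
    ∀ x ∈ closure Ω, w x ≤ M := by
  have : Nontrivial (EuclideanSpace ℝ (Fin n)) := by
    have : Nonempty (Fin n) := Fin.pos_iff_nonempty.1 (Nat.pos_of_ne_zero hn)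
    infer_instance
  intro x hx
  by_cases hxΩ : x ∈ Ω
  swap
  · exact hM x (by rw [hΩo.frontier_eq]; exact ⟨hx, hxΩ⟩)
  obtain ⟨e, he⟩ := exists_ne (0 : EuclideanSpace ℝ (Fin n))
  obtain ⟨a, ha, hae⟩ := exists_smul_mem_frontier hΩo hΩc hΩb hxΩ he
  obtain ⟨b, hb, hbe⟩ := exists_smul_mem_frontier hΩo hΩc hΩb hxΩ (neg_ne_zero.2 he)
  have hab : 0 < a + b := by linarith
  have h := hw.2 (frontier_subset_closure hae) (frontier_subset_closure hbe)
    (show 0 ≤ b / (a + b) by positivity) (show 0 ≤ a / (a + b) by positivity)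
    (by field_simp; ring)
  have hpt : (b / (a + b)) • (x + a • e) + (a / (a + b)) • (x + b • -e) = x := by
    have h1 : b / (a + b) + a / (a + b) = 1 := by field_simp; ring
    have h2 : b / (a + b) * a - a / (a + b) * b = 0 := by ring
    calc _ = (b / (a + b) + a / (a + b)) • x
          + (b / (a + b) * a - a / (a + b) * b) • e := by module
      _ = x := by rw [h1, h2]; simp
  rw [hpt, smul_eq_mul, smul_eq_mul] at h
  calc w x ≤ _ := h
    _ ≤ b / (a + b) * M + a / (a + b) * M := by
        gcongr
        · exact hM _ hae
        · exact hM _ hbe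
    _ = M := by field_simp; ring

/-- Uniform upper semicontinuity at the boundary of the convex functions with boundary values
at most `φ`. -/
theorem eventually_forall_convexOn_le_add {n : ℕ} {Ω : Set (EuclideanSpace ℝ (Fin n))}
    (hΩo : IsOpen Ω) (hΩc : Convex ℝ Ω) (hΩb : Bornology.IsBounded Ω) (hΩne : Ω.Nonempty)
    {φ : EuclideanSpace ℝ (Fin n) → ℝ} (hφc : ContinuousOn φ (closure Ω)) {M : ℝ}
    {y₀ : EuclideanSpace ℝ (Fin n)} (hy₀ : y₀ ∈ frontier Ω) {ε : ℝ} (hε : 0 < ε) :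
    ∀ᶠ x in 𝓝 y₀, x ∈ closure Ω → ∀ g : EuclideanSpace ℝ (Fin n) → ℝ,
      ConvexOn ℝ (closure Ω) g → (∀ y ∈ frontier Ω, g y ≤ φ y) →
      (∀ y ∈ closure Ω, g y ≤ M) → g x ≤ φ y₀ + ε := by
  obtain ⟨z, hz⟩ := hΩne
  obtain ⟨t, htc, hpos, hsmul, hcl, hfr⟩ := exists_radial_gauge hΩo hΩc hΩb hz
  have hty : t y₀ = 1 := (hfr _).2 hy₀
  set P : EuclideanSpace ℝ (Fin n) → EuclideanSpace ℝ (Fin n) :=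
    fun x => z + (t x)⁻¹ • (x - z) with hP
  have hPfr : ∀ x, x ≠ z → P x ∈ frontier Ω := fun x hx => by
    have := hpos x hx
    refine (hfr _).1 ?_
    rw [hP]
    simp only
    rw [hsmul _ (inv_pos.2 this).le, add_sub_cancel, inv_mul_cancel₀ this.ne']
  have hPc : ContinuousAt P y₀ :=
    continuousAt_const.add ((htc.continuousAt.inv₀ (by simp [hty])).smul (by fun_prop))
  have hPy : P y₀ = y₀ := by simp [hP, hty]
  have hne : ∀ᶠ x in 𝓝 y₀, x ≠ z := by
    refine isOpen_ne.mem_nhds ?_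
    rintro rfl
    rw [hΩo.frontier_eq] at hy₀
    exact hy₀.2 hz
  have h1 : Tendsto (fun x => φ (P x)) (𝓝 y₀) (𝓝 (φ y₀)) := by
    have h2 : Tendsto P (𝓝 y₀) (𝓝[closure Ω] y₀) := by
      refine tendsto_nhdsWithin_iff.2 ⟨by simpa [hPy] using hPc.tendsto, ?_⟩
      exact hne.mono fun x hx => frontier_subset_closure (hPfr x hx)
    exact (hφc y₀ (frontier_subset_closure hy₀)).tendsto.comp h2
  have h3 : Tendsto (fun x => (1 - t x) * M + t x * φ (P x)) (𝓝 y₀) (𝓝 (φ y₀)) := by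
    have := ((tendsto_const_nhds (x := (1 : ℝ))).sub (htc.tendsto y₀)).mul_const M |>.add
      ((htc.tendsto y₀).mul h1)
    simpa [hty] using this
  filter_upwards [hne, h3 (Iio_mem_nhds (show φ y₀ < φ y₀ + ε by linarith))] with x hxz hx hxcl
    g hg hgφ hgM
  have ht0 := hpos x hxz
  have ht1 := (hcl x).2 hxcl
  have hcomb : (1 - t x) • z + t x • P x = x := by
    have : t x • P x = t x • z + (x - z) := by
      simp only [hP, smul_add, smul_smul, mul_inv_cancel₀ ht0.ne', one_smul]
    rw [this]
    module
  have h := hg.2 (subset_closure hz) (frontier_subset_closure (hPfr x hxz))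
    (show 0 ≤ 1 - t x by linarith) ht0.le (by ring)
  rw [hcomb, smul_eq_mul, smul_eq_mul] at h
  have h4 : (1 - t x) * g z ≤ (1 - t x) * M :=
    mul_le_mul_of_nonneg_left (hgM z (subset_closure hz)) (by linarith)
  have h5 : t x * g (P x) ≤ t x * φ (P x) :=
    mul_le_mul_of_nonneg_left (hgφ _ (hPfr x hxz)) ht0.le
  have hx' : (1 - t x) * M + t x * φ (P x) < φ y₀ + ε := hx
  linarith

theorem exists_unit_normal {n : ℕ} {Ω : Set (EuclideanSpace ℝ (Fin n))}
    (hΩo : IsOpen Ω) (hΩc : Convex ℝ Ω) (hΩne : Ω.Nonempty) {y₀ : EuclideanSpace ℝ (Fin n)}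
    (hy₀ : y₀ ∈ frontier Ω) : ∃ ν : EuclideanSpace ℝ (Fin n), ‖ν‖ = 1 ∧
      (∀ x ∈ Ω, 0 < ⟪ν, y₀ - x⟫) ∧ ∀ x ∈ closure Ω, 0 ≤ ⟪ν, y₀ - x⟫ := by
  rw [hΩo.frontier_eq] at hy₀
  obtain ⟨f, hf⟩ := geometric_hahn_banach_open_point hΩc hΩo hy₀.2
  set a := (InnerProductSpace.toDual ℝ (EuclideanSpace ℝ (Fin n))).symm f with ha
  have hfa : ∀ x, ⟪a, x⟫ = f x := fun x => InnerProductSpace.toDual_symm_apply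
  have ha0 : a ≠ 0 := by
    intro h0
    obtain ⟨z, hz⟩ := hΩne
    have := hf z hz
    rw [← hfa, ← hfa, h0] at this
    simp at this
  have hpos : ∀ x ∈ Ω, 0 < ⟪‖a‖⁻¹ • a, y₀ - x⟫ := fun x hx => by
    rw [real_inner_smul_left, inner_sub_right, hfa, hfa]
    exact mul_pos (inv_pos.2 (norm_pos_iff.2 ha0)) (sub_pos.2 (hf x hx))
  refine ⟨‖a‖⁻¹ • a, norm_smul_inv_norm ha0, hpos, fun x hx => ?_⟩
  exact le_on_closure (f := fun _ => (0 : ℝ)) (g := fun x => ⟪‖a‖⁻¹ • a, y₀ - x⟫)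
    (fun x hx => (hpos x hx).le) (by fun_prop) (by fun_prop) hx

/-- Aleksandrov's maximum principle, relative to a convex function with the same boundary
values. -/
theorem exists_pow_sub_le_mul_dist {n : ℕ} (hn : n ≠ 0) {Ω : Set (EuclideanSpace ℝ (Fin n))}
    (hΩo : IsOpen Ω) (hΩc : Convex ℝ Ω) (hΩb : Bornology.IsBounded Ω) (hΩne : Ω.Nonempty)
    {φ : EuclideanSpace ℝ (Fin n) → ℝ} (hφc : ContinuousOn φ (closure Ω))
    (hφ : ConvexOn ℝ (closure Ω) φ) {A : ℝ≥0∞} (hA : A ≠ ⊤) :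
    ∃ C : ℝ, ∀ w : EuclideanSpace ℝ (Fin n) → ℝ, ConvexOn ℝ (closure Ω) w →
      ContinuousOn w (closure Ω) → (∀ y ∈ frontier Ω, w y = φ y) →
      volume (subgradImg Ω w Ω) ≤ A → ∀ x ∈ closure Ω, ∀ y ∈ frontier Ω, w x ≤ φ x →
      (φ x - w x) ^ n ≤ C * dist x y := by
  obtain ⟨D₀, hD₀⟩ := isBounded_iff.1 hΩb.closure
  set D : ℝ := max D₀ 1 with hDdef
  have hD1 : 1 ≤ D := le_max_right _ _
  have hD : ∀ x ∈ closure Ω, ∀ y ∈ closure Ω, dist x y ≤ D := fun x hx y hy =>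
    (hD₀ hx hy).trans (le_max_left _ _)
  set B : ℝ := volume.real (ball (0 : EuclideanSpace ℝ (Fin n)) 1) with hB
  have hBpos : 0 < B := ENNReal.toReal_pos (measure_ball_pos volume _ one_pos).ne'
    measure_ball_lt_top.ne
  have hC0 : 0 ≤ A.toReal * (2 * D) ^ n * 2 / (D * B) := by positivity
  refine ⟨A.toReal * (2 * D) ^ n * 2 / (D * B), fun w hw hwc hwφ hwA x hx y hy hwx => ?_⟩
  rcases hwx.eq_or_lt with heq | hlt
  · rw [heq, sub_self, zero_pow hn]
    exact mul_nonneg hC0 dist_nonneg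
  have hxΩ : x ∈ Ω := by
    by_contra hxn
    exact hlt.ne (hwφ x (by rw [hΩo.frontier_eq]; exact ⟨hx, hxn⟩))
  obtain ⟨ν, hν1, hνpos, hνnn⟩ := exists_unit_normal hΩo hΩc hΩne hy
  set h : ℝ := φ x - w x with hh
  have hhpos : 0 < h := sub_pos.2 hlt
  set t : ℝ := ⟪ν, y - x⟫ with ht
  have htpos : 0 < t := hνpos x hxΩ
  have htd : t ≤ dist x y := by
    have := real_inner_le_norm ν (y - x)
    rwa [hν1, one_mul, ← dist_eq_norm, dist_comm] at this
  obtain ⟨p₀, hp₀⟩ := subgrad_nonempty hΩo (hφ.subset subset_closure hΩc) hxΩ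
  have hp₀' := le_of_mem_subgrad_of_mem_closure hφc hp₀
  set r : ℝ := h / (2 * D) with hr
  have hrpos : 0 < r := by positivity
  set κ : ℝ := D / (2 * t) with hκ
  have hκpos : 0 < κ := by positivity
  set L : EuclideanSpace ℝ (Fin n) →ₗ[ℝ] EuclideanSpace ℝ (Fin n) :=
    r • LinearMap.transvection (innerₛₗ ℝ ν) (κ • ν) with hL
  have hdet : LinearMap.det L = r ^ n * (1 + κ) := by
    rw [hL, LinearMap.det_smul, LinearMap.transvection.det]
    simp [hν1]
  have hLapply : ∀ ξ, L ξ = r • (ξ + (⟪ν, ξ⟫ * κ) • ν) := fun ξ => by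
    simp [hL, LinearMap.transvection, smul_smul]
  have hsub : (fun η => (p₀ + (r * κ) • ν) + η) '' (L '' ball 0 1) ⊆ subgradImg Ω w Ω := by
    rintro _ ⟨_, ⟨ξ, hξ, rfl⟩, rfl⟩
    rw [mem_ball_zero_iff] at hξ
    refine mem_subgradImg_of_lt_frontier hΩb hw hwc hΩo subset_rfl hxΩ fun y' hy' => ?_
    have hy'c := frontier_subset_closure hy'
    have h1 := hp₀' y' hy'c
    rw [hwφ y' hy']
    have h2 : ⟪ξ, y' - x⟫ ≤ ‖ξ‖ * D := by
      refine (real_inner_le_norm _ _).trans ?_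
      gcongr
      rw [← dist_eq_norm]
      exact hD y' hy'c x hx
    have h3 : ⟪ν, y' - x⟫ ≤ t := by
      have := hνnn y' hy'c
      rw [inner_sub_right] at this
      rw [ht, inner_sub_right, inner_sub_right]
      linarith
    have h4 : |⟪ν, ξ⟫| ≤ 1 := by
      have := abs_real_inner_le_norm ν ξ
      rw [hν1, one_mul] at this
      linarith
    have h5 := abs_le.1 h4
    have h6 : (1 + ⟪ν, ξ⟫) * κ * ⟪ν, y' - x⟫ ≤ D := by
      calc (1 + ⟪ν, ξ⟫) * κ * ⟪ν, y' - x⟫ ≤ (1 + ⟪ν, ξ⟫) * κ * t := by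
            refine mul_le_mul_of_nonneg_left h3 (mul_nonneg (by linarith) hκpos.le)
        _ ≤ 2 * κ * t := by gcongr; linarith
        _ = D := by rw [hκ]; field_simp
    have h7 : ‖ξ‖ * D < D := by nlinarith
    have h8 : r * (⟪ξ, y' - x⟫ + (1 + ⟪ν, ξ⟫) * κ * ⟪ν, y' - x⟫) < r * (2 * D) := by
      refine mul_lt_mul_of_pos_left ?_ hrpos
      linarith
    have h9 : r * (2 * D) = h := by rw [hr]; field_simp
    have h10 : ⟪p₀ + (r * κ) • ν + L ξ, y' - x⟫ = ⟪p₀, y' - x⟫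
        + r * (⟪ξ, y' - x⟫ + (1 + ⟪ν, ξ⟫) * κ * ⟪ν, y' - x⟫) := by
      rw [hLapply]
      simp only [inner_add_left, real_inner_smul_left]
      ring
    simp only [h10]
    linarith
  have hvol := (measure_mono (μ := volume) hsub).trans hwA
  rw [Set.image_add_left, measure_preimage_add, Measure.addHaar_image_linearMap, hdet] at hvol
  have hreal := ENNReal.toReal_mono hA hvol
  rw [ENNReal.toReal_mul, ENNReal.toReal_ofReal (abs_nonneg _),
    abs_of_pos (by positivity)] at hreal
  have hreal' : r ^ n * (1 + κ) * B ≤ A.toReal := hreal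
  have h11 : r ^ n * κ * B ≤ A.toReal := by
    refine le_trans ?_ hreal'
    gcongr
    linarith
  have h12 : h ^ n = r ^ n * (2 * D) ^ n := by
    rw [← mul_pow]; congr 1; rw [hr]; field_simp
  have h13 : r ^ n * κ * B = h ^ n * (D * B) / ((2 * D) ^ n * 2 * t) := by
    rw [h12, hκ]; field_simp
  rw [h13, div_le_iff₀ (by positivity)] at h11
  calc h ^ n ≤ A.toReal * (2 * D) ^ n * 2 / (D * B) * t := by
        rw [div_mul_eq_mul_div, le_div_iff₀ (by positivity)]
        linarith
    _ ≤ _ := by gcongr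

/-- Nonnegative continuous convex functions on `closure Ω` with boundary values `φ`. -/
structure IsAdmissible {n : ℕ} (Ω : Set (EuclideanSpace ℝ (Fin n)))
    (φ w : EuclideanSpace ℝ (Fin n) → ℝ) : Prop where
  convexOn : ConvexOn ℝ (closure Ω) w
  continuousOn : ContinuousOn w (closure Ω)
  nonneg : ∀ x ∈ closure Ω, 0 ≤ w x
  eq_of_mem_frontier : ∀ x ∈ frontier Ω, w x = φ x

theorem IsAdmissible.of_tendstoUniformlyOn {n : ℕ} {Ω : Set (EuclideanSpace ℝ (Fin n))}
    {φ v : EuclideanSpace ℝ (Fin n) → ℝ} {w : ℕ → EuclideanSpace ℝ (Fin n) → ℝ}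
    (hw : ∀ k, IsAdmissible Ω φ (w k)) (hlim : TendstoUniformlyOn w v atTop (closure Ω)) :
    IsAdmissible Ω φ v where
  convexOn := by
    refine ⟨(hw 0).convexOn.1, fun x hx y hy a b ha hb hab => ?_⟩
    refine le_of_tendsto_of_tendsto' (hlim.tendsto_at ((hw 0).convexOn.1 hx hy ha hb hab))
      (((hlim.tendsto_at hx).const_smul a).add ((hlim.tendsto_at hy).const_smul b)) fun k => ?_
    exact (hw k).convexOn.2 hx hy ha hb hab
  continuousOn := hlim.continuousOn (Frequently.of_forall fun k => (hw k).continuousOn)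
  nonneg := fun x hx => ge_of_tendsto' (hlim.tendsto_at hx) fun k => (hw k).nonneg x hx
  eq_of_mem_frontier := fun x hx => by
    refine tendsto_nhds_unique (hlim.tendsto_at (frontier_subset_closure hx)) ?_
    simp [fun k => (hw k).eq_of_mem_frontier x hx]

theorem eventually_forall_abs_sub_lt {n : ℕ} (hn : n ≠ 0)
    {Ω : Set (EuclideanSpace ℝ (Fin n))}
    (hΩo : IsOpen Ω) (hΩc : Convex ℝ Ω) (hΩb : Bornology.IsBounded Ω) (hΩne : Ω.Nonempty)
    {φ : EuclideanSpace ℝ (Fin n) → ℝ} (hφc : ContinuousOn φ (closure Ω))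
    (hφ : ConvexOn ℝ (closure Ω) φ) {M : ℝ} {A : ℝ≥0∞} (hA : A ≠ ⊤)
    {y : EuclideanSpace ℝ (Fin n)} (hy : y ∈ closure Ω) {ε : ℝ} (hε : 0 < ε) :
    ∀ᶠ x in 𝓝 y, x ∈ closure Ω → ∀ w : EuclideanSpace ℝ (Fin n) → ℝ, IsAdmissible Ω φ w →
      (∀ x ∈ closure Ω, w x ≤ M) → volume (subgradImg Ω w Ω) ≤ A → |w x - w y| < ε := by
  by_cases hyΩ : y ∈ Ω
  · obtain ⟨r, hr, hrΩ⟩ := Metric.isOpen_iff.1 hΩo y hyΩ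
    set K : ℝ≥0 := (2 * M / (r / 2)).toNNReal
    have hsmall : ∀ᶠ x in 𝓝 y, K * dist x y < ε := by
      have : Tendsto (fun x => K * dist x y) (𝓝 y) (𝓝 (K * dist y y)) :=
        (tendsto_const_nhds).mul (tendsto_id.dist tendsto_const_nhds)
      rw [dist_self, mul_zero] at this
      exact this (Iio_mem_nhds hε)
    filter_upwards [hsmall, ball_mem_nhds y (half_pos hr)] with x hx hxr _ w hw hwM _
    have hlip := ConvexOn.lipschitzOnWith_of_abs_le (f := w) (x₀ := y) (r := r) (M := M)
      (hw.convexOn.subset (hrΩ.trans subset_closure) (convex_ball y r)) (half_pos hr)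
      (fun a ha => by
        have haΩ := subset_closure (hrΩ ha)
        rw [abs_of_nonneg (hw.nonneg a haΩ)]
        exact hwM a haΩ)
    have h := hlip.dist_le_mul x (by rwa [sub_half]) y (by
      rw [sub_half]; exact mem_ball_self (half_pos hr))
    rw [Real.dist_eq] at h
    exact h.trans_lt hx
  · have hyf : y ∈ frontier Ω := by rw [hΩo.frontier_eq]; exact ⟨hy, hyΩ⟩
    obtain ⟨C, hC⟩ := exists_pow_sub_le_mul_dist hn hΩo hΩc hΩb hΩne hφc hφ hA
    have hsmall : ∀ᶠ x in 𝓝 y, C * dist x y < (ε / 2) ^ n := by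
      have : Tendsto (fun x => C * dist x y) (𝓝 y) (𝓝 (C * dist y y)) :=
        (tendsto_const_nhds).mul (tendsto_id.dist tendsto_const_nhds)
      rw [dist_self, mul_zero] at this
      exact this (Iio_mem_nhds (by positivity))
    have hφy : ∀ᶠ x in 𝓝 y, x ∈ closure Ω → |φ x - φ y| < ε / 2 := by
      have := hφc y hy (Metric.ball_mem_nhds (φ y) (half_pos hε))
      rw [mem_map, mem_nhdsWithin_iff_eventually] at this
      exact this.mono fun x hx hxc => by simpa [Real.dist_eq] using hx hxc
    filter_upwards [hsmall, hφy, eventually_forall_convexOn_le_add (M := M) hΩo hΩc hΩb hΩne hφc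
      hyf (half_pos hε)] with x hx₁ hx₂ hx₃ hxc w hw hwM hwA
    have hup := hx₃ hxc w hw.convexOn (fun z hz => (hw.eq_of_mem_frontier z hz).le) hwM
    have hφ' := abs_lt.1 (hx₂ hxc)
    have hlow : φ x - w x < ε / 2 := by
      rcases lt_or_ge (φ x) (w x) with h | h
      · linarith
      · exact lt_of_pow_lt_pow_left₀ n (by positivity)
          ((hC w hw.convexOn hw.continuousOn hw.eq_of_mem_frontier hwA x hxc y hyf h).trans_lt
            hx₁)
    rw [hw.eq_of_mem_frontier y hyf, abs_lt]
    constructor <;> linarith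

/-- Compactness of admissible functions with bounded Monge–Ampère mass. -/
theorem exists_subseq_tendstoUniformlyOn {n : ℕ} (hn : n ≠ 0)
    {Ω : Set (EuclideanSpace ℝ (Fin n))}
    (hΩo : IsOpen Ω) (hΩc : Convex ℝ Ω) (hΩb : Bornology.IsBounded Ω) (hΩne : Ω.Nonempty)
    {φ : EuclideanSpace ℝ (Fin n) → ℝ} (hφc : ContinuousOn φ (closure Ω))
    (hφ : ConvexOn ℝ (closure Ω) φ) {M : ℝ} {A : ℝ≥0∞} (hA : A ≠ ⊤)
    {w : ℕ → EuclideanSpace ℝ (Fin n) → ℝ} (hw : ∀ k, IsAdmissible Ω φ (w k))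
    (hwM : ∀ k, ∀ x ∈ closure Ω, w k x ≤ M) (hwA : ∀ k, volume (subgradImg Ω (w k) Ω) ≤ A) :
    ∃ v, ∃ k : ℕ → ℕ, StrictMono k ∧ IsAdmissible Ω φ v ∧
      TendstoUniformlyOn (fun j => w (k j)) v atTop (closure Ω) := by
  have : CompactSpace (closure Ω) := isCompact_iff_compactSpace.1 hΩb.isCompact_closure
  set F : ℕ → BoundedContinuousFunction (closure Ω) ℝ := fun k =>
    BoundedContinuousFunction.mkOfCompact ⟨fun x => w k x, (hw k).continuousOn.domRestrict⟩
  have hcomp : IsCompact (closure (range F)) := by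
    refine BoundedContinuousFunction.arzela_ascoli (Icc 0 M) isCompact_Icc _ ?_ ?_
    · rintro _ x ⟨k, rfl⟩
      exact ⟨(hw k).nonneg x x.2, hwM k x x.2⟩
    · intro y
      rw [Metric.equicontinuousAt_iff_right]
      intro ε hε
      have := continuous_subtype_val.tendsto y (eventually_forall_abs_sub_lt (M := M) hn hΩo hΩc
        hΩb hΩne hφc hφ hA y.2 hε)
      filter_upwards [this] with x hx
      rintro ⟨_, k, rfl⟩
      have h := hx x.2 (w k) (hw k) (hwM k) (hwA k)
      rw [dist_comm, Real.dist_eq]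
      exact h
  obtain ⟨G, -, k, hk, hG⟩ := hcomp.tendsto_subseq fun k => subset_closure (mem_range_self k)
  classical
  set v : EuclideanSpace ℝ (Fin n) → ℝ := fun x => if h : x ∈ closure Ω then G ⟨x, h⟩ else 0
    with hv
  have hlim : TendstoUniformlyOn (fun j => w (k j)) v atTop (closure Ω) := by
    rw [tendstoUniformlyOn_iff_tendstoUniformly_comp_coe]
    have hvG : v ∘ Subtype.val = G := by
      ext x
      simp [hv]
    rw [hvG]
    exact BoundedContinuousFunction.tendsto_iff_tendstoUniformly.1 hG
  exact ⟨v, k, hk, IsAdmissible.of_tendstoUniformlyOn (fun j => hw (k j)) hlim, hlim⟩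

/-- The convex envelope `u` of `f`: outside the contact set `{u = f}` its subgradients are slopes
of affine functions touching `u` at several points. -/
theorem exists_convex_envelope {n : ℕ} {Ω : Set (EuclideanSpace ℝ (Fin n))}
    (hΩo : IsOpen Ω) (hΩc : Convex ℝ Ω) (hΩb : Bornology.IsBounded Ω) (hΩne : Ω.Nonempty)
    {φ : EuclideanSpace ℝ (Fin n) → ℝ} (hφc : ContinuousOn φ (closure Ω))
    {f : EuclideanSpace ℝ (Fin n) → ℝ} {M : ℝ} (hf0 : ∀ x ∈ closure Ω, 0 ≤ f x)
    (hfM : ∀ x ∈ closure Ω, f x ≤ M) (hfφ : ∀ x ∈ frontier Ω, f x = φ x)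
    (hflsc : LowerSemicontinuousOn f (closure Ω))
    (hbar : ∀ y ∈ frontier Ω, ∃ g, ConvexOn ℝ (closure Ω) g ∧ ContinuousOn g (closure Ω) ∧
      (∀ x ∈ closure Ω, g x ≤ f x) ∧ g y = φ y) :
    ∃ u, IsAdmissible Ω φ u ∧ (∀ x ∈ closure Ω, u x ≤ f x) ∧
      (∀ g, ConvexOn ℝ (closure Ω) g → ContinuousOn g (closure Ω) →
        (∀ x ∈ closure Ω, g x ≤ f x) → ∀ x ∈ closure Ω, g x ≤ u x) ∧
      ∀ x ∈ Ω, ∀ p ∈ subgrad Ω u x, p ∈ multiSlopes Ω u ∨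
        (u x = f x ∧ ∀ z ∈ closure Ω, f x + ⟪p, z - x⟫ ≤ f z) := by
  set S : Set (EuclideanSpace ℝ (Fin n) → ℝ) := {g | ConvexOn ℝ (closure Ω) g ∧
    ContinuousOn g (closure Ω) ∧ ∀ x ∈ closure Ω, g x ≤ f x} with hS
  have h0S : (fun _ => 0) ∈ S := ⟨convexOn_const 0 hΩc.closure, continuousOn_const, hf0⟩
  have : Nonempty S := ⟨⟨_, h0S⟩⟩
  set u : EuclideanSpace ℝ (Fin n) → ℝ := fun x => ⨆ g : S, g.1 x with hu
  have hle : ∀ g ∈ S, ∀ x ∈ closure Ω, g x ≤ u x := fun g hg x hx =>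
    le_ciSup (f := fun g : S => g.1 x) ⟨f x, by rintro _ ⟨g, rfl⟩; exact g.2.2.2 x hx⟩ ⟨g, hg⟩
  have huf : ∀ x ∈ closure Ω, u x ≤ f x := fun x hx => ciSup_le fun g => g.2.2.2 x hx
  have huc : ConvexOn ℝ (closure Ω) u := by
    refine ⟨hΩc.closure, fun x hx y hy a b ha hb hab => ciSup_le fun g => ?_⟩
    refine (g.2.1.2 hx hy ha hb hab).trans ?_
    have h1 := hle g g.2 x hx
    have h2 := hle g g.2 y hy
    simp only [smul_eq_mul]
    gcongr
  have huφ : ∀ y ∈ frontier Ω, u y = φ y := fun y hy => by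
    obtain ⟨g, hg, hgc, hgf, hgy⟩ := hbar y hy
    have hyc := frontier_subset_closure hy
    refine le_antisymm ((huf y hyc).trans (hfφ y hy).le) ?_
    rw [← hgy]
    exact hle g ⟨hg, hgc, hgf⟩ y hyc
  have hucont : ContinuousOn u (closure Ω) := by
    intro y hy
    by_cases hyΩ : y ∈ Ω
    · exact (((huc.subset subset_closure hΩc).continuousOn hΩo).continuousAt
        (hΩo.mem_nhds hyΩ)).continuousWithinAt
    have hyf : y ∈ frontier Ω := by rw [hΩo.frontier_eq]; exact ⟨hy, hyΩ⟩
    obtain ⟨g, hg, hgc, hgf, hgy⟩ := hbar y hyf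
    rw [ContinuousWithinAt, huφ y hyf]
    refine tendsto_order.2 ⟨fun a ha => ?_, fun a ha => ?_⟩
    · filter_upwards [(hgc y hy).tendsto (Ioi_mem_nhds (hgy.symm ▸ ha)), self_mem_nhdsWithin]
        with x hx hxc
      exact lt_of_lt_of_le hx (hle g ⟨hg, hgc, hgf⟩ x hxc)
    · have h := eventually_forall_convexOn_le_add (M := M) hΩo hΩc hΩb hΩne hφc hyf
        (ε := (a - φ y) / 2) (by linarith)
      filter_upwards [nhdsWithin_le_nhds h, self_mem_nhdsWithin] with x hx hxc
      have := hx hxc u huc (fun z hz => (huφ z hz).le) fun z hz => (huf z hz).trans (hfM z hz)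
      linarith
  refine ⟨u, ⟨huc, hucont, fun x hx => hle _ h0S x hx, huφ⟩, huf,
    fun g hg hgc hgf => hle g ⟨hg, hgc, hgf⟩, fun x hx p hp => ?_⟩
  have hxc := subset_closure hx
  have hp' := le_of_mem_subgrad_of_mem_closure hucont hp
  have hlsc : LowerSemicontinuousOn (fun z => f z + -⟪p, z - x⟫) (closure Ω) :=
    hflsc.add (ContinuousOn.lowerSemicontinuousOn (by fun_prop))
  obtain ⟨x₁, hx₁, hmin⟩ := hlsc.exists_isMinOn ⟨x, hxc⟩ hΩb.isCompact_closure
  have hmin' : ∀ z ∈ closure Ω, f x₁ - ⟪p, x₁ - x⟫ ≤ f z - ⟪p, z - x⟫ := fun z hz => hmin hz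
  have hle₁ : f x₁ - ⟪p, x₁ - x⟫ ≤ u x := by
    have hmem : (fun z => f x₁ - ⟪p, x₁ - x⟫ + ⟪p, z - x⟫) ∈ S := by
      refine ⟨?_, by fun_prop, fun z hz => by linarith [hmin' z hz]⟩
      have h1 : ConvexOn ℝ (closure Ω) fun z => ⟪p, z⟫ + (f x₁ - ⟪p, x₁ - x⟫ - ⟪p, x⟫) :=
        ((innerₛₗ ℝ p).convexOn hΩc.closure).add_const _
      refine h1.congr fun z _ => ?_
      simp only [inner_sub_right]
      ring
    have := hle _ hmem x hxc
    simpa using this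
  have hx₁p := hp' x₁ hx₁
  have hu₁ : u x₁ = u x + ⟪p, x₁ - x⟫ := by linarith [huf x₁ hx₁]
  rcases eq_or_ne x₁ x with rfl | hne
  · right
    simp only [sub_self, inner_zero_right, sub_zero] at hle₁ hmin'
    have heq := le_antisymm (huf x₁ hxc) hle₁
    exact ⟨heq, fun z hz => by linarith [hmin' z hz]⟩
  · left
    refine ⟨x, hxc, x₁, hx₁, hne.symm, hp', fun z hz => ?_⟩
    have := hp' z hz
    rw [hu₁]
    have h2 : ⟪p, z - x⟫ = ⟪p, x₁ - x⟫ + ⟪p, z - x₁⟫ := by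
      rw [← inner_add_right]; congr 1; abel
    linarith

theorem MongeAmpereLE.volume_subgradImg_le {n : ℕ} {q : ℝ} (hq : 0 ≤ q)
    {Ω : Set (EuclideanSpace ℝ (Fin n))} (hΩo : IsOpen Ω)
    {μ : Measure (EuclideanSpace ℝ (Fin n))}
    {T : EuclideanSpace ℝ (Fin n) → EuclideanSpace ℝ (Fin n)}
    (hTm : Measurable T) {φ w : EuclideanSpace ℝ (Fin n) → ℝ} {M : ℝ}
    (hw : IsAdmissible Ω φ w) (hwM : ∀ x ∈ closure Ω, w x ≤ M) (hle : MongeAmpereLE q Ω μ T w) :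
    volume (subgradImg Ω w Ω) ≤ ENNReal.ofReal (M ^ q) * μ univ :=
  calc volume (subgradImg Ω w Ω) ≤ ∫⁻ x in T ⁻¹' Ω, ENNReal.ofReal (w (T x) ^ q) ∂μ :=
        hle Ω hΩo.measurableSet subset_rfl
    _ ≤ ∫⁻ _ in T ⁻¹' Ω, ENNReal.ofReal (M ^ q) ∂μ :=
        setLIntegral_mono' (hTm hΩo.measurableSet) fun x hx => ENNReal.ofReal_le_ofReal
          (Real.rpow_le_rpow (hw.nonneg _ (subset_closure hx)) (hwM _ (subset_closure hx)) hq)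
    _ ≤ _ := by
        rw [setLIntegral_const]
        gcongr
        exact subset_univ _

/-- The convex envelope of the boundary values has vanishing Monge–Ampère measure. -/
theorem exists_isAdmissible_volume_eq_zero {n : ℕ} (hn : n ≠ 0)
    {Ω : Set (EuclideanSpace ℝ (Fin n))}
    (hΩo : IsOpen Ω) (hΩc : Convex ℝ Ω) (hΩb : Bornology.IsBounded Ω) (hΩne : Ω.Nonempty)
    {φ : EuclideanSpace ℝ (Fin n) → ℝ} (hφc : ContinuousOn φ (closure Ω))
    (hφ : ConvexOn ℝ (closure Ω) φ) (hφ0 : ∀ x ∈ frontier Ω, 0 ≤ φ x) :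
    ∃ u, IsAdmissible Ω φ u ∧ volume (subgradImg Ω u Ω) = 0 := by
  classical
  obtain ⟨M, hM⟩ := hΩb.isCompact_closure.exists_bound_of_continuousOn hφc
  simp only [Real.norm_eq_abs] at hM
  have hφM : ∀ x ∈ closure Ω, φ x ≤ M := fun x hx => (le_abs_self _).trans (hM x hx)
  have hM0 : 0 ≤ M := by
    obtain ⟨z, hz⟩ := hΩne
    exact (abs_nonneg _).trans (hM z (subset_closure hz))
  set f : EuclideanSpace ℝ (Fin n) → ℝ := fun x => if x ∈ Ω then M + 1 else φ x with hf
  have hfΩ : ∀ x ∈ Ω, f x = M + 1 := fun x hx => if_pos hx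
  have hffr : ∀ x ∈ frontier Ω, f x = φ x := fun x hx => if_neg (by
    rw [hΩo.frontier_eq] at hx; exact hx.2)
  have hcases : ∀ x ∈ closure Ω, x ∈ Ω ∨ x ∈ frontier Ω := fun x hx => by
    rw [hΩo.frontier_eq]; by_cases h : x ∈ Ω
    · exact Or.inl h
    · exact Or.inr ⟨hx, h⟩
  have hφf : ∀ x ∈ closure Ω, φ x ≤ f x := fun x hx => by
    rcases hcases x hx with h | h
    · rw [hfΩ x h]; linarith [hφM x hx]
    · exact (hffr x h).ge
  have hlsc : LowerSemicontinuousOn f (closure Ω) := by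
    intro x hx a ha
    rcases hcases x hx with h | h
    · rw [hfΩ x h] at ha
      filter_upwards [nhdsWithin_le_nhds (hΩo.mem_nhds h)] with y hy
      rwa [hfΩ y hy]
    · rw [hffr x h] at ha
      filter_upwards [(hφc x hx).tendsto (Ioi_mem_nhds ha), self_mem_nhdsWithin] with y hy hyc
      exact lt_of_lt_of_le hy (hφf y hyc)
  have hf0 : ∀ x ∈ closure Ω, 0 ≤ f x := fun x hx => by
    rcases hcases x hx with h | h
    · rw [hfΩ x h]; linarith
    · rw [hffr x h]; exact hφ0 x h
  have hfM : ∀ x ∈ closure Ω, f x ≤ M + 1 := fun x hx => by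
    rcases hcases x hx with h | h
    · rw [hfΩ x h]
    · rw [hffr x h]; linarith [hφM x hx]
  obtain ⟨u, hu, huf, -, hsub⟩ := exists_convex_envelope hΩo hΩc hΩb hΩne hφc hf0 hfM hffr hlsc
    (fun y _ => ⟨φ, hφ, hφc, hφf, rfl⟩)
  refine ⟨u, hu, measure_mono_null ?_ (volume_multiSlopes hΩb hu.continuousOn)⟩
  intro p hp
  obtain ⟨x, hx, hpx⟩ := mem_subgradImg.1 hp
  rcases hsub x hx p hpx with h | ⟨h, -⟩
  · exact h
  · have := le_of_convexOn_of_le_frontier hn hΩo hΩc hΩb hu.convexOn (M := M)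
      (fun y hy => (hu.eq_of_mem_frontier y hy).trans_le (hφM y (frontier_subset_closure hy)))
      x (subset_closure hx)
    rw [hfΩ x hx] at h
    linarith

/-- Lowering `v` at a single point of positivity and taking the convex envelope. -/
theorem exists_isAdmissible_lower_at {n : ℕ}
    {Ω : Set (EuclideanSpace ℝ (Fin n))}
    (hΩo : IsOpen Ω) (hΩc : Convex ℝ Ω) (hΩb : Bornology.IsBounded Ω) (hΩne : Ω.Nonempty)
    {φ : EuclideanSpace ℝ (Fin n) → ℝ} (hφc : ContinuousOn φ (closure Ω))
    {v : EuclideanSpace ℝ (Fin n) → ℝ} {M : ℝ} (hv : IsAdmissible Ω φ v)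
    (hvM : ∀ x ∈ closure Ω, v x ≤ M) {s : EuclideanSpace ℝ (Fin n)} (hs : s ∈ Ω) {ε : ℝ}
    (hε : 0 < ε) (hεs : ε ≤ v s) : ∃ u, IsAdmissible Ω φ u ∧ (∀ x ∈ closure Ω, u x ≤ v x) ∧
      (∀ x ∈ closure Ω, v x - ε ≤ u x) ∧ u s < v s ∧
      ∀ x ∈ Ω, x ≠ s → ∀ p ∈ subgrad Ω u x,
        p ∈ multiSlopes Ω u ∨ (u x = v x ∧ p ∈ subgrad Ω v x) := by
  classical
  set f : EuclideanSpace ℝ (Fin n) → ℝ := Function.update v s (v s - ε) with hf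
  have hfs : f s = v s - ε := Function.update_self ..
  have hfne : ∀ x, x ≠ s → f x = v x := fun x hx => Function.update_of_ne hx ..
  have hfv : ∀ x, f x ≤ v x := fun x => by
    rcases eq_or_ne x s with rfl | h
    · linarith
    · exact (hfne x h).le
  have hvf : ∀ x, v x - ε ≤ f x := fun x => by
    rcases eq_or_ne x s with rfl | h
    · exact hfs.ge
    · rw [hfne x h]; linarith
  have hfr : ∀ y ∈ frontier Ω, y ≠ s := by
    rintro y hy rfl
    rw [hΩo.frontier_eq] at hy
    exact hy.2 hs
  have hlsc : LowerSemicontinuousOn f (closure Ω) := by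
    intro x hx a ha
    rcases eq_or_ne x s with rfl | hne
    · filter_upwards [(hv.continuousOn x hx).tendsto (Ioi_mem_nhds
        (show a < v x from lt_of_lt_of_le ha (hfv x)))] with y hy
      rcases eq_or_ne y x with rfl | h
      · exact ha
      · rw [hfne y h]; exact hy
    · have hav : a < v x := lt_of_lt_of_le ha (hfv x)
      filter_upwards [(hv.continuousOn x hx).tendsto (Ioi_mem_nhds hav),
        nhdsWithin_le_nhds (isOpen_ne.mem_nhds hne)] with y hy hys
      rw [hfne y hys]
      exact hy
  have hf0 : ∀ x ∈ closure Ω, 0 ≤ f x := fun x hx => by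
    rcases eq_or_ne x s with rfl | h
    · linarith
    · rw [hfne x h]; exact hv.nonneg x hx
  have hbar : ∀ y ∈ frontier Ω, ∃ g, ConvexOn ℝ (closure Ω) g ∧ ContinuousOn g (closure Ω) ∧
      (∀ x ∈ closure Ω, g x ≤ f x) ∧ g y = φ y := by
    intro y hy
    obtain ⟨ν, -, hνpos, hνnn⟩ := exists_unit_normal hΩo hΩc hΩne hy
    have hts := hνpos s hs
    set κ : ℝ := ε / ⟪ν, y - s⟫ with hκ
    have hκ0 : 0 < κ := by positivity
    have hlin : ConvexOn ℝ (closure Ω) fun x => -(κ * ⟪ν, y - x⟫) := by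
      have h1 : ConvexOn ℝ (closure Ω) fun z => ⟪κ • ν, z⟫ + -(κ * ⟪ν, y⟫) :=
        ((innerₛₗ ℝ (κ • ν)).convexOn hΩc.closure).add_const _
      refine h1.congr fun z _ => ?_
      simp only [inner_sub_right, real_inner_smul_left]
      ring
    refine ⟨fun x => v x + -(κ * ⟪ν, y - x⟫), hv.convexOn.add hlin,
      hv.continuousOn.add (by fun_prop), fun x hx => ?_, ?_⟩
    · rcases eq_or_ne x s with rfl | h
      · have : κ * ⟪ν, y - x⟫ = ε := by rw [hκ]; field_simp
        linarith
      · rw [hfne x h]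
        linarith [mul_nonneg hκ0.le (hνnn x hx)]
    · simp [hv.eq_of_mem_frontier y hy]
  obtain ⟨u, hu, huf, hmax, hsub⟩ := exists_convex_envelope hΩo hΩc hΩb hΩne hφc hf0
    (fun x hx => (hfv x).trans (hvM x hx))
    (fun y hy => (hfne y (hfr y hy)).trans (hv.eq_of_mem_frontier y hy)) hlsc hbar
  refine ⟨u, hu, fun x hx => (huf x hx).trans (hfv x), hmax _ ?_ ?_ fun x _ => hvf x, ?_,
    fun x hx hxs p hp => ?_⟩
  · exact (hv.convexOn.add_const (-ε)).congr fun x _ => (sub_eq_add_neg _ _).symm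
  · exact hv.continuousOn.sub continuousOn_const
  · have := huf s (subset_closure hs)
    linarith
  · refine (hsub x hx p hp).imp_right ?_
    rw [hfne x hxs]
    exact fun ⟨h1, h2⟩ => ⟨h1, fun z hz => (h2 z (subset_closure hz)).trans (hfv z)⟩

theorem exists_lt_of_volume_subgradImg_lt {n : ℕ} {q : ℝ} (hq : 0 ≤ q)
    {Ω : Set (EuclideanSpace ℝ (Fin n))}
    (hΩo : IsOpen Ω) (hΩc : Convex ℝ Ω) (hΩb : Bornology.IsBounded Ω) (hΩne : Ω.Nonempty)
    {φ : EuclideanSpace ℝ (Fin n) → ℝ} (hφc : ContinuousOn φ (closure Ω))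
    {μ : Measure (EuclideanSpace ℝ (Fin n))} [IsFiniteMeasure μ]
    {T : EuclideanSpace ℝ (Fin n) → EuclideanSpace ℝ (Fin n)} (hTm : Measurable T)
    {v : EuclideanSpace ℝ (Fin n) → ℝ} {M : ℝ} (hv : IsAdmissible Ω φ v)
    (hvM : ∀ x ∈ closure Ω, v x ≤ M) (hle : MongeAmpereLE q Ω μ T v)
    {s : EuclideanSpace ℝ (Fin n)} (hs : s ∈ Ω) (hvs : 0 < v s)
    (hlt : volume (subgradImg Ω v {s}) < ENNReal.ofReal (v s ^ q) * μ (T ⁻¹' {s})) :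
    ∃ u, IsAdmissible Ω φ u ∧ MongeAmpereLE q Ω μ T u ∧ (∀ x ∈ closure Ω, u x ≤ v x) ∧
      u s < v s := by
  have hεpos : ∀ j : ℕ, 0 < v s / ((j : ℝ) + 1) := fun j => by positivity
  have hε0 : Tendsto (fun j : ℕ => v s / ((j : ℝ) + 1)) atTop (𝓝 0) := by
    simpa [div_eq_mul_inv] using (tendsto_one_div_add_atTop_nhds_zero_nat (𝕜 := ℝ)).const_mul (v s)
  choose u hu huv hvu hus hsub using fun j : ℕ =>
    exists_isAdmissible_lower_at hΩo hΩc hΩb hΩne hφc hv hvM hs (hεpos j)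
      (div_le_self hvs.le (by linarith [Nat.cast_nonneg (α := ℝ) j]))
  have hlim : TendstoUniformlyOn u v atTop (closure Ω) := by
    rw [Metric.tendstoUniformlyOn_iff]
    intro ε hε
    filter_upwards [hε0 (Iio_mem_nhds hε)] with j hj x hx
    rw [Real.dist_eq, abs_of_nonneg (by linarith [huv j x hx])]
    have hj' : v s / ((j : ℝ) + 1) < ε := hj
    linarith [hvu j x hx]
  obtain ⟨V, hV, hVo, hVlt⟩ := Set.exists_isOpen_lt_of_lt _ _ hlt
  obtain ⟨δ, hδ, -, hev⟩ := eventually_subgradImg_subset (M := M) hΩo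
    (fun k x hx => by
      have hxc := subset_closure hx
      rw [abs_of_nonneg ((hu k).nonneg x hxc)]
      exact (huv k x hxc).trans (hvM x hxc))
    (hv.continuousOn.mono subset_closure) (hlim.mono subset_closure) isCompact_singleton
    (singleton_subset_iff.2 hs) hVo hV
  have hmass : ∀ᶠ j in atTop, volume V < ENNReal.ofReal (u j s ^ q) * μ (T ⁻¹' {s}) := by
    have h1 : Tendsto (fun j => ENNReal.ofReal (u j s ^ q)) atTop
        (𝓝 (ENNReal.ofReal (v s ^ q))) := ENNReal.tendsto_ofReal
      (((Real.continuous_rpow_const hq).tendsto _).comp (hlim.tendsto_at (subset_closure hs)))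
    have h2 := ENNReal.Tendsto.mul_const (b := μ (T ⁻¹' {s})) h1 (Or.inr (measure_ne_top _ _))
    exact h2 (Ioi_mem_nhds hVlt)
  obtain ⟨j, hjV, hjm⟩ := (hev.and hmass).exists
  refine ⟨u j, hu j, fun E hE hEΩ => ?_, huv j, hus j⟩
  set C : Set (EuclideanSpace ℝ (Fin n)) := closure Ω ∩ (fun x => u j x - v x) ⁻¹' {0} with hC
  have hCm : MeasurableSet C := (((hu j).continuousOn.sub
    hv.continuousOn).preimage_isClosed_of_isClosed isClosed_closure
      isClosed_singleton).measurableSet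
  have hCeq : ∀ x ∈ C, u j x = v x := fun x hx => sub_eq_zero.1 hx.2
  set F : Set (EuclideanSpace ℝ (Fin n)) := (E ∩ C) \ {s} with hF
  have hFm : MeasurableSet F := (hE.inter hCm).diff (measurableSet_singleton s)
  have hFE : F ⊆ E := sdiff_subset.trans inter_subset_left
  have hcover : subgradImg Ω (u j) E ⊆
      (multiSlopes Ω (u j) ∪ subgradImg Ω v F) ∪ subgradImg Ω (u j) (E ∩ {s}) := by
    intro p hp
    obtain ⟨x, hx, hpx⟩ := mem_subgradImg.1 hp
    rcases eq_or_ne x s with rfl | hxs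
    · exact Or.inr (mem_subgradImg.2 ⟨x, ⟨hx, rfl⟩, hpx⟩)
    · rcases hsub j x (hEΩ hx) hxs p hpx with h | ⟨h1, h2⟩
      · exact Or.inl (Or.inl h)
      · exact Or.inl (Or.inr (mem_subgradImg.2
          ⟨x, ⟨⟨hx, subset_closure (hEΩ hx), sub_eq_zero.2 h1⟩, hxs⟩, h2⟩))
  have hvolF : volume (subgradImg Ω v F) ≤ ∫⁻ x in T ⁻¹' F, ENNReal.ofReal (u j (T x) ^ q) ∂μ := by
    refine (hle F hFm (hFE.trans hEΩ)).trans_eq (setLIntegral_congr_fun (hTm hFm) fun x hx => ?_)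
    have hx' : T x ∈ C := hx.1.2
    simp only [hCeq _ hx']
  have hvols : volume (subgradImg Ω (u j) (E ∩ {s})) ≤
      ∫⁻ x in T ⁻¹' (E ∩ {s}), ENNReal.ofReal (u j (T x) ^ q) ∂μ := by
    by_cases hsE : s ∈ E
    · rw [inter_eq_right.2 (singleton_subset_iff.2 hsE)]
      calc volume (subgradImg Ω (u j) {s}) ≤ volume V :=
            measure_mono ((subgradImg_mono (self_subset_cthickening _)).trans hjV)
        _ ≤ ENNReal.ofReal (u j s ^ q) * μ (T ⁻¹' {s}) := hjm.le
        _ = ∫⁻ _ in T ⁻¹' {s}, ENNReal.ofReal (u j s ^ q) ∂μ := (setLIntegral_const _ _).symm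
        _ = _ := setLIntegral_congr_fun (hTm (measurableSet_singleton s)) fun x hx => by
            have hx' : T x = s := hx
            simp only [hx']
    · rw [inter_singleton_eq_empty.2 hsE]
      simp [subgradImg]
  calc volume (subgradImg Ω (u j) E)
      ≤ volume (multiSlopes Ω (u j)) + volume (subgradImg Ω v F)
        + volume (subgradImg Ω (u j) (E ∩ {s})) :=
        (measure_mono hcover).trans ((measure_union_le _ _).trans
          (add_le_add_left (measure_union_le _ _) _))
    _ ≤ ∫⁻ x in T ⁻¹' F, ENNReal.ofReal (u j (T x) ^ q) ∂μ
        + ∫⁻ x in T ⁻¹' (E ∩ {s}), ENNReal.ofReal (u j (T x) ^ q) ∂μ := by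
        rw [volume_multiSlopes hΩb (hu j).continuousOn, zero_add]
        exact add_le_add hvolF hvols
    _ = ∫⁻ x in T ⁻¹' F ∪ T ⁻¹' (E ∩ {s}), ENNReal.ofReal (u j (T x) ^ q) ∂μ := by
        refine (lintegral_union (hTm (hE.inter (measurableSet_singleton s))) ?_).symm
        exact Disjoint.preimage T (disjoint_left.2 fun x hx hx' => hx.2 hx'.2)
    _ ≤ _ := lintegral_mono_set (union_subset (preimage_mono hFE)
        (preimage_mono inter_subset_left))

/-- Existence for a measure concentrated on finitely many points, by minimization. -/
theorem exists_discrete_solution {n : ℕ} (hn : n ≠ 0) {q : ℝ} (hq : 0 ≤ q)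
    {Ω : Set (EuclideanSpace ℝ (Fin n))}
    (hΩo : IsOpen Ω) (hΩc : Convex ℝ Ω) (hΩb : Bornology.IsBounded Ω) (hΩne : Ω.Nonempty)
    {μ : Measure (EuclideanSpace ℝ (Fin n))} [IsFiniteMeasure μ] (hμΩ : μ Ωᶜ = 0)
    {φ : EuclideanSpace ℝ (Fin n) → ℝ} (hφc : ContinuousOn φ (closure Ω))
    (hφ : ConvexOn ℝ (closure Ω) φ) (hφ0 : ∀ x ∈ frontier Ω, 0 ≤ φ x) {M : ℝ}
    (hM : ∀ w, IsAdmissible Ω φ w → ∀ x ∈ closure Ω, w x ≤ M)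
    (T : SimpleFunc (EuclideanSpace ℝ (Fin n)) (EuclideanSpace ℝ (Fin n)))
    (hT : ∀ x, T x ∈ Ω) :
    ∃ v, IsAdmissible Ω φ v ∧ MongeAmpereLE q Ω μ T v ∧
      ∀ E : Set (EuclideanSpace ℝ (Fin n)), MeasurableSet E → E ⊆ {x ∈ Ω | 0 < v x} →
        ∫⁻ x in T ⁻¹' E, ENNReal.ofReal (v (T x) ^ q) ∂μ ≤ volume (subgradImg Ω v E) := by
  classical
  set S : Set (EuclideanSpace ℝ (Fin n) → ℝ) :=
    {w | IsAdmissible Ω φ w ∧ MongeAmpereLE q Ω μ T w} with hS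
  have hRΩ : ∀ s ∈ T.range, s ∈ closure Ω := fun s hs => by
    obtain ⟨x, rfl⟩ := SimpleFunc.mem_range.1 hs
    exact subset_closure (hT x)
  set J : (EuclideanSpace ℝ (Fin n) → ℝ) → ℝ := fun w => ∑ s ∈ T.range, w s with hJ
  obtain ⟨u, hu, hu0⟩ := exists_isAdmissible_volume_eq_zero hn hΩo hΩc hΩb hΩne hφc hφ hφ0
  have hSne : (J '' S).Nonempty := ⟨_, u, ⟨hu, fun E _ hE => by
    rw [measure_mono_null (subgradImg_mono hE) hu0]; exact zero_le⟩, rfl⟩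
  have hSbdd : BddBelow (J '' S) := by
    refine ⟨0, ?_⟩
    rintro _ ⟨w, hw, rfl⟩
    exact Finset.sum_nonneg fun s hs => hw.1.nonneg s (hRΩ s hs)
  obtain ⟨a, -, ha, haS⟩ := exists_seq_tendsto_sInf hSne hSbdd
  choose w hwS hwa using haS
  have hA : ENNReal.ofReal (M ^ q) * μ univ ≠ ⊤ :=
    ENNReal.mul_ne_top ENNReal.ofReal_ne_top (measure_ne_top _ _)
  obtain ⟨v, k, hk, hv, hlim⟩ := exists_subseq_tendstoUniformlyOn (M := M) hn hΩo hΩc hΩb hΩne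
    hφc hφ hA (fun j => (hwS j).1) (fun j => hM _ (hwS j).1) fun j =>
      (hwS j).2.volume_subgradImg_le hq hΩo T.measurable (hwS j).1 (hM _ (hwS j).1)
  have hvle : MongeAmpereLE q Ω μ T v :=
    MongeAmpereLE.of_tendstoUniformlyOn (T := fun _ => T) hq hΩo hΩb hμΩ T.measurable
      (fun _ => hT) (fun x _ => hT x) (fun _ _ => tendsto_const_nhds)
      (fun j => (hwS (k j)).1.convexOn) (fun j => (hwS (k j)).1.continuousOn)
      (fun j => (hwS (k j)).1.nonneg) (fun j => hM _ (hwS (k j)).1) hv.continuousOn hlim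
      fun j => (hwS (k j)).2
  have hJv : J v = sInf (J '' S) := by
    refine tendsto_nhds_unique (tendsto_finsetSum _ fun s hs => hlim.tendsto_at (hRΩ s hs))
      ((ha.comp hk.tendsto_atTop).congr fun j => (hwa (k j)).symm)
  have hatom : ∀ s ∈ T.range, 0 < v s →
      ENNReal.ofReal (v s ^ q) * μ (T ⁻¹' {s}) ≤ volume (subgradImg Ω v {s}) := by
    intro s hs hvs
    by_contra! hlt
    obtain ⟨x, rfl⟩ := SimpleFunc.mem_range.1 hs
    obtain ⟨w', hw', hw'le, hw'v, hw's⟩ := exists_lt_of_volume_subgradImg_lt hq hΩo hΩc hΩb hΩne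
      hφc T.measurable hv (hM v hv) hvle (hT x) hvs hlt
    have h1 : J w' < J v := Finset.sum_lt_sum (fun s hs => hw'v s (hRΩ s hs)) ⟨_, hs, hw's⟩
    have h2 : sInf (J '' S) ≤ J w' := csInf_le hSbdd ⟨w', ⟨hw', hw'le⟩, rfl⟩
    linarith
  refine ⟨v, hv, hvle, fun E hE hEpos => ?_⟩
  set R := T.range.filter (· ∈ E) with hR
  have hclosed : ∀ s, IsClosed (subgradImg Ω v {s}) := fun s => by
    have : subgradImg Ω v {s} = ⋂ y ∈ Ω, {p | v s + ⟪p, y - s⟫ ≤ v y} := by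
      ext p
      simp [subgradImg, subgrad]
    rw [this]
    exact isClosed_biInter fun y _ => isClosed_le (by fun_prop) continuous_const
  have hRE : ∀ s ∈ R, s ∈ E := fun s hs => (Finset.mem_filter.1 hs).2
  have hdisj : (R : Set (EuclideanSpace ℝ (Fin n))).Pairwise
      (Function.onFun (AEDisjoint volume) fun s => subgradImg Ω v {s}) := by
    intro s hs s' hs' hne
    refine measure_mono_null ?_ (volume_multiSlopes hΩb hv.continuousOn)
    rintro p ⟨hp, hp'⟩
    simp only [subgradImg, mem_singleton_iff, iUnion_iUnion_eq_left] at hp hp'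
    exact ⟨s, subset_closure (hEpos (hRE s hs)).1, s', subset_closure (hEpos (hRE s' hs')).1, hne,
      le_of_mem_subgrad_of_mem_closure hv.continuousOn hp,
      le_of_mem_subgrad_of_mem_closure hv.continuousOn hp'⟩
  calc ∫⁻ x in T ⁻¹' E, ENNReal.ofReal (v (T x) ^ q) ∂μ
      = ∫⁻ x in ⋃ s ∈ R, T ⁻¹' {s}, ENNReal.ofReal (v (T x) ^ q) ∂μ := by
        congr 2
        ext x
        simp [hR]
    _ = ∑ s ∈ R, ∫⁻ x in T ⁻¹' {s}, ENNReal.ofReal (v (T x) ^ q) ∂μ := by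
        refine lintegral_biUnion_finset (fun s _ s' _ hne => ?_)
          (fun s _ => T.measurable (measurableSet_singleton s)) _
        exact Disjoint.preimage T (disjoint_singleton.2 hne)
    _ = ∑ s ∈ R, ENNReal.ofReal (v s ^ q) * μ (T ⁻¹' {s}) := by
        refine Finset.sum_congr rfl fun s _ => ?_
        rw [← setLIntegral_const]
        refine setLIntegral_congr_fun (T.measurable (measurableSet_singleton s)) fun x hx => ?_
        have hx' : T x = s := hx
        simp only [hx']
    _ ≤ ∑ s ∈ R, volume (subgradImg Ω v {s}) := Finset.sum_le_sum fun s hs =>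
        hatom s (Finset.mem_filter.1 hs).1 (hEpos (hRE s hs)).2
    _ = volume (⋃ s ∈ R, subgradImg Ω v {s}) :=
        (measure_biUnion_finset₀ hdisj fun s _ => (hclosed s).measurableSet.nullMeasurableSet).symm
    _ ≤ _ := measure_mono (iUnion₂_subset fun s hs =>
        subgradImg_mono (singleton_subset_iff.2 (hRE s hs)))

/-- Existence for a general measure, by discretization. -/
theorem exists_solution {n : ℕ} (hn : n ≠ 0) {q : ℝ} (hq : 0 ≤ q)
    {Ω : Set (EuclideanSpace ℝ (Fin n))}
    (hΩo : IsOpen Ω) (hΩc : Convex ℝ Ω) (hΩb : Bornology.IsBounded Ω) (hΩne : Ω.Nonempty)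
    {μ : Measure (EuclideanSpace ℝ (Fin n))} [IsFiniteMeasure μ] (hμΩ : μ Ωᶜ = 0)
    {φ : EuclideanSpace ℝ (Fin n) → ℝ} (hφc : ContinuousOn φ (closure Ω))
    (hφ : ConvexOn ℝ (closure Ω) φ) (hφ0 : ∀ x ∈ frontier Ω, 0 ≤ φ x) {M : ℝ}
    (hM : ∀ w, IsAdmissible Ω φ w → ∀ x ∈ closure Ω, w x ≤ M) :
    ∃ v, IsAdmissible Ω φ v ∧ MongeAmpereLE q Ω μ id v ∧
      ∀ E : Set (EuclideanSpace ℝ (Fin n)), MeasurableSet E → E ⊆ {x ∈ Ω | 0 < v x} →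
        ∫⁻ x in E, ENNReal.ofReal (v x ^ q) ∂μ ≤ volume (subgradImg Ω v E) := by
  obtain ⟨z, hz⟩ := id hΩne
  set T : ℕ → SimpleFunc (EuclideanSpace ℝ (Fin n)) (EuclideanSpace ℝ (Fin n)) := fun k =>
    SimpleFunc.approxOn id measurable_id Ω z hz k
  have hT : ∀ k x, T k x ∈ Ω := fun k x => SimpleFunc.approxOn_mem measurable_id hz k x
  have hTid : ∀ x ∈ Ω, Tendsto (fun k => T k x) atTop (𝓝 x) := fun x hx =>
    SimpleFunc.tendsto_approxOn measurable_id hz (subset_closure hx)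
  choose w hw hwle hwge using fun k =>
    exists_discrete_solution hn hq hΩo hΩc hΩb hΩne hμΩ hφc hφ hφ0 hM (T k) (hT k)
  have hA : ENNReal.ofReal (M ^ q) * μ univ ≠ ⊤ :=
    ENNReal.mul_ne_top ENNReal.ofReal_ne_top (measure_ne_top _ _)
  obtain ⟨v, k, hk, hv, hlim⟩ := exists_subseq_tendstoUniformlyOn (M := M) hn hΩo hΩc hΩb hΩne
    hφc hφ hA hw (fun j => hM _ (hw j)) fun j =>
      (hwle j).volume_subgradImg_le hq hΩo (T j).measurable (hw j) (hM _ (hw j))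
  have hTk : ∀ x ∈ Ω, Tendsto (fun j => T (k j) x) atTop (𝓝 x) := fun x hx =>
    (hTid x hx).comp hk.tendsto_atTop
  refine ⟨v, hv, ?_, fun E hE hEpos => ?_⟩
  · exact MongeAmpereLE.of_tendstoUniformlyOn (T := fun j => T (k j)) hq hΩo hΩb hμΩ measurable_id
      (fun j => hT (k j)) (fun x hx => hx) hTk
      (fun j => (hw (k j)).convexOn) (fun j => (hw (k j)).continuousOn)
      (fun j => (hw (k j)).nonneg) (fun j => hM _ (hw (k j))) hv.continuousOn hlim
      fun j => hwle (k j)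
  · exact lintegral_le_volume_subgradImg_of_tendsto hq hΩo hTk (fun j => (hw (k j)).nonneg)
      (fun j => hM _ (hw (k j))) hv.continuousOn hlim (fun j => hwge (k j)) hE hEpos

/-- Comparison principle. -/
theorem le_of_lintegral_le_volume_subgradImg {n : ℕ} (hn : n ≠ 0) {q : ℝ} (hq : 0 ≤ q)
    {Ω : Set (EuclideanSpace ℝ (Fin n))} (hΩo : IsOpen Ω) (hΩc : Convex ℝ Ω)
    (hΩb : Bornology.IsBounded Ω)
    {μ : Measure (EuclideanSpace ℝ (Fin n))} [IsFiniteMeasure μ]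
    {φ v w : EuclideanSpace ℝ (Fin n) → ℝ} {M : ℝ}
    (hM : ∀ w, IsAdmissible Ω φ w → ∀ x ∈ closure Ω, w x ≤ M)
    (hv : IsAdmissible Ω φ v) (hw : IsAdmissible Ω φ w)
    (hvge : ∀ E : Set (EuclideanSpace ℝ (Fin n)), MeasurableSet E → E ⊆ {x ∈ Ω | 0 < v x} →
        ∫⁻ x in E, ENNReal.ofReal (v x ^ q) ∂μ ≤ volume (subgradImg Ω v E))
    (hwle : MongeAmpereLE q Ω μ id w) : ∀ x ∈ closure Ω, v x ≤ w x := by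
  intro x₀ hx₀
  by_contra! hlt
  have hx₀Ω : x₀ ∈ Ω := by
    by_contra h
    have hf : x₀ ∈ frontier Ω := by rw [hΩo.frontier_eq]; exact ⟨hx₀, h⟩
    rw [hv.eq_of_mem_frontier x₀ hf, hw.eq_of_mem_frontier x₀ hf] at hlt
    exact lt_irrefl _ hlt
  have hvM := hM v hv
  have hM0 : 0 ≤ M := (hv.nonneg x₀ hx₀).trans (hvM x₀ hx₀)
  obtain ⟨ε, hε, hε₀⟩ : ∃ ε : ℝ, 0 < ε ∧ w x₀ < (1 + ε) * v x₀ - ε * M := by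
    refine ⟨(v x₀ - w x₀) / (2 * (M + 1)), div_pos (by linarith) (by linarith), ?_⟩
    have h1 : (v x₀ - w x₀) / (2 * (M + 1)) * (M - v x₀) ≤ (v x₀ - w x₀) / 2 := by
      rw [div_mul_eq_mul_div, div_le_div_iff₀ (by linarith) two_pos]
      nlinarith [hv.nonneg x₀ hx₀]
    linarith
  set u : EuclideanSpace ℝ (Fin n) → ℝ := fun x => (1 + ε) * v x - ε * M with hu
  have huv : ∀ x ∈ closure Ω, u x ≤ v x := fun x hx => by
    have := mul_le_mul_of_nonneg_left (hvM x hx) hε.le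
    simp only [hu]
    linarith
  have huc : ContinuousOn u (closure Ω) := (hv.continuousOn.const_mul _).sub continuousOn_const
  set G : Set (EuclideanSpace ℝ (Fin n)) := Ω ∩ (fun x => u x - w x) ⁻¹' Ioi 0 with hG
  have hGo : IsOpen G :=
    ((huc.sub hw.continuousOn).mono subset_closure).isOpen_inter_preimage hΩo isOpen_Ioi
  have hGΩ : G ⊆ Ω := inter_subset_left
  have hGu : ∀ x ∈ G, w x < u x := fun x hx => sub_pos.1 hx.2
  have hfr : ∀ y ∈ frontier G, y ∈ closure Ω ∧ u y ≤ w y := by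
    intro y hy
    have hyc := closure_mono hGΩ (frontier_subset_closure hy)
    refine ⟨hyc, ?_⟩
    by_cases hyΩ : y ∈ Ω
    · rw [hGo.frontier_eq] at hy
      by_contra! h
      exact hy.2 ⟨hyΩ, sub_pos.2 h⟩
    · have hf : y ∈ frontier Ω := by rw [hΩo.frontier_eq]; exact ⟨hyc, hyΩ⟩
      rw [hw.eq_of_mem_frontier y hf, ← hv.eq_of_mem_frontier y hf]
      exact huv y hyc
  have hGpos : G ⊆ {x ∈ Ω | 0 < v x} := fun x hx => ⟨hx.1, by
    have hxc := subset_closure hx.1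
    linarith [hGu x hx, huv x hxc, hw.nonneg x hxc]⟩
  have hx₀G : x₀ ∈ G := ⟨hx₀Ω, sub_pos.2 hε₀⟩
  have htouch : ∀ x ∈ G, ∀ p ∈ subgrad Ω v x, ∀ y ∈ closure Ω,
      u x + ⟪(1 + ε) • p, y - x⟫ ≤ u y := by
    intro x _ p hp y hy
    have h1 := le_of_mem_subgrad_of_mem_closure hv.continuousOn hp y hy
    rw [real_inner_smul_left]
    simp only [hu]
    nlinarith
  have hmem : ∀ x ∈ G, ∀ p ∈ subgrad Ω v x, ∀ e : EuclideanSpace ℝ (Fin n),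
      (∀ y ∈ closure Ω, ⟪e, y - x⟫ < u x - w x) → (1 + ε) • p + e ∈ subgradImg Ω w G := by
    intro x hx p hp e he
    refine mem_subgradImg_of_lt_frontier hΩb hw.convexOn hw.continuousOn hGo hGΩ hx
      fun y hy => ?_
    obtain ⟨hyc, huy⟩ := hfr y hy
    have h1 := htouch x hx p hp y hyc
    have h2 := he y hyc
    rw [inner_add_left]
    linarith
  have hsub : (fun p => (1 + ε) • p) '' subgradImg Ω v G ⊆ subgradImg Ω w G := by
    rintro _ ⟨p, hp, rfl⟩
    obtain ⟨x, hx, hpx⟩ := mem_subgradImg.1 hp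
    have := hmem x hx p hpx 0 fun y _ => by
      rw [inner_zero_left]; exact sub_pos.2 (hGu x hx)
    simpa using this
  have hwpos : 0 < volume (subgradImg Ω w G) := by
    obtain ⟨p, hp⟩ := subgrad_nonempty hΩo
      (hv.convexOn.subset subset_closure hΩc) hx₀Ω
    obtain ⟨D, hD⟩ := isBounded_iff.1 hΩb.closure
    set r : ℝ := (u x₀ - w x₀) / (|D| + 1) with hr
    have hD0 : 0 < |D| + 1 := by positivity
    have hr0 : 0 < r := div_pos (sub_pos.2 hε₀) hD0
    refine (measure_ball_pos volume ((1 + ε) • p) hr0).trans_le (measure_mono fun b hb => ?_)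
    have := hmem x₀ hx₀G p hp (b - (1 + ε) • p) fun y hy => ?_
    · simpa using this
    · rw [mem_ball, dist_eq_norm] at hb
      have hyd : ‖y - x₀‖ < |D| + 1 := by
        rw [← dist_eq_norm]
        exact (hD hy hx₀).trans_lt ((le_abs_self D).trans_lt (lt_add_one _))
      calc ⟪b - (1 + ε) • p, y - x₀⟫ ≤ ‖b - (1 + ε) • p‖ * ‖y - x₀‖ := real_inner_le_norm _ _
        _ ≤ r * ‖y - x₀‖ := by gcongr
        _ < r * (|D| + 1) := by gcongr
        _ = _ := div_mul_cancel₀ _ hD0.ne'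
  have hGm := hGo.measurableSet
  have hwG : volume (subgradImg Ω w G) ≤ volume (subgradImg Ω v G) :=
    calc volume (subgradImg Ω w G) ≤ ∫⁻ x in G, ENNReal.ofReal (w x ^ q) ∂μ := hwle G hGm hGΩ
      _ ≤ ∫⁻ x in G, ENNReal.ofReal (v x ^ q) ∂μ := by
          refine setLIntegral_mono' hGm fun x hx => ENNReal.ofReal_le_ofReal ?_
          have hxc := subset_closure (hGΩ hx)
          exact Real.rpow_le_rpow (hw.nonneg x hxc) (by linarith [hGu x hx, huv x hxc]) hq
      _ ≤ _ := hvge G hGm hGpos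
  have hfin : volume (subgradImg Ω w G) ≠ ⊤ := by
    refine ne_top_of_le_ne_top ?_ ((measure_mono (subgradImg_mono hGΩ)).trans
      (hwle.volume_subgradImg_le hq hΩo measurable_id hw (hM w hw)))
    exact ENNReal.mul_ne_top ENNReal.ofReal_ne_top (measure_ne_top _ _)
  have hscale : ENNReal.ofReal ((1 + ε) ^ n) * volume (subgradImg Ω v G) ≤
      volume (subgradImg Ω w G) := by
    refine le_trans (le_of_eq ?_) (measure_mono hsub)
    rw [image_smul, Measure.addHaar_smul, finrank_euclideanSpace_fin,
      abs_of_pos (pow_pos (by linarith) n)]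
  have hone : 1 < ENNReal.ofReal ((1 + ε) ^ n) := by
    rw [ENNReal.one_lt_ofReal]
    exact one_lt_pow₀ (by linarith) hn
  refine ((ENNReal.mul_lt_mul_iff_left hwpos.ne' hfin).2 hone).not_ge ?_
  rw [one_mul]
  exact le_trans (by gcongr) hscale

theorem subgradImg_congr {n : ℕ} {Ω E : Set (EuclideanSpace ℝ (Fin n))}
    {v w : EuclideanSpace ℝ (Fin n) → ℝ} (h : EqOn v w Ω) (hE : E ⊆ Ω) :
    subgradImg Ω v E = subgradImg Ω w E := by
  refine iUnion₂_congr fun x hx => ?_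
  ext p
  refine forall₂_congr fun y hy => ?_
  rw [h (hE hx), h hy]

theorem mem_obstacleClass_iff {n : ℕ} {q : ℝ} {Ω : Set (EuclideanSpace ℝ (Fin n))}
    {μ : Measure (EuclideanSpace ℝ (Fin n))} {φ w : EuclideanSpace ℝ (Fin n) → ℝ} :
    w ∈ obstacleClass n q Ω μ φ ↔ IsAdmissible Ω φ w ∧ MongeAmpereLE q Ω μ id w :=
  ⟨fun h => ⟨⟨h.2.2.1, h.1, h.2.1, h.2.2.2.1⟩, h.2.2.2.2⟩,
    fun h => ⟨h.1.continuousOn, h.1.nonneg, h.1.convexOn, h.1.eq_of_mem_frontier, h.2⟩⟩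

theorem setLIntegral_rpow_congr {n : ℕ} {q : ℝ} {Ω E : Set (EuclideanSpace ℝ (Fin n))}
    {μ : Measure (EuclideanSpace ℝ (Fin n))} {v w : EuclideanSpace ℝ (Fin n) → ℝ}
    (h : EqOn v w Ω) (hEm : MeasurableSet E) (hE : E ⊆ Ω) :
    ∫⁻ x in E, ENNReal.ofReal (v x ^ q) ∂μ = ∫⁻ x in E, ENNReal.ofReal (w x ^ q) ∂μ :=
  setLIntegral_congr_fun hEm fun x hx => by simp only [h (hE hx)]

theorem mem_obstacleClass_of_eqOn {n : ℕ} {q : ℝ} {Ω : Set (EuclideanSpace ℝ (Fin n))}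
    {μ : Measure (EuclideanSpace ℝ (Fin n))} {φ v w : EuclideanSpace ℝ (Fin n) → ℝ}
    (hv : v ∈ obstacleClass n q Ω μ φ) (h : EqOn w v (closure Ω)) :
    w ∈ obstacleClass n q Ω μ φ := by
  have hΩ : EqOn w v Ω := h.mono subset_closure
  refine ⟨hv.1.congr h, fun x hx => (hv.2.1 x hx).trans_eq (h hx).symm, hv.2.2.1.congr h.symm,
    fun x hx => (h (frontier_subset_closure hx)).trans (hv.2.2.2.1 x hx), fun E hEm hE => ?_⟩
  rw [subgradImg_congr hΩ hE, setLIntegral_rpow_congr hΩ hEm hE]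
  exact hv.2.2.2.2 E hEm hE

theorem obstacleInf_eqOn {n : ℕ} {q : ℝ} {Ω : Set (EuclideanSpace ℝ (Fin n))}
    {μ : Measure (EuclideanSpace ℝ (Fin n))} {φ v : EuclideanSpace ℝ (Fin n) → ℝ}
    (hv : v ∈ obstacleClass n q Ω μ φ)
    (hmin : ∀ w ∈ obstacleClass n q Ω μ φ, ∀ x ∈ closure Ω, v x ≤ w x) :
    EqOn (obstacleInf n q Ω μ φ) v (closure Ω) := by
  intro x hx
  have hleast : IsLeast (range fun w : obstacleClass n q Ω μ φ => w.1 x) (v x) :=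
    ⟨⟨⟨v, hv⟩, rfl⟩, forall_mem_range.2 fun w => hmin w.1 w.2 x hx⟩
  exact hleast.csInf_eq

end

/-- **Existence of a solution to the obstacle problem by Perron's method**
(Proposition 2.1): the class `𝒟_{μ₀,φ}` is nonempty, its pointwise infimum `v` belongs to
`𝒟_{μ₀,φ}`, and `v` satisfies `ℳv = v^q μ₀` on `{v > 0}`. -/
theorem obstacle_problem_existence
    (n : ℕ) (hn : 2 ≤ n) (q : ℝ) (hq0 : 0 ≤ q) (hqn : q < n)
    (Ω : Set (EuclideanSpace ℝ (Fin n)))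
    (hΩo : IsOpen Ω) (hΩc : Convex ℝ Ω) (hΩb : Bornology.IsBounded Ω)
    (hΩne : Ω.Nonempty)
    (μ₀ : Measure (EuclideanSpace ℝ (Fin n))) (hμfin : IsFiniteMeasure μ₀)
    (hμΩ : μ₀ Ωᶜ = 0)
    (φ : EuclideanSpace ℝ (Fin n) → ℝ)
    (hφc : ContinuousOn φ (closure Ω)) (hφconv : ConvexOn ℝ (closure Ω) φ)
    (hφ0 : ∀ x ∈ frontier Ω, 0 ≤ φ x) :
    (obstacleClass n q Ω μ₀ φ).Nonempty ∧
    obstacleInf n q Ω μ₀ φ ∈ obstacleClass n q Ω μ₀ φ ∧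
    ∀ E : Set (EuclideanSpace ℝ (Fin n)), MeasurableSet E →
      E ⊆ {x ∈ Ω | 0 < obstacleInf n q Ω μ₀ φ x} →
      volume (subgradImg Ω (obstacleInf n q Ω μ₀ φ) E)
        = ∫⁻ x in E, ENNReal.ofReal (obstacleInf n q Ω μ₀ φ x ^ q) ∂μ₀ := by
  have hn0 : n ≠ 0 := by omega
  obtain ⟨M, hφM⟩ := hΩb.isCompact_closure.exists_bound_of_continuousOn hφc
  have hM : ∀ w, IsAdmissible Ω φ w → ∀ x ∈ closure Ω, w x ≤ M := fun w hw =>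
    le_of_convexOn_of_le_frontier hn0 hΩo hΩc hΩb hw.convexOn fun x hx =>
      (hw.eq_of_mem_frontier x hx).trans_le
        ((le_abs_self _).trans (hφM x (frontier_subset_closure hx)))
  obtain ⟨v, hv, hvle, hvge⟩ :=
    exists_solution hn0 hq0 hΩo hΩc hΩb hΩne hμΩ hφc hφconv hφ0 hM
  have hvmem : v ∈ obstacleClass n q Ω μ₀ φ := mem_obstacleClass_iff.2 ⟨hv, hvle⟩
  have hcl : EqOn (obstacleInf n q Ω μ₀ φ) v (closure Ω) :=
    obstacleInf_eqOn hvmem fun w hw =>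
      le_of_lintegral_le_volume_subgradImg hn0 hq0 hΩo hΩc hΩb hM hv
        (mem_obstacleClass_iff.1 hw).1 hvge (mem_obstacleClass_iff.1 hw).2
  have hΩv : EqOn (obstacleInf n q Ω μ₀ φ) v Ω := hcl.mono subset_closure
  refine ⟨⟨v, hvmem⟩, mem_obstacleClass_of_eqOn hvmem hcl, fun E hE hEpos => ?_⟩
  have hEΩ : E ⊆ Ω := fun x hx => (hEpos hx).1
  rw [subgradImg_congr hΩv hEΩ, setLIntegral_rpow_congr hΩv hE hEΩ]
  exact (hvle E hE hEΩ).antisymm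
    (hvge E hE fun x hx => ⟨hEΩ hx, (hEpos hx).2.trans_eq (hΩv (hEΩ hx))⟩)
end
end

section
/- Let n ≥ 1, let w : ℝⁿ → ℝ be a convex function and let x₀ ∈ ℝⁿ. Assume the graph of w contains no entire line through x₀, i.e. for every nonzero e ∈ ℝⁿ, the function t ↦ w(x₀ + t e) is not affine on all of ℝ. Then for every h > 0 there exists p_h ∈ ℝⁿ such that the section S̃ := { x ∈ ℝⁿ : w(x) < w(x₀) + p_h·(x − x₀) + h } is a bounded (open convex, nonempty) set whose center of mass is x₀, i.e. ∫_{S̃} x dx = |S̃| · x₀, where |S̃| > 0 is the Lebesgue measure of S̃. -/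
open MeasureTheory Set Metric
open scoped RealInnerProductSpace

noncomputable section

section CenteredSections

open Filter Topology

lemma ConcaveOn.exists_ray_of_not_isBounded {E : Type*} [NormedAddCommGroup E] [NormedSpace ℝ E]
    [FiniteDimensional ℝ E] {g : E → ℝ} (hg : ConcaveOn ℝ univ g)
    (hb : ¬ Bornology.IsBounded {x | 0 < g x}) :
    ∃ e : E, e ≠ 0 ∧ ∀ t : ℝ, 0 ≤ t → g 0 ≤ g (t • e) := by
  have hcont : Continuous g := hg.locallyLipschitz.continuous
  have hex : ∀ k : ℕ, ∃ x : E, 0 < g x ∧ (k : ℝ) + 1 < ‖x‖ := by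
    intro k
    by_contra! hk
    exact hb (isBounded_iff_forall_norm_le.2 ⟨k + 1, fun x hx => hk x hx⟩)
  choose x hxg hxn using hex
  have hpos : ∀ k, 0 < ‖x k‖ := fun k => lt_trans (by positivity) (hxn k)
  have hsph : ∀ k, ‖x k‖⁻¹ • x k ∈ sphere (0 : E) 1 := by
    intro k
    simp [norm_smul, (hpos k).ne']
  obtain ⟨e, he, φ, hφ, hlim⟩ := (isCompact_sphere (0 : E) 1).tendsto_subseq hsph
  refine ⟨e, ne_zero_of_mem_unit_sphere ⟨e, he⟩, fun t ht => ?_⟩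
  have hnorm : Tendsto (fun k => ‖x (φ k)‖) atTop atTop := by
    refine tendsto_atTop_mono (fun k => ?_) tendsto_natCast_atTop_atTop
    have h1 := hxn (φ k)
    have h2 : (k : ℝ) ≤ φ k := by exact_mod_cast hφ.id_le k
    linarith
  have hl : Tendsto (fun k => g (t • (‖x (φ k)‖⁻¹ • x (φ k)))) atTop (𝓝 (g (t • e))) :=
    (hcont.tendsto _).comp (hlim.const_smul t)
  have hr : Tendsto (fun k => (1 - t * ‖x (φ k)‖⁻¹) * g 0) atTop (𝓝 (g 0)) := by
    have := ((tendsto_inv_atTop_zero.comp hnorm).const_mul t).const_sub 1 |>.mul_const (g 0)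
    simpa using this
  refine le_of_tendsto_of_tendsto hr hl ?_
  filter_upwards [hnorm.eventually_ge_atTop t] with k hk
  have hp := hpos (φ k)
  have hle : t * ‖x (φ k)‖⁻¹ ≤ 1 := by
    rw [← div_eq_mul_inv, div_le_one hp]; exact hk
  have h1 := hg.2 (mem_univ (0 : E)) (mem_univ (x (φ k))) (sub_nonneg.2 hle)
    (by positivity : 0 ≤ t * ‖x (φ k)‖⁻¹) (by ring)
  simp only [smul_zero, zero_add, smul_eq_mul] at h1
  rw [smul_smul]
  have : 0 ≤ t * ‖x (φ k)‖⁻¹ * g (x (φ k)) := by have := hxg (φ k); positivity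
  linarith

lemma ConcaveOn.lintegral_eq_top_of_ray {E : Type*} [NormedAddCommGroup E] [NormedSpace ℝ E]
    [FiniteDimensional ℝ E] [MeasurableSpace E] [BorelSpace E] (μ : Measure E)
    [μ.IsAddHaarMeasure] {g : E → ℝ} (hg : ConcaveOn ℝ univ g) (h0 : 0 < g 0)
    {e : E} (he : e ≠ 0) (hray : ∀ t : ℝ, 0 ≤ t → g 0 ≤ g (t • e)) :
    ∫⁻ x, ENNReal.ofReal (g x) ∂μ = ⊤ := by
  have hcont : Continuous g := hg.locallyLipschitz.continuous
  obtain ⟨r, hr, hball⟩ : ∃ r > 0, ∀ y ∈ ball (0 : E) r, g 0 / 2 < g y :=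
    Metric.eventually_nhds_iff_ball.1
      (hcont.continuousAt.eventually (lt_mem_nhds (half_lt_self h0)))
  have hen : 0 < ‖e‖ := norm_pos_iff.2 he
  let c : ℕ → E := fun k => ((k : ℝ) * (r / ‖e‖)) • e
  have hsub : (⋃ k, ball (c k) (r / 2)) ⊆ {x | g 0 / 2 ≤ g x} := by
    refine iUnion_subset fun k y hy => ?_
    have h1 : g 0 / 2 < g ((2 : ℝ) • (y - c k)) := by
      apply hball
      rw [mem_ball_zero_iff, norm_smul, ← dist_eq_norm]
      have := mem_ball.1 hy
      simp only [Real.norm_ofNat]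
      linarith
    have h2 : g 0 ≤ g ((2 : ℝ) • c k) := by
      simp only [c, smul_smul]
      exact hray _ (by positivity)
    have h3 := hg.2 (mem_univ ((2 : ℝ) • (y - c k))) (mem_univ ((2 : ℝ) • c k))
      (by norm_num : (0 : ℝ) ≤ 1 / 2) (by norm_num : (0 : ℝ) ≤ 1 / 2) (by norm_num)
    have h4 : (1 / 2 : ℝ) • ((2 : ℝ) • (y - c k)) + (1 / 2 : ℝ) • ((2 : ℝ) • c k) = y := by
      module
    rw [h4, smul_eq_mul, smul_eq_mul] at h3
    simp only [mem_ofPred_eq]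
    linarith
  have hdisj : Pairwise (Function.onFun Disjoint fun k => ball (c k) (r / 2)) := by
    intro i j hij
    apply ball_disjoint_ball
    have h1 : dist (c i) (c j) = |(i : ℝ) - j| * r := by
      rw [dist_eq_norm, ← sub_smul, ← sub_mul, norm_smul, norm_mul, Real.norm_eq_abs,
        Real.norm_of_nonneg (by positivity)]
      field_simp
    have h2 : (1 : ℝ) ≤ |(i : ℝ) - j| := by
      have : (1 : ℤ) ≤ |(i : ℤ) - j| := Int.one_le_abs (sub_ne_zero.2 (by exact_mod_cast hij))
      exact_mod_cast this
    rw [h1]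
    nlinarith
  have hvol : μ (⋃ k, ball (c k) (r / 2)) = ⊤ := by
    rw [measure_iUnion hdisj fun k => measurableSet_ball]
    simp_rw [Measure.addHaar_ball_center μ]
    exact ENNReal.tsum_const_eq_top_of_ne_zero (measure_ball_pos μ 0 (half_pos hr)).ne'
  have hmarkov := mul_meas_ge_le_lintegral₀ (μ := μ)
    (f := fun x => ENNReal.ofReal (g x)) (by fun_prop) (ENNReal.ofReal (g 0 / 2))
  have hset : μ {x | ENNReal.ofReal (g 0 / 2) ≤ ENNReal.ofReal (g x)} = ⊤ := by
    refine measure_mono_top (subset_trans hsub fun x hx => ENNReal.ofReal_le_ofReal hx) hvol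
  rw [hset, ENNReal.mul_top (by simpa using h0)] at hmarkov
  exact top_le_iff.1 hmarkov

lemma Continuous.integrable_posPart_of_isBounded {E : Type*} [NormedAddCommGroup E]
    [ProperSpace E] [MeasurableSpace E] [BorelSpace E] (μ : Measure E)
    [IsFiniteMeasureOnCompacts μ] {g : E → ℝ} (hg : Continuous g)
    (hb : Bornology.IsBounded {x | 0 < g x}) :
    Integrable (fun x => max (g x) 0) μ := by
  have hc : HasCompactSupport fun x => max (g x) 0 := by
    refine hb.isCompact_closure.of_isClosed_subset isClosed_closure (closure_mono ?_)
    intro x hx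
    by_contra h
    exact hx (max_eq_right (not_lt.1 h))
  exact (hg.max continuous_const).integrable_of_hasCompactSupport hc

/-- The slopes of the affine minorants of a convex function. -/
def minorantSlopes {E : Type*} [NormedAddCommGroup E] [InnerProductSpace ℝ E] (u : E → ℝ) :
    Set E :=
  {p | ∃ C : ℝ, ∀ x, ⟪p, x⟫ - C ≤ u x}

lemma convex_minorantSlopes {E : Type*} [NormedAddCommGroup E] [InnerProductSpace ℝ E]
    (u : E → ℝ) : Convex ℝ (minorantSlopes u) := by
  rintro p ⟨C, hC⟩ q ⟨D, hD⟩ a b ha hb hab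
  refine ⟨a * C + b * D, fun x => ?_⟩
  have h1 := mul_le_mul_of_nonneg_left (hC x) ha
  have h2 := mul_le_mul_of_nonneg_left (hD x) hb
  have h3 : u x = a * u x + b * u x := by rw [← add_mul, hab, one_mul]
  rw [inner_add_left, real_inner_smul_left, real_inner_smul_left, h3]
  linarith

lemma ConvexOn.exists_mem_minorantSlopes {E : Type*} [NormedAddCommGroup E]
    [InnerProductSpace ℝ E] [FiniteDimensional ℝ E] {u : E → ℝ} (hu : ConvexOn ℝ univ u)
    {x : E} {a : ℝ} (ha : a < u x) :
    ∃ p ∈ minorantSlopes u, ∀ y, a + ⟪p, y - x⟫ ≤ u y := by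
  have hcont : Continuous u := hu.locallyLipschitz.continuous
  obtain ⟨l, c, hle, heq⟩ := hu.exists_affine_le_of_lt (𝕜 := ℝ) (mem_univ x) ha isClosed_univ
    (hcont.lowerSemicontinuous.lowerSemicontinuousOn _)
  let p := (InnerProductSpace.toDual ℝ E).symm l
  have hp : ∀ y, ⟪p, y⟫ = l y := fun y => InnerProductSpace.toDual_symm_apply
  have hle' : ∀ y, l y + c ≤ u y := fun y => by simpa using hle ⟨y, mem_univ y⟩
  have heq' : l x + c = a := by simpa using heq
  refine ⟨p, ⟨-c, fun y => ?_⟩, fun y => ?_⟩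
  · rw [hp]; linarith [hle' y]
  · rw [inner_sub_right, hp, hp]; linarith [hle' y]

lemma ConvexOn.interior_minorantSlopes_nonempty {E : Type*} [NormedAddCommGroup E]
    [InnerProductSpace ℝ E] [FiniteDimensional ℝ E] {u : E → ℝ} (hu : ConvexOn ℝ univ u)
    (hline : ∀ e : E, e ≠ 0 → ¬ ∃ a b : ℝ, ∀ t : ℝ, u (t • e) = a * t + b) :
    (interior (minorantSlopes u)).Nonempty := by
  rw [(convex_minorantSlopes u).interior_nonempty_iff_affineSpan_eq_top]
  obtain ⟨p₀, hp₀, -⟩ := hu.exists_mem_minorantSlopes (sub_one_lt (u 0))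
  by_contra hspan
  have hdir : vectorSpan ℝ (minorantSlopes u) ≠ ⊤ := by
    rwa [Ne, ← AffineSubspace.affineSpan_eq_top_iff_vectorSpan_eq_top_of_nonempty ℝ E E ⟨p₀, hp₀⟩]
  obtain ⟨e, heS, he⟩ := Submodule.exists_mem_ne_zero_of_ne_bot
    (mt Submodule.orthogonal_eq_bot_iff.1 hdir)
  have hconst : ∀ p ∈ minorantSlopes u, ⟪p, e⟫ = ⟪p₀, e⟫ := by
    intro p hp
    have := heS (p - p₀) (vsub_mem_vectorSpan ℝ hp hp₀)
    rwa [inner_sub_left, sub_eq_zero] at this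
  have hkey : ∀ s t : ℝ, u (t • e) + ⟪p₀, e⟫ * (s - t) ≤ u (s • e) := by
    intro s t
    refine le_of_forall_lt fun b hb => ?_
    obtain ⟨a, hba, ha⟩ := exists_between (sub_lt_iff_lt_add.2 hb)
    obtain ⟨p, hp, hpy⟩ := hu.exists_mem_minorantSlopes ha
    have := hpy (s • e)
    rw [← sub_smul, real_inner_smul_right, hconst p hp] at this
    linarith
  refine hline e he ⟨⟪p₀, e⟫, u 0, fun t => ?_⟩
  have h1 := hkey t 0
  have h2 := hkey 0 t
  simp only [zero_smul] at h1 h2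
  linarith

lemma ConvexOn.concaveOn_inner_sub {E : Type*} [NormedAddCommGroup E] [InnerProductSpace ℝ E]
    {u : E → ℝ} (hu : ConvexOn ℝ univ u) (p : E) :
    ConcaveOn ℝ univ fun x => ⟪p, x⟫ - u x :=
  ((innerₛₗ ℝ p).concaveOn convex_univ).sub hu

lemma ConvexOn.section_subset_closedBall {E : Type*} [NormedAddCommGroup E]
    [InnerProductSpace ℝ E] {u : E → ℝ} (hu : ConvexOn ℝ univ u) {p q : E}
    {R : ℝ} (hR : 0 < R) (hb : {x | u x < ⟪p, x⟫} ⊆ ball 0 R)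
    (hq : 2 * R * ‖q - p‖ ≤ -u 0) :
    {x | u x < ⟪q, x⟫} ⊆ closedBall 0 (2 * R) := by
  intro x hx
  by_contra hxR
  rw [mem_closedBall_zero_iff, not_le] at hxR
  have hxn : 0 < ‖x‖ := by linarith
  let σ := R / ‖x‖
  have hσ0 : 0 < σ := by positivity
  have hσx : σ * ‖x‖ = R := div_mul_cancel₀ _ hxn.ne'
  have hσ : σ < 1 / 2 := by rw [div_lt_iff₀ hxn]; linarith
  have h1 : ⟪p, σ • x⟫ - u (σ • x) ≤ 0 := by
    by_contra! hpos
    have : σ • x ∈ ball (0 : E) R := hb (sub_pos.1 hpos)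
    rw [mem_ball_zero_iff, norm_smul, Real.norm_of_nonneg hσ0.le, hσx] at this
    exact lt_irrefl _ this
  have h2 := (hu.concaveOn_inner_sub p).2 (mem_univ (0 : E)) (mem_univ x)
    (by linarith : 0 ≤ 1 - σ) hσ0.le (by ring)
  simp only [smul_zero, zero_add, inner_zero_right, smul_eq_mul, zero_sub] at h2
  have h3 : ⟪q - p, x⟫ ≤ ‖q - p‖ * ‖x‖ := real_inner_le_norm _ _
  rw [inner_sub_left] at h3
  have h4 : u x < ⟪q, x⟫ := hx
  have h5 : 0 < σ * (⟪p, x⟫ - u x + ‖q - p‖ * ‖x‖) := mul_pos hσ0 (by linarith)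
  have h6 : σ * (‖q - p‖ * ‖x‖) = R * ‖q - p‖ := by rw [← hσx]; ring
  have h7 : 0 ≤ ‖q - p‖ * R := by positivity
  nlinarith

section PositivePartIntegral

variable {E : Type*} [NormedAddCommGroup E] [InnerProductSpace ℝ E] [FiniteDimensional ℝ E]
  [MeasurableSpace E] [BorelSpace E] (μ : Measure E) {u : E → ℝ}

/-- The integral of the positive part of `x ↦ ⟪p, x⟫ - u x`, as a function of the slope `p`. -/
def slopeEnergy (u : E → ℝ) (p : E) : ENNReal := ∫⁻ x, ENNReal.ofReal (⟪p, x⟫ - u x) ∂μ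

lemma lowerSemicontinuous_slopeEnergy (hu : Continuous u) :
    LowerSemicontinuous (slopeEnergy μ u) := by
  refine lowerSemicontinuous_iff_le_liminf.2 fun p => ?_
  refine le_trans (lintegral_mono fun x => ?_)
    (lintegral_liminf_le fun q => (by fun_prop : Measurable fun x =>
      ENNReal.ofReal (⟪q, x⟫ - u x)))
  have : Continuous fun q : E => ENNReal.ofReal (⟪q, x⟫ - u x) :=
    ENNReal.continuous_ofReal.comp (by fun_prop)
  exact (this.tendsto p).liminf_eq.ge

variable [μ.IsAddHaarMeasure]

lemma slopeEnergy_lt_top_iff (hu : ConvexOn ℝ univ u) (h0 : u 0 < 0) (p : E) :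
    slopeEnergy μ u p < ⊤ ↔ Bornology.IsBounded {x | u x < ⟪p, x⟫} := by
  have hcont : Continuous u := hu.locallyLipschitz.continuous
  have hset : {x | u x < ⟪p, x⟫} = {x | 0 < ⟪p, x⟫ - u x} := by simp [sub_pos]
  rw [hset]
  constructor
  · intro h
    by_contra hb
    obtain ⟨e, he, hray⟩ := (hu.concaveOn_inner_sub p).exists_ray_of_not_isBounded hb
    exact h.ne ((hu.concaveOn_inner_sub p).lintegral_eq_top_of_ray μ (by simpa using h0) he hray)
  · intro hb
    have := (Continuous.integrable_posPart_of_isBounded μ (by fun_prop) hb).lintegral_lt_top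
    simpa [ENNReal.ofReal_max, slopeEnergy] using this

lemma exists_slopeEnergy_ge (hu : Continuous u) (h0 : u 0 < 0) :
    ∃ c : ℝ, 0 < c ∧ ∀ p, ENNReal.ofReal (c * ‖p‖) ≤ slopeEnergy μ u p := by
  obtain ⟨r, hr, hball⟩ : ∃ r > 0, ∀ y ∈ ball (0 : E) r, u y < 0 :=
    Metric.eventually_nhds_iff_ball.1 (hu.continuousAt.eventually (gt_mem_nhds h0))
  have hm : 0 < μ.real (ball (0 : E) (r / 4)) :=
    ENNReal.toReal_pos (measure_ball_pos μ 0 (by positivity)).ne' measure_ball_lt_top.ne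
  refine ⟨r / 4 * μ.real (ball (0 : E) (r / 4)), by positivity, fun p => ?_⟩
  obtain rfl | hp := eq_or_ne p 0
  · simp
  have hpn : 0 < ‖p‖ := norm_pos_iff.2 hp
  let z : E := (r / 2 / ‖p‖) • p
  have hz : ‖z‖ = r / 2 := by
    rw [norm_smul, Real.norm_of_nonneg (by positivity)]
    field_simp
  have hpz : ⟪p, z⟫ = ‖p‖ * (r / 2) := by
    rw [real_inner_smul_right, real_inner_self_eq_norm_sq]
    field_simp
  calc ENNReal.ofReal (r / 4 * μ.real (ball (0 : E) (r / 4)) * ‖p‖)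
      = ENNReal.ofReal (r / 4 * ‖p‖) * μ (ball z (r / 4)) := by
        rw [Measure.addHaar_ball_center, mul_right_comm, ENNReal.ofReal_mul (by positivity),
          ofReal_measureReal]
    _ = ∫⁻ _ in ball z (r / 4), ENNReal.ofReal (r / 4 * ‖p‖) ∂μ := by
        rw [setLIntegral_const]
    _ ≤ ∫⁻ x in ball z (r / 4), ENNReal.ofReal (⟪p, x⟫ - u x) ∂μ := by
        refine setLIntegral_mono' measurableSet_ball fun x hx => ENNReal.ofReal_le_ofReal ?_
        have hxz : ‖x - z‖ < r / 4 := by rwa [← dist_eq_norm]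
        have h1 : u x < 0 := by
          apply hball
          rw [mem_ball_zero_iff]
          have := norm_le_norm_sub_add x z
          linarith
        have h2 : -(‖p‖ * ‖x - z‖) ≤ ⟪p, x - z⟫ :=
          (abs_le.1 (abs_real_inner_le_norm p (x - z))).1
        rw [inner_sub_right, hpz] at h2
        nlinarith
    _ ≤ slopeEnergy μ u p := setLIntegral_le_lintegral _ _

lemma exists_slopeEnergy_le (hu : Continuous u) (h0 : u 0 < 0) {p₀ : E}
    (hp₀ : slopeEnergy μ u p₀ < ⊤) :
    ∃ p, ∀ q, slopeEnergy μ u p ≤ slopeEnergy μ u q := by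
  obtain ⟨c, hc, hge⟩ := exists_slopeEnergy_ge μ hu h0
  let R := (slopeEnergy μ u p₀).toReal / c
  obtain ⟨p, -, hmin⟩ := ((lowerSemicontinuous_slopeEnergy μ hu).lowerSemicontinuousOn
    _).exists_isMinOn ⟨p₀, mem_closedBall_zero_iff.2 (le_max_right R ‖p₀‖)⟩
    (isCompact_closedBall (0 : E) (max R ‖p₀‖))
  refine ⟨p, fun q => ?_⟩
  by_cases hq : q ∈ closedBall (0 : E) (max R ‖p₀‖)
  · exact hmin hq
  · refine le_trans (hmin (mem_closedBall_zero_iff.2 (le_max_right R ‖p₀‖))) (le_trans ?_ (hge q))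
    rw [mem_closedBall_zero_iff, not_le] at hq
    have h1 : R < ‖q‖ := (le_max_left _ _).trans_lt hq
    rw [div_lt_iff₀' hc] at h1
    exact (ENNReal.le_ofReal_iff_toReal_le hp₀.ne (by positivity)).2 h1.le

lemma ConvexOn.measure_eq_inner_eq_zero (hu : ConvexOn ℝ univ u) (h0 : u 0 < 0) (p : E) :
    μ {x | u x = ⟪p, x⟫} = 0 := by
  have hg := hu.concaveOn_inner_sub p
  have hconv : Convex ℝ {x | u x < ⟪p, x⟫} := by
    simpa [sub_pos] using hg.convex_gt 0
  refine measure_mono_null (fun x hx => ?_) (hconv.addHaar_frontier μ)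
  have hx : u x = ⟪p, x⟫ := hx
  have hnot : x ∉ {x | u x < ⟪p, x⟫} := fun hlt => (mem_ofPred.1 hlt).ne hx
  refine ⟨?_, fun hi => hnot (interior_subset hi)⟩
  have hlim : Tendsto (fun t : ℝ => (1 - t) • x) (𝓝[>] 0) (𝓝 x) := by
    have : Continuous fun t : ℝ => (1 - t) • x := by fun_prop
    simpa using (this.tendsto 0).mono_left nhdsWithin_le_nhds
  refine mem_closure_of_tendsto hlim ?_
  filter_upwards [Ioo_mem_nhdsGT (zero_lt_one' ℝ)] with t ht
  have h1 := hg.2 (mem_univ (0 : E)) (mem_univ x) ht.1.le (sub_nonneg.2 ht.2.le) (by ring)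
  simp only [smul_zero, zero_add, inner_zero_right, smul_eq_mul, zero_sub, hx, sub_self,
    mul_zero, add_zero] at h1
  have h2 : 0 < t * -u 0 := mul_pos ht.1 (neg_pos.2 h0)
  exact sub_pos.1 (h2.trans_le h1)

lemma integral_section_inner_nonneg (hu : ConvexOn ℝ univ u) {p q : E}
    (hp : Bornology.IsBounded {x | u x < ⟪p, x⟫})
    (hpq : Bornology.IsBounded {x | u x < ⟪p + q, x⟫})
    (hle : slopeEnergy μ u p ≤ slopeEnergy μ u (p + q)) :
    0 ≤ ∫ x, {x | u x < ⟪p + q, x⟫}.indicator (fun x => ⟪q, x⟫) x ∂μ := by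
  have hcont : Continuous u := hu.locallyLipschitz.continuous
  have hopen : IsOpen {x | u x < ⟪p + q, x⟫} := isOpen_lt hcont (by fun_prop)
  have hint : ∀ p : E, Bornology.IsBounded {x | u x < ⟪p, x⟫} →
      Integrable (fun x => max (⟪p, x⟫ - u x) 0) μ := fun p hb =>
    Continuous.integrable_posPart_of_isBounded μ (by fun_prop) (by simpa [sub_pos] using hb)
  have henergy : ∀ p : E, Bornology.IsBounded {x | u x < ⟪p, x⟫} →
      slopeEnergy μ u p = ENNReal.ofReal (∫ x, max (⟪p, x⟫ - u x) 0 ∂μ) := fun p hb => by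
    rw [ofReal_integral_eq_lintegral_ofReal (hint p hb) (ae_of_all _ fun x => le_max_right _ _)]
    simp [ENNReal.ofReal_max, slopeEnergy]
  have hind : Integrable ({x | u x < ⟪p + q, x⟫}.indicator fun x => ⟪q, x⟫) μ := by
    rw [integrable_indicator_iff hopen.measurableSet]
    have : Continuous fun x => ⟪q, x⟫ := by fun_prop
    exact (this.continuousOn.integrableOn_compact hpq.isCompact_closure).mono_set subset_closure
  rw [henergy p hp, henergy _ hpq, ENNReal.ofReal_le_ofReal_iff
    (integral_nonneg fun x => le_max_right (⟪p + q, x⟫ - u x) 0)] at hle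
  have hmono : ∫ x, max (⟪p + q, x⟫ - u x) 0 ∂μ ≤ ∫ x, (max (⟪p, x⟫ - u x) 0 +
      {x | u x < ⟪p + q, x⟫}.indicator (fun x => ⟪q, x⟫) x) ∂μ := by
    refine integral_mono (hint _ hpq) ((hint p hp).add hind) fun x => ?_
    by_cases hx : u x < ⟪p + q, x⟫
    · simp only [indicator_of_mem (show x ∈ {x | u x < ⟪p + q, x⟫} from hx)]
      rw [max_eq_left (sub_nonneg.2 hx.le), inner_add_left]
      linarith [le_max_left (⟪p, x⟫ - u x) 0]
    · simp only [indicator_of_notMem (show x ∉ {x | u x < ⟪p + q, x⟫} from hx)]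
      rw [max_eq_right (sub_nonpos.2 (not_lt.1 hx)), add_zero]
      exact le_max_right _ _
  rw [integral_add (hint p hp) hind] at hmono
  linarith

lemma integral_section_eq_zero_of_slopeEnergy_le (hu : ConvexOn ℝ univ u) (h0 : u 0 < 0) {p : E}
    (hb : Bornology.IsBounded {x | u x < ⟪p, x⟫})
    (hmin : ∀ q, slopeEnergy μ u p ≤ slopeEnergy μ u q) :
    ∫ x in {x | u x < ⟪p, x⟫}, x ∂μ = 0 := by
  have hcont : Continuous u := hu.locallyLipschitz.continuous
  have hopen : ∀ q : E, IsOpen {x | u x < ⟪q, x⟫} := fun q => isOpen_lt hcont (by fun_prop)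
  obtain ⟨R, hR, hbR⟩ := hb.subset_ball_lt 0 0
  have hnonneg : ∀ q : E, 0 ≤ ∫ x, {x | u x < ⟪p, x⟫}.indicator (fun x => ⟪q, x⟫) x ∂μ := by
    intro q
    have hsmall : ∀ᶠ t : ℝ in 𝓝[>] 0,
        {x | u x < ⟪p + t • q, x⟫} ⊆ closedBall (0 : E) (2 * R) := by
      have hc : Continuous fun t : ℝ => 2 * R * ‖p + t • q - p‖ := by fun_prop
      have hev : ∀ᶠ t : ℝ in 𝓝 0, 2 * R * ‖p + t • q - p‖ < -u 0 :=
        hc.continuousAt.eventually (gt_mem_nhds (by simpa using h0))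
      filter_upwards [hev.filter_mono nhdsWithin_le_nhds] with t ht
      exact hu.section_subset_closedBall hR hbR ht.le
    have hlim : Tendsto
        (fun t : ℝ => ∫ x, {x | u x < ⟪p + t • q, x⟫}.indicator (fun x => ⟪q, x⟫) x ∂μ)
        (𝓝[>] 0) (𝓝 (∫ x, {x | u x < ⟪p, x⟫}.indicator (fun x => ⟪q, x⟫) x ∂μ)) := by
      refine tendsto_integral_filter_of_dominated_convergence
        ((closedBall (0 : E) (2 * R)).indicator fun x => ‖⟪q, x⟫‖) ?_ ?_ ?_ ?_
      · refine .of_forall fun t => (Measurable.indicator (by fun_prop)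
          (hopen _).measurableSet).aestronglyMeasurable
      · filter_upwards [hsmall] with t ht
        refine ae_of_all _ fun x => ?_
        rw [norm_indicator_eq_indicator_norm]
        exact indicator_le_indicator_of_subset ht (fun _ => norm_nonneg _) x
      · rw [integrable_indicator_iff measurableSet_closedBall]
        have : Continuous fun x => ‖⟪q, x⟫‖ := by fun_prop
        exact this.continuousOn.integrableOn_compact (isCompact_closedBall _ _)
      · have hae : ∀ᵐ x ∂μ, u x ≠ ⟪p, x⟫ := by
          simpa [ae_iff] using hu.measure_eq_inner_eq_zero μ h0 p
        filter_upwards [hae] with x hx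
        have hc : Continuous fun t : ℝ => ⟪p + t • q, x⟫ := by fun_prop
        have hc0 : Tendsto (fun t : ℝ => ⟪p + t • q, x⟫) (𝓝[>] 0) (𝓝 ⟪p, x⟫) := by
          simpa using (hc.tendsto 0).mono_left nhdsWithin_le_nhds
        refine tendsto_const_nhds.congr' ?_
        rcases lt_or_gt_of_ne hx with hlt | hgt
        · filter_upwards [hc0.eventually (lt_mem_nhds hlt)] with t ht
          simp [indicator, hlt, ht]
        · filter_upwards [hc0.eventually (gt_mem_nhds hgt)] with t ht
          simp [indicator, hgt.not_gt, ht.not_gt]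
    refine ge_of_tendsto hlim ?_
    filter_upwards [hsmall, self_mem_nhdsWithin] with t ht htpos
    have h1 := integral_section_inner_nonneg μ hu hb (isBounded_closedBall.subset ht) (hmin _)
    have h2 : ∫ x, {x | u x < ⟪p + t • q, x⟫}.indicator (fun x => ⟪t • q, x⟫) x ∂μ =
        t * ∫ x, {x | u x < ⟪p + t • q, x⟫}.indicator (fun x => ⟪q, x⟫) x ∂μ := by
      rw [← integral_const_mul]
      congr with x
      simp [indicator, real_inner_smul_left]
    rw [h2] at h1
    exact nonneg_of_mul_nonneg_right h1 htpos
  have hint : IntegrableOn (fun x : E => x) {x | u x < ⟪p, x⟫} μ :=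
    (continuous_id.continuousOn.integrableOn_compact hb.isCompact_closure).mono_set subset_closure
  have h := hnonneg (-∫ x in {x | u x < ⟪p, x⟫}, x ∂μ)
  rw [integral_indicator (hopen p).measurableSet, integral_inner hint, inner_neg_left,
    real_inner_self_eq_norm_sq] at h
  have : ‖∫ x in {x | u x < ⟪p, x⟫}, x ∂μ‖ ^ 2 = 0 := le_antisymm (by linarith) (sq_nonneg _)
  exact norm_eq_zero.1 (pow_eq_zero_iff two_ne_zero |>.1 this)

end PositivePartIntegral

lemma ConvexOn.exists_isBounded_section {E : Type*} [NormedAddCommGroup E]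
    [InnerProductSpace ℝ E] [FiniteDimensional ℝ E] {u : E → ℝ} (hu : ConvexOn ℝ univ u)
    (hline : ∀ e : E, e ≠ 0 → ¬ ∃ a b : ℝ, ∀ t : ℝ, u (t • e) = a * t + b) :
    ∃ p : E, Bornology.IsBounded {x | u x < ⟪p, x⟫} := by
  obtain ⟨p, hp⟩ := hu.interior_minorantSlopes_nonempty hline
  obtain ⟨ε, hε, hball⟩ := Metric.isOpen_iff.1 isOpen_interior p hp
  refine ⟨p, ?_⟩
  by_contra hb
  obtain ⟨e, he, hray⟩ := (hu.concaveOn_inner_sub p).exists_ray_of_not_isBounded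
    (by simpa [sub_pos] using hb)
  have hen : 0 < ‖e‖ := norm_pos_iff.2 he
  have hmem : p + (ε / 2 / ‖e‖) • e ∈ ball p ε := by
    rw [mem_ball, dist_self_add_left, norm_smul, Real.norm_of_nonneg (by positivity),
      div_mul_cancel₀ _ hen.ne']
    linarith
  obtain ⟨C, hC⟩ := interior_subset (hball hmem)
  have hbound : ∀ t : ℝ, 0 ≤ t → t * (ε / 2 * ‖e‖) ≤ C + u 0 := by
    intro t ht
    have h1 := hray t ht
    have h2 := hC (t • e)
    rw [inner_add_left, real_inner_smul_left, real_inner_smul_right e e,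
      real_inner_self_eq_norm_sq] at h2
    have h3 : ε / 2 / ‖e‖ * (t * ‖e‖ ^ 2) = t * (ε / 2 * ‖e‖) := by field_simp
    simp only [inner_zero_right, zero_sub] at h1
    linarith
  have hk : 0 < ε / 2 * ‖e‖ := by positivity
  have h4 := hbound ((|C + u 0| + 1) / (ε / 2 * ‖e‖)) (by positivity)
  rw [div_mul_cancel₀ _ hk.ne'] at h4
  linarith [le_abs_self (C + u 0)]

lemma ConvexOn.exists_isBounded_section_integral_eq_zero {E : Type*} [NormedAddCommGroup E]
    [InnerProductSpace ℝ E] [FiniteDimensional ℝ E] [MeasurableSpace E] [BorelSpace E]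
    (μ : Measure E) [μ.IsAddHaarMeasure] {u : E → ℝ} (hu : ConvexOn ℝ univ u) (h0 : u 0 < 0)
    (hline : ∀ e : E, e ≠ 0 → ¬ ∃ a b : ℝ, ∀ t : ℝ, u (t • e) = a * t + b) :
    ∃ p : E, Bornology.IsBounded {x | u x < ⟪p, x⟫} ∧ ∫ x in {x | u x < ⟪p, x⟫}, x ∂μ = 0 := by
  obtain ⟨p₀, hp₀⟩ := hu.exists_isBounded_section hline
  rw [← slopeEnergy_lt_top_iff μ hu h0] at hp₀
  obtain ⟨p, hmin⟩ := exists_slopeEnergy_le μ hu.locallyLipschitz.continuous h0 hp₀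
  have hb := (slopeEnergy_lt_top_iff μ hu h0 p).1 ((hmin p₀).trans_lt hp₀)
  exact ⟨p, hb, integral_section_eq_zero_of_slopeEnergy_le μ hu h0 hb hmin⟩

end CenteredSections

/-- **Existence of centered sections** (Caffarelli; Savin, Lemma 2.6): if the graph of a
globally defined convex function `w : ℝⁿ → ℝ` contains no entire line through `x₀`, then
for every `h > 0` there is a slope `p_h` such that the section
`S̃ = {w < w(x₀) + p_h·(x − x₀) + h}` is a bounded nonempty open convex set of positive
Lebesgue measure whose center of mass is `x₀`. -/
theorem exists_centered_section
    (n : ℕ) (hn : 1 ≤ n) (w : EuclideanSpace ℝ (Fin n) → ℝ)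
    (hconv : ConvexOn ℝ Set.univ w)
    (x₀ : EuclideanSpace ℝ (Fin n))
    (hline : ∀ e : EuclideanSpace ℝ (Fin n), e ≠ 0 →
      ¬ ∃ a b : ℝ, ∀ t : ℝ, w (x₀ + t • e) = a * t + b) :
    ∀ h : ℝ, 0 < h →
      ∃ p : EuclideanSpace ℝ (Fin n),
        Convex ℝ {x | w x < w x₀ + ⟪p, x - x₀⟫ + h} ∧
        IsOpen {x | w x < w x₀ + ⟪p, x - x₀⟫ + h} ∧
        ({x | w x < w x₀ + ⟪p, x - x₀⟫ + h}).Nonempty ∧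
        Bornology.IsBounded {x | w x < w x₀ + ⟪p, x - x₀⟫ + h} ∧
        0 < volume {x | w x < w x₀ + ⟪p, x - x₀⟫ + h} ∧
        (∫ x in {x | w x < w x₀ + ⟪p, x - x₀⟫ + h}, x)
          = (volume {x | w x < w x₀ + ⟪p, x - x₀⟫ + h}).toReal • x₀ := by
  intro h hh
  let u : EuclideanSpace ℝ (Fin n) → ℝ := fun y => w (x₀ + y) - (w x₀ + h)
  have hcont : Continuous w := hconv.locallyLipschitz.continuous
  have hu : ConvexOn ℝ univ u := by
    have := (hconv.translate_right x₀).sub (concaveOn_const (w x₀ + h) convex_univ)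
    rw [preimage_univ] at this
    exact this
  have h0 : u 0 < 0 := by simp [u, hh]
  obtain ⟨p, hb, hint⟩ := hu.exists_isBounded_section_integral_eq_zero volume h0 (by
    rintro e he ⟨a, b, hab⟩
    exact hline e he ⟨a, b + (w x₀ + h), fun t => by linarith [hab t]⟩)
  let S : Set (EuclideanSpace ℝ (Fin n)) := {x | w x < w x₀ + ⟪p, x - x₀⟫ + h}
  have hpre : (fun y => x₀ + y) ⁻¹' S = {y | u y < ⟪p, y⟫} := by
    ext y
    simp only [S, u, mem_preimage, mem_ofPred_eq, add_sub_cancel_left]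
    constructor <;> intro hy <;> linarith
  have himg : S = (fun y => x₀ + y) '' {y | u y < ⟪p, y⟫} := by
    rw [← hpre, image_preimage_eq _ (add_left_surjective x₀)]
  have hmp := measurePreserving_add_left (volume : Measure (EuclideanSpace ℝ (Fin n))) x₀
  have hopen : IsOpen S := isOpen_lt hcont (by fun_prop)
  have hne : S.Nonempty := ⟨x₀, by simp [S, hh]⟩
  have hbS : Bornology.IsBounded S := by
    rw [himg]
    exact hb.vadd x₀
  refine ⟨p, ?_, hopen, hne, hbS, hopen.measure_pos volume hne, ?_⟩
  · change Convex ℝ S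
    rw [himg]
    refine Convex.translate ?_ x₀
    simpa [sub_pos] using (hu.concaveOn_inner_sub p).convex_gt 0
  · change ∫ x in S, x = (volume S).toReal • x₀
    have hvol : volume {y | u y < ⟪p, y⟫} = volume S := by
      rw [← hpre, hmp.measure_preimage hopen.measurableSet.nullMeasurableSet]
    have hbi : IntegrableOn (fun y => y) {y | u y < ⟪p, y⟫} :=
      (continuous_id.continuousOn.integrableOn_compact hb.isCompact_closure).mono_set
        subset_closure
    have hconst : IntegrableOn (fun _ => x₀) {y | u y < ⟪p, y⟫} :=
      integrableOn_const hb.measure_lt_top.ne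
    rw [← hmp.setIntegral_preimage_emb (measurableEmbedding_addLeft x₀), hpre,
      integral_add hconst hbi, hint, add_zero,
      setIntegral_const, measureReal_def, hvol]
end
end
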